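/- arXiv:2102.03460 — 4 statements merged into one kernel-verified Lean document; each statement's English description precedes it below -/
import Mathlib

section
/- If t > 1 is an odd integer and r ≥ 0 is an integer, then γ*(2^r · t) ≥ γ(2^r) · γ*(t). -/
open scoped BigOperators

/-- `gamma s t` is the number of `s`-tuples `(a_1, …, a_s)` of positive integers
with `lcm(a_1, …, a_s) = t`. -/
noncomputable def gamma (s t : ℕ) : ℕ :=
  Nat.card {a : Fin s → ℕ // (∀ i, 0 < a i) ∧ Finset.univ.lcm a = t}

/-- `gammaStar s t` is the number of `s`-tuples `(a_1, …, a_s)` of integers, each `a_i > 1`,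
with `lcm(a_1, …, a_s) = t`. -/
noncomputable def gammaStar (s t : ℕ) : ℕ :=
  Nat.card {a : Fin s → ℕ // (∀ i, 1 < a i) ∧ Finset.univ.lcm a = t}

theorem finset_lcm_mul_of_coprime {ι : Type*} (S : Finset ι) (a b : ι → ℕ)
    (h : Nat.Coprime (S.lcm a) (S.lcm b)) :
    S.lcm (fun i => a i * b i) = S.lcm a * S.lcm b := by
  apply Nat.dvd_antisymm
  · exact Finset.lcm_dvd fun i hi => Nat.mul_dvd_mul (Finset.dvd_lcm hi) (Finset.dvd_lcm hi)
  · apply h.mul_dvd_of_dvd_of_dvd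
    · exact Finset.lcm_dvd fun i hi => (Dvd.intro _ rfl).trans
        (Finset.dvd_lcm (f := fun i => a i * b i) hi)
    · exact Finset.lcm_dvd fun i hi => (Dvd.intro_left _ rfl).trans
        (Finset.dvd_lcm (f := fun i => a i * b i) hi)

theorem finite_tuples_of_lcm_eq {ι : Type*} [Fintype ι] {n : ℕ} (hn : n ≠ 0)
    (P : (ι → ℕ) → Prop) : Finite {a : ι → ℕ // P a ∧ Finset.univ.lcm a = n} := by
  apply Set.Finite.subset (Set.Finite.pi' fun _ : ι => Set.finite_Iic n)
  rintro a ⟨-, ha⟩ i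
  exact Nat.le_of_dvd (Nat.pos_of_ne_zero hn) (ha ▸ Finset.dvd_lcm (Finset.mem_univ i))

/-- Coordinatewise multiplication injects pairs of tuples with coprime lcms `m` and `n` into
tuples with lcm `m * n`. -/
theorem gamma_mul_gammaStar_le (s : ℕ) {m n : ℕ} (hm : m ≠ 0) (hn : n ≠ 0)
    (hmn : Nat.Coprime m n) :
    gamma s m * gammaStar s n ≤ gammaStar s (m * n) := by
  unfold gamma gammaStar
  rw [← Nat.card_prod]
  have := finite_tuples_of_lcm_eq (ι := Fin s) (mul_ne_zero hm hn) (fun a => ∀ i, 1 < a i)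
  refine Nat.card_le_card_of_injective
    (fun p => ⟨fun i => p.1.1 i * p.2.1 i, fun i => ?_, ?_⟩) ?_
  · exact (p.2.2.1 i).trans_le (Nat.le_mul_of_pos_left _ (p.1.2.1 i))
  · rw [finset_lcm_mul_of_coprime _ _ _ (by rwa [p.1.2.2, p.2.2.2]), p.1.2.2, p.2.2.2]
  · rintro ⟨⟨a, ha, hal⟩, ⟨b, hb, hbl⟩⟩ ⟨⟨c, hc, hcl⟩, ⟨d, hd, hdl⟩⟩ h
    have hac : a = c := by
      funext i
      have hi : a i * b i = c i * d i := congrFun (congrArg Subtype.val h) i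
      have dvd_m {f : Fin s → ℕ} (hf : Finset.univ.lcm f = m) : f i ∣ m :=
        hf ▸ Finset.dvd_lcm (Finset.mem_univ i)
      have dvd_n {f : Fin s → ℕ} (hf : Finset.univ.lcm f = n) : f i ∣ n :=
        hf ▸ Finset.dvd_lcm (Finset.mem_univ i)
      apply Nat.dvd_antisymm
      · exact (hmn.of_dvd (dvd_m hal) (dvd_n hdl)).dvd_of_dvd_mul_right (hi ▸ Dvd.intro _ rfl)
      · exact (hmn.of_dvd (dvd_m hcl) (dvd_n hbl)).dvd_of_dvd_mul_right (hi ▸ Dvd.intro _ rfl)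
    subst hac
    have hbd : b = d := by
      funext i
      have hi : a i * b i = a i * d i := congrFun (congrArg Subtype.val h) i
      exact Nat.eq_of_mul_eq_mul_left (ha i) hi
    subst hbd
    rfl

/-- If `t > 1` is odd and `r ≥ 0`, then `γ*(2^r · t) ≥ γ(2^r) · γ*(t)`. -/
theorem gammaStar_two_pow_mul (s : ℕ) (hs : 1 ≤ s) (t : ℕ) (ht : 1 < t) (hodd : Odd t)
    (r : ℕ) :
    gammaStar s (2 ^ r * t) ≥ gamma s (2 ^ r) * gammaStar s t := by
  exact gamma_mul_gammaStar_le s (by positivity) (by omega) (hodd.coprime_two_left.pow_left r)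
end

section
/- The series Σ_{t=2}^∞ f(t) · γ*(t) · (log t)^s converges. -/
open scoped BigOperators

/-- `rad t` is the radical of `t`: the product of the distinct primes dividing `t`. -/
def rad (t : ℕ) : ℕ := ∏ p ∈ t.primeFactors, p

/-- `f t = 1 / (t · t₀ · φ(t))` where `t₀` is the radical of `t`. -/
noncomputable def f (t : ℕ) : ℝ := 1 / ((t : ℝ) * (rad t : ℝ) * (t.totient : ℝ))

lemma card_divisors_mul_le (m n : ℕ) :
    (m * n).divisors.card ≤ m.divisors.card * n.divisors.card := by
  open scoped Pointwise in
  rw [Nat.divisors_mul]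
  exact Finset.card_mul_le

lemma summable_card_divisors_pow_mul_rpow_neg {σ : ℝ} (hσ : 1 < σ) (k : ℕ) :
    Summable (fun n : ℕ => (n.divisors.card : ℝ) ^ k * (n : ℝ) ^ (-σ)) := by
  induction k with
  | zero => simpa using Real.summable_nat_rpow.2 (by linarith : -σ < -1)
  | succ k ih =>
    have h_prod : Summable (fun p : ℕ × ℕ =>
        ((p.1 * p.2).divisors.card : ℝ) ^ k * ((p.1 * p.2 : ℕ) : ℝ) ^ (-σ)) := by
      refine Summable.of_nonneg_of_le (fun p => by positivity) (fun p => ?_)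
        (ih.mul_of_nonneg ih (fun n => by positivity) (fun n => by positivity))
      have h : ((p.1 * p.2).divisors.card : ℝ) ≤ p.1.divisors.card * p.2.divisors.card := by
        exact_mod_cast card_divisors_mul_le p.1 p.2
      calc _ ≤ ((p.1.divisors.card : ℝ) * p.2.divisors.card) ^ k *
            ((p.1 * p.2 : ℕ) : ℝ) ^ (-σ) := by gcongr
        _ = _ := by
          rw [Nat.cast_mul, Real.mul_rpow (by positivity) (by positivity)]
          ring
    let e : (Σ n : ℕ, n.divisors) → ℕ × ℕ := fun x => (x.2, x.1 / x.2)
    have he (x : Σ n : ℕ, n.divisors) : (e x).1 * (e x).2 = x.1 :=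
      Nat.mul_div_cancel' (Nat.dvd_of_mem_divisors x.2.2)
    have h_inj : Function.Injective e := by
      intro x y hxy
      have h₁ : x.1 = y.1 := by rw [← he x, ← he y, hxy]
      have h₂ : (x.2 : ℕ) = y.2 := congrArg Prod.fst hxy
      obtain ⟨n, d⟩ := x
      obtain ⟨m, c⟩ := y
      obtain rfl : n = m := h₁
      obtain rfl : d = c := Subtype.ext h₂
      rfl
    refine (h_prod.comp_injective h_inj).sigma.congr fun n => ?_
    have h_fiber (d : n.divisors) :
        (((e ⟨n, d⟩).1 * (e ⟨n, d⟩).2).divisors.card : ℝ) ^ k *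
          (((e ⟨n, d⟩).1 * (e ⟨n, d⟩).2 : ℕ) : ℝ) ^ (-σ) =
        (n.divisors.card : ℝ) ^ k * (n : ℝ) ^ (-σ) := by rw [he]
    simp only [Function.comp_apply, h_fiber, tsum_fintype, Finset.sum_const, Finset.card_univ,
      Fintype.card_coe, nsmul_eq_mul]
    ring

lemma le_totient_mul_card_divisors (n : ℕ) : n ≤ n.totient * n.divisors.card := by
  induction n using Nat.recOnPosPrimePosCoprime with
  | zero => simp
  | one => simp
  | prime_pow p k hp hk =>
    rw [Nat.totient_prime_pow hp hk, Nat.divisors_prime_pow hp, Finset.card_map,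
      Finset.card_range]
    have h₁ : p ≤ (p - 1) * (k + 1) := by
      have := hp.two_le
      calc p ≤ (p - 1) * 2 := by omega
        _ ≤ _ := by gcongr; omega
    calc p ^ k = p ^ (k - 1) * p := (pow_sub_one_mul hk.ne' p).symm
      _ ≤ p ^ (k - 1) * ((p - 1) * (k + 1)) := by gcongr
      _ = _ := by ring
  | coprime a b ha hb hab iha ihb =>
    rw [Nat.totient_mul hab, hab.card_divisors_mul]
    calc a * b ≤ (a.totient * a.divisors.card) * (b.totient * b.divisors.card) := by gcongr
      _ = _ := by ring

lemma gammaStar_le_card_divisors_pow (s : ℕ) {t : ℕ} (ht : t ≠ 0) :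
    gammaStar s t ≤ t.divisors.card ^ s := by
  let e : {a : Fin s → ℕ // (∀ i, 1 < a i) ∧ Finset.univ.lcm a = t} → (Fin s → t.divisors) :=
    fun a i => ⟨a.1 i, Nat.mem_divisors.2
      ⟨(Finset.dvd_lcm (Finset.mem_univ i)).trans a.2.2.dvd, ht⟩⟩
  have he : Function.Injective e := fun a b h =>
    Subtype.ext (funext fun i => congrArg Subtype.val (congrFun h i))
  calc gammaStar s t ≤ Nat.card (Fin s → t.divisors) := Nat.card_le_card_of_injective e he
    _ = _ := by
      rw [Nat.card_eq_fintype_card, Fintype.card_fun, Fintype.card_coe, Fintype.card_fin]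

lemma f_nonneg (t : ℕ) : 0 ≤ f t := by
  unfold f
  positivity

lemma f_le_card_divisors_mul_rpow {t : ℕ} (ht : t ≠ 0) :
    f t ≤ t.divisors.card * (t : ℝ) ^ (-2 : ℝ) := by
  have ht₀ : (0 : ℝ) < t := by positivity
  have h_rad : (1 : ℝ) ≤ rad t := by
    exact_mod_cast Finset.prod_pos fun p hp => (Nat.prime_of_mem_primeFactors hp).pos
  have h_totient : (0 : ℝ) < t.totient := by
    exact_mod_cast Nat.totient_pos.2 (Nat.pos_of_ne_zero ht)
  have h : (t : ℝ) ≤ t.totient * t.divisors.card := by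
    exact_mod_cast le_totient_mul_card_divisors t
  rw [f, Real.rpow_neg ht₀.le, Real.rpow_two, ← div_eq_mul_inv,
    div_le_div_iff₀ (by positivity) (by positivity)]
  calc 1 * (t : ℝ) ^ 2 = t * 1 * t := by ring
    _ ≤ t * rad t * (t.totient * t.divisors.card) := by gcongr
    _ = _ := by ring

/-- The series `Σ_{t=2}^∞ f(t) · γ*(t) · (log t)^s` converges. -/
theorem summable_f_gammaStar_log_pow (s : ℕ) (hs : 1 ≤ s) :
    Summable (fun t : ℕ =>
      if 2 ≤ t then f t * (gammaStar s t : ℝ) * (Real.log t) ^ s else 0) := by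
  have h_log : ∀ᶠ t : ℕ in Filter.atTop, Real.log t ^ s ≤ (t : ℝ) ^ (1 / 2 : ℝ) := by
    have h := (isLittleO_log_rpow_rpow_atTop (s : ℝ) (by norm_num : (0 : ℝ) < 1 / 2)).bound
      one_pos
    filter_upwards [tendsto_natCast_atTop_atTop.eventually h] with t ht
    rw [Real.rpow_natCast, one_mul, Real.norm_of_nonneg (r := (t : ℝ) ^ (1 / 2 : ℝ))
      (by positivity)] at ht
    exact (Real.le_norm_self _).trans ht
  refine Summable.of_norm_bounded_eventually_nat
    (summable_card_divisors_pow_mul_rpow_neg (by norm_num : (1 : ℝ) < 3 / 2) (s + 1)) ?_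
  filter_upwards [h_log, Filter.eventually_ge_atTop 2] with t ht h2
  have ht₀ : (0 : ℝ) < t := by positivity
  have h_log_nonneg : 0 ≤ Real.log t := Real.log_natCast_nonneg t
  have h_gamma : (gammaStar s t : ℝ) ≤ (t.divisors.card : ℝ) ^ s := by
    exact_mod_cast gammaStar_le_card_divisors_pow s (by omega)
  have h_f := f_nonneg t
  rw [if_pos h2, Real.norm_of_nonneg (by positivity)]
  calc f t * gammaStar s t * Real.log t ^ s
      ≤ (t.divisors.card * (t : ℝ) ^ (-2 : ℝ)) * (t.divisors.card : ℝ) ^ s *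
          (t : ℝ) ^ (1 / 2 : ℝ) := by
        gcongr
        exact f_le_card_divisors_mul_rpow (by omega)
    _ = (t.divisors.card : ℝ) ^ (s + 1) * ((t : ℝ) ^ (-2 : ℝ) * (t : ℝ) ^ (1 / 2 : ℝ)) := by ring
    _ = _ := by
        rw [← Real.rpow_add ht₀]
        norm_num
end

section
/- For all integers t ≥ 2 and u ≥ 8, one has φ(t) · Σ_{p prime, p ≡ 1 (mod t), p ∣ u} 1/p ≤ 3 + 2 · log(log(log u / log 2)). -/
open scoped BigOperators

open ArithmeticFunction in
theorem sum_moebius_filter_dvd_dvd {P : Finset ℕ} {k m : ℕ} (hm : Squarefree m) (hkm : k ∣ m)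
    (hP : ∀ d, d ∣ m → d ∈ P) :
    ∑ d ∈ P with k ∣ d ∧ d ∣ m, (moebius d : ℝ) = if m = k then (moebius k : ℝ) else 0 := by
  obtain ⟨l, rfl⟩ := hkm
  have hm0 : k * l ≠ 0 := hm.ne_zero
  have hk0 : k ≠ 0 := left_ne_zero_of_mul hm0
  have hl0 : l ≠ 0 := right_ne_zero_of_mul hm0
  have hcop : k.Coprime l := Nat.coprime_of_squarefree_mul hm
  have h1 : {d ∈ P | k ∣ d ∧ d ∣ k * l} = l.divisors.image (k * ·) := by
    ext d
    simp only [Finset.mem_filter, Finset.mem_image, Nat.mem_divisors]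
    constructor
    · rintro ⟨-, ⟨f, rfl⟩, h⟩
      exact ⟨f, ⟨Nat.dvd_of_mul_dvd_mul_left (Nat.pos_of_ne_zero hk0) h, hl0⟩, rfl⟩
    · rintro ⟨f, ⟨hf, -⟩, rfl⟩
      exact ⟨hP _ (mul_dvd_mul_left k hf), dvd_mul_right _ _, mul_dvd_mul_left k hf⟩
  rw [h1, Finset.sum_image fun a _ b _ h => Nat.eq_of_mul_eq_mul_left (Nat.pos_of_ne_zero hk0) h]
  have h2 : ∀ f ∈ l.divisors, (moebius (k * f) : ℝ) = moebius k * moebius f := by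
    intro f hf
    rw [isMultiplicative_moebius.map_mul_of_coprime
      (hcop.coprime_dvd_right (Nat.dvd_of_mem_divisors hf))]
    push_cast; rfl
  rw [Finset.sum_congr rfl h2, ← Finset.mul_sum]
  have h3 : ∑ f ∈ l.divisors, moebius f = if l = 1 then 1 else 0 := by
    rw [← coe_zeta_mul_apply, coe_zeta_mul_moebius, one_apply]
  have h4 : ∑ f ∈ l.divisors, (moebius f : ℝ) = if l = 1 then 1 else 0 := by
    exact_mod_cast congrArg (Int.cast : ℤ → ℝ) h3
  rw [h4]
  by_cases hl : l = 1
  · simp [hl]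
  · have : k * l ≠ k := fun h => hl (by simpa [hk0] using h)
    simp [hl, this]

theorem totient_eq_mul_prod_one_sub_inv (n : ℕ) :
    (n.totient : ℝ) = n * ∏ p ∈ n.primeFactors, (1 - (p : ℝ)⁻¹) := by
  have := congrArg (Rat.cast : ℚ → ℝ) (Nat.totient_eq_mul_prod_factors n)
  push_cast at this
  exact this

theorem sum_inv_factoredNumbers_le {r : ℕ} (hr : r ≠ 0) (B : Finset ℕ)
    (hB : ∀ h ∈ B, h ∈ Nat.factoredNumbers r.primeFactors) :
    ∑ h ∈ B, (1 : ℝ) / h ≤ r / r.totient := by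
  let f : ℕ →* ℝ :=
    { toFun := fun n => (n : ℝ)⁻¹
      map_one' := by simp
      map_mul' := fun a b => by push_cast; exact mul_inv _ _ }
  have hf : ∀ {p : ℕ}, p.Prime → ‖f p‖ < 1 := fun {p} hp => by
    change ‖(p : ℝ)⁻¹‖ < 1
    rw [norm_inv, Real.norm_natCast]
    exact inv_lt_one_of_one_lt₀ (by exact_mod_cast hp.one_lt)
  obtain ⟨-, h2⟩ :=
    EulerProduct.summable_and_hasSum_factoredNumbers_prod_filter_prime_geometric hf r.primeFactors
  have h3 : ∏ p ∈ r.primeFactors with p.Prime, (1 - f p)⁻¹ = (r : ℝ) / r.totient := by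
    rw [Finset.filter_true_of_mem fun p hp => Nat.prime_of_mem_primeFactors hp]
    have hr' : (r : ℝ) ≠ 0 := by exact_mod_cast hr
    rw [totient_eq_mul_prod_one_sub_inv, Finset.prod_inv_distrib, div_mul_eq_div_div, div_self hr', one_div]
    rfl
  rw [h3] at h2
  have h5 : ∑ h ∈ B, (1 : ℝ) / h = ∑ h ∈ B.subtype (· ∈ Nat.factoredNumbers r.primeFactors),
      f h := by
    rw [Finset.sum_subtype_of_mem (fun n : ℕ => f n) hB]
    exact Finset.sum_congr rfl fun x _ => one_div _
  rw [h5]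
  exact sum_le_hasSum _ (fun i _ => inv_nonneg.2 (Nat.cast_nonneg _)) h2

theorem sum_inv_totient_divisors {d : ℕ} (hd : Squarefree d) :
    ∑ k ∈ d.divisors, (1 : ℝ) / k.totient = d / d.totient := by
  have hd0 : 0 < d := Nat.pos_of_ne_zero hd.ne_zero
  have hφ : (d.totient : ℝ) ≠ 0 := by exact_mod_cast (Nat.totient_pos.2 hd0).ne'
  rw [eq_div_iff hφ]
  conv_rhs => rw [← Nat.sum_totient d, ← Nat.sum_div_divisors]
  push_cast
  rw [Finset.sum_mul]
  refine Finset.sum_congr rfl fun k hk => ?_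
  obtain ⟨l, rfl⟩ := Nat.dvd_of_mem_divisors hk
  have hk0 : 0 < k := Nat.pos_of_mul_pos_right hd0
  have hkφ : (k.totient : ℝ) ≠ 0 := by exact_mod_cast (Nat.totient_pos.2 hk0).ne'
  rw [Nat.totient_mul (Nat.coprime_of_squarefree_mul hd), Nat.mul_div_cancel_left _ hk0]
  push_cast
  field_simp

theorem abs_card_filter_dvd_mul_add_one_sub_le {t m : ℕ} (hm : 0 < m) (h : m.Coprime t) (N : ℕ) :
    |(((Finset.Ioc 0 N).filter fun n => m ∣ t * n + 1).card : ℝ) - N / m| ≤ 1 := by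
  obtain ⟨v, hv⟩ : ∃ v : ℕ, m ∣ t * v + 1 := by
    have : NeZero m := ⟨hm.ne'⟩
    refine ⟨(-(t : ZMod m)⁻¹).val, ?_⟩
    rw [← ZMod.natCast_eq_zero_iff]
    push_cast
    rw [ZMod.natCast_zmod_val, mul_neg, ZMod.coe_mul_inv_eq_one _ h.symm]
    simp
  have h1 : (Finset.Ioc 0 N).filter (fun n => m ∣ t * n + 1) =
      (Finset.Ioc 0 N).filter (fun n => n ≡ v [MOD m]) := by
    refine Finset.filter_congr fun n _ => ?_
    constructor
    · intro hn
      have h2 : t * n + 1 ≡ t * v + 1 [MOD m] :=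
        ((Nat.modEq_zero_iff_dvd.2 hn).trans (Nat.modEq_zero_iff_dvd.2 hv).symm)
      exact Nat.ModEq.cancel_left_of_coprime h (Nat.ModEq.add_right_cancel' 1 h2)
    · intro hn
      have h2 : t * n + 1 ≡ t * v + 1 [MOD m] := (hn.mul_left t).add_right 1
      exact Nat.modEq_zero_iff_dvd.1 (h2.trans (Nat.modEq_zero_iff_dvd.2 hv))
  rw [h1]
  have h2 := Nat.Ioc_filter_modEq_card 0 N hm v
  have hmQ : (0 : ℚ) < m := by exact_mod_cast hm
  set a : ℚ := ((N : ℚ) - v) / m with ha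
  set b : ℚ := (((0 : ℕ) : ℚ) - v) / m with hb
  have hab : a - b = N / m := by rw [ha, hb]; push_cast; ring
  have hle : b ≤ a := by
    have : (0 : ℚ) ≤ N / m := by positivity
    linarith
  rw [max_eq_left (sub_nonneg.2 (Int.floor_mono hle))] at h2
  have h3 : (((Finset.Ioc 0 N).filter (fun n => n ≡ v [MOD m])).card : ℚ) = ⌊a⌋ - ⌊b⌋ := by
    exact_mod_cast congrArg (Int.cast : ℤ → ℚ) h2
  have h4 : |(((Finset.Ioc 0 N).filter (fun n => n ≡ v [MOD m])).card : ℚ) - N / m| ≤ 1 := by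
    rw [h3, ← hab, abs_le]
    have := Int.floor_le a
    have := Int.lt_floor_add_one a
    have := Int.floor_le b
    have := Int.lt_floor_add_one b
    constructor <;> linarith
  have h5 := (Rat.cast_le (K := ℝ)).2 h4
  push_cast at h5
  exact h5

/-- The squarefree `m ≤ Q` coprime to `t`. -/
def sieveSupport (t Q : ℕ) : Finset ℕ := {m ∈ Finset.Icc 1 Q | Squarefree m ∧ m.Coprime t}

/-- The Selberg sum `∑ 1 / φ(m)` over the squarefree `m ≤ Q` coprime to `t`. -/
noncomputable def sieveMass (t Q : ℕ) : ℝ := ∑ m ∈ sieveSupport t Q, (1 : ℝ) / m.totient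

/-- Selberg's weights of level `Q` for sieving by primes not dividing `t`. -/
noncomputable def sieveWeight (t Q d : ℕ) : ℝ :=
  ArithmeticFunction.moebius d * d / sieveMass t Q *
    ∑ m ∈ sieveSupport t Q with d ∣ m, (1 : ℝ) / m.totient

theorem mem_sieveSupport {t Q m : ℕ} :
    m ∈ sieveSupport t Q ↔ (1 ≤ m ∧ m ≤ Q) ∧ Squarefree m ∧ m.Coprime t := by
  simp [sieveSupport]

theorem mem_sieveSupport_of_dvd {t Q m d : ℕ} (hm : m ∈ sieveSupport t Q) (hd : d ∣ m) :
    d ∈ sieveSupport t Q := by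
  rw [mem_sieveSupport] at *
  obtain ⟨⟨h1, h2⟩, h3, h4⟩ := hm
  exact ⟨⟨Nat.pos_of_dvd_of_pos hd h1, (Nat.le_of_dvd h1 hd).trans h2⟩,
    h3.squarefree_of_dvd hd, h4.coprime_dvd_left hd⟩

theorem totient_pos_of_mem_sieveSupport {t Q m : ℕ} (hm : m ∈ sieveSupport t Q) :
    (0 : ℝ) < m.totient := by
  exact_mod_cast Nat.totient_pos.2 (mem_sieveSupport.1 hm).1.1

theorem one_mem_sieveSupport (t : ℕ) {Q : ℕ} (hQ : 1 ≤ Q) : 1 ∈ sieveSupport t Q :=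
  mem_sieveSupport.2 ⟨⟨le_rfl, hQ⟩, squarefree_one, Nat.coprime_one_left t⟩

theorem sieveMass_pos (t : ℕ) {Q : ℕ} (hQ : 1 ≤ Q) : 0 < sieveMass t Q :=
  Finset.sum_pos (fun _ hm => div_pos one_pos (totient_pos_of_mem_sieveSupport hm))
    ⟨1, one_mem_sieveSupport t hQ⟩

theorem sieveWeight_one (t : ℕ) {Q : ℕ} (hQ : 1 ≤ Q) : sieveWeight t Q 1 = 1 := by
  have h := (sieveMass_pos t hQ).ne'
  have h2 : ∑ m ∈ sieveSupport t Q with 1 ∣ m, (1 : ℝ) / m.totient = sieveMass t Q := by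
    simp [sieveMass]
  rw [sieveWeight, h2]
  simp [h]

theorem mul_sum_filter_dvd_le_sieveMass {t Q d : ℕ} (hd : d ∈ sieveSupport t Q) :
    (d : ℝ) * ∑ m ∈ sieveSupport t Q with d ∣ m, (1 : ℝ) / m.totient ≤ sieveMass t Q := by
  obtain ⟨⟨hd1, -⟩, hds, -⟩ := mem_sieveSupport.1 hd
  set S := {m ∈ sieveSupport t Q | d ∣ m} with hS
  have key : ∀ m ∈ S, ∃ l, m = d * l ∧ d.Coprime l ∧ m ∈ sieveSupport t Q := by
    intro m hm
    rw [hS, Finset.mem_filter] at hm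
    obtain ⟨hm, l, rfl⟩ := hm
    have := (mem_sieveSupport.1 hm).2.1
    exact ⟨l, rfl, Nat.coprime_of_squarefree_mul this, hm⟩
  have h1 : (d : ℝ) * ∑ m ∈ S, (1 : ℝ) / m.totient =
      ∑ x ∈ S ×ˢ d.divisors, (1 : ℝ) / (x.2 * (x.1 / d)).totient := by
    rw [Finset.mul_sum, Finset.sum_product]
    refine Finset.sum_congr rfl fun m hm => ?_
    obtain ⟨l, rfl, hdl, -⟩ := key m hm
    simp only [Nat.mul_div_cancel_left _ hd1]
    have h2 : ∀ k ∈ d.divisors, (1 : ℝ) / (k * l).totient = 1 / k.totient * (1 / l.totient) := by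
      intro k hk
      rw [Nat.totient_mul (hdl.coprime_dvd_left (Nat.dvd_of_mem_divisors hk))]
      push_cast
      rw [one_div_mul_one_div]
    rw [Finset.sum_congr rfl h2, ← Finset.sum_mul, sum_inv_totient_divisors hds,
      Nat.totient_mul hdl]
    push_cast
    rw [div_mul_div_comm, mul_one, mul_one_div]
  have hinj : Set.InjOn (fun x : ℕ × ℕ => x.2 * (x.1 / d)) (S ×ˢ d.divisors : Finset (ℕ × ℕ)) := by
    rintro ⟨m, k⟩ h ⟨m', k'⟩ h' heq
    simp only [Finset.coe_product, Set.mem_prod, Finset.mem_coe] at h h'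
    obtain ⟨l, rfl, hdl, -⟩ := key m h.1
    obtain ⟨l', rfl, hdl', -⟩ := key m' h'.1
    have hk := Nat.dvd_of_mem_divisors h.2
    have hk' := Nat.dvd_of_mem_divisors h'.2
    simp only [Nat.mul_div_cancel_left _ hd1] at heq
    have e1 : k = k' := by
      have := congrArg (fun z => d.gcd z) heq
      rwa [hdl.symm.gcd_mul_right_cancel_right, hdl'.symm.gcd_mul_right_cancel_right,
        Nat.gcd_eq_right hk, Nat.gcd_eq_right hk'] at this
    subst e1
    have e2 : l = l' :=
      Nat.eq_of_mul_eq_mul_left (Nat.pos_of_dvd_of_pos hk hd1) heq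
    rw [e2]
  rw [h1, ← Finset.sum_image (f := fun n : ℕ => (1 : ℝ) / n.totient) hinj, sieveMass]
  refine Finset.sum_le_sum_of_subset_of_nonneg ?_ fun _ _ _ => by positivity
  intro n hn
  rw [Finset.mem_image] at hn
  obtain ⟨⟨m, k⟩, hx, rfl⟩ := hn
  rw [Finset.mem_product] at hx
  obtain ⟨l, rfl, -, hmem⟩ := key m hx.1
  simp only [Nat.mul_div_cancel_left _ hd1]
  exact mem_sieveSupport_of_dvd hmem
    (mul_dvd_mul_right (Nat.dvd_of_mem_divisors hx.2) l)

theorem abs_sieveWeight_le_one {t Q d : ℕ} (hd : d ∈ sieveSupport t Q) :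
    |sieveWeight t Q d| ≤ 1 := by
  have hQ : 1 ≤ Q := (mem_sieveSupport.1 hd).1.1.trans (mem_sieveSupport.1 hd).1.2
  have hL := sieveMass_pos t hQ
  have h := mul_sum_filter_dvd_le_sieveMass hd
  have hμ : |(ArithmeticFunction.moebius d : ℝ)| ≤ 1 := by
    exact_mod_cast ArithmeticFunction.abs_moebius_le_one
  have hnn : 0 ≤ (d : ℝ) * ∑ m ∈ sieveSupport t Q with d ∣ m, (1 : ℝ) / m.totient := by positivity
  have e : sieveWeight t Q d = ArithmeticFunction.moebius d *
      (((d : ℝ) * ∑ m ∈ sieveSupport t Q with d ∣ m, (1 : ℝ) / m.totient) / sieveMass t Q) := by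
    rw [sieveWeight]; ring
  rw [e, abs_mul, abs_of_nonneg (div_nonneg hnn hL.le)]
  exact mul_le_one₀ hμ (div_nonneg hnn hL.le) ((div_le_one hL).2 h)

theorem sum_sieveWeight_div_filter_dvd {t Q k : ℕ} (hk : k ∈ sieveSupport t Q) :
    ∑ d ∈ sieveSupport t Q with k ∣ d, sieveWeight t Q d / d =
      ArithmeticFunction.moebius k / (sieveMass t Q * k.totient) := by
  have h1 : ∀ d ∈ {d ∈ sieveSupport t Q | k ∣ d}, sieveWeight t Q d / d =
      ∑ m ∈ sieveSupport t Q, if d ∣ m then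
        (ArithmeticFunction.moebius d : ℝ) * (1 / sieveMass t Q * (1 / m.totient)) else 0 := by
    intro d hd
    have hd1 := (mem_sieveSupport.1 (Finset.mem_filter.1 hd).1).1.1
    have hd0 : (d : ℝ) ≠ 0 := by exact_mod_cast (Nat.pos_iff_ne_zero.1 hd1)
    rw [← Finset.sum_filter, ← Finset.mul_sum, ← Finset.mul_sum, sieveWeight]
    field_simp
  rw [Finset.sum_congr rfl h1, Finset.sum_comm]
  have h2 : ∀ m ∈ sieveSupport t Q, (∑ d ∈ sieveSupport t Q with k ∣ d, if d ∣ m then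
        (ArithmeticFunction.moebius d : ℝ) * (1 / sieveMass t Q * (1 / m.totient)) else 0) =
      if m = k then (ArithmeticFunction.moebius k : ℝ) * (1 / sieveMass t Q * (1 / m.totient))
      else 0 := by
    intro m hm
    rw [← Finset.sum_filter, Finset.filter_filter, ← Finset.sum_mul]
    by_cases hkm : k ∣ m
    · rw [sum_moebius_filter_dvd_dvd (mem_sieveSupport.1 hm).2.1 hkm
        fun d hd => mem_sieveSupport_of_dvd hm hd]
      split_ifs <;> simp
    · rw [if_neg (fun h : m = k => hkm (h ▸ dvd_rfl)), Finset.filter_false_of_mem]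
      · simp
      · rintro d - ⟨h, h'⟩
        exact hkm (h.trans h')
  rw [Finset.sum_congr rfl h2, Finset.sum_ite_eq' _ k, if_pos hk]
  rw [one_div_mul_one_div, mul_one_div]

theorem sum_sieveWeight_mul_div_lcm (t : ℕ) {Q : ℕ} (hQ : 1 ≤ Q) :
    ∑ d ∈ sieveSupport t Q, ∑ e ∈ sieveSupport t Q,
      sieveWeight t Q d * sieveWeight t Q e / (d.lcm e : ℕ) = 1 / sieveMass t Q := by
  have hL := (sieveMass_pos t hQ).ne'
  have h1 : ∀ d ∈ sieveSupport t Q, ∀ e ∈ sieveSupport t Q,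
      sieveWeight t Q d * sieveWeight t Q e / (d.lcm e : ℕ) =
      ∑ k ∈ sieveSupport t Q, (k.totient : ℝ) *
        ((if k ∣ d then sieveWeight t Q d / d else 0) *
          (if k ∣ e then sieveWeight t Q e / e else 0)) := by
    intro d hd e he
    have hd0 : (d : ℝ) ≠ 0 := by exact_mod_cast Nat.pos_iff_ne_zero.1 (mem_sieveSupport.1 hd).1.1
    have he0 : (e : ℝ) ≠ 0 := by exact_mod_cast Nat.pos_iff_ne_zero.1 (mem_sieveSupport.1 he).1.1
    have hg : ((d.gcd e : ℕ) : ℝ) * (d.lcm e : ℕ) = d * e := by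
      exact_mod_cast Nat.gcd_mul_lcm d e
    have hl0 : ((d.lcm e : ℕ) : ℝ) ≠ 0 := by
      intro h
      rw [h, mul_zero] at hg
      exact mul_ne_zero hd0 he0 hg.symm
    have hsum : ((d.gcd e : ℕ) : ℝ) = ∑ k ∈ sieveSupport t Q with k ∣ d ∧ k ∣ e,
        (k.totient : ℝ) := by
      rw [← Nat.sum_totient (d.gcd e)]
      push_cast
      refine Finset.sum_congr ?_ fun _ _ => rfl
      ext k
      simp only [Nat.mem_divisors, Finset.mem_filter, Nat.dvd_gcd_iff]
      constructor
      · rintro ⟨h, -⟩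
        exact ⟨mem_sieveSupport_of_dvd hd h.1, h⟩
      · rintro ⟨-, h⟩
        refine ⟨h, fun h0 => hd0 ?_⟩
        exact_mod_cast (Nat.gcd_eq_zero_iff.1 h0).1
    have h2 : ∀ k ∈ sieveSupport t Q, (k.totient : ℝ) *
        ((if k ∣ d then sieveWeight t Q d / d else 0) *
          (if k ∣ e then sieveWeight t Q e / e else 0)) =
        if k ∣ d ∧ k ∣ e then
          (k.totient : ℝ) * (sieveWeight t Q d / d * (sieveWeight t Q e / e)) else 0 := by
      intro k _
      by_cases ha : k ∣ d <;> by_cases hb : k ∣ e <;> simp [ha, hb]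
    rw [Finset.sum_congr rfl h2, ← Finset.sum_filter, ← Finset.sum_mul, ← hsum,
      div_mul_div_comm, ← hg]
    have hg0 : ((d.gcd e : ℕ) : ℝ) ≠ 0 := by
      intro h
      rw [h, zero_mul] at hg
      exact mul_ne_zero hd0 he0 hg.symm
    field_simp
  rw [Finset.sum_congr rfl fun d hd => Finset.sum_congr rfl (h1 d hd)]
  have h3 : ∑ d ∈ sieveSupport t Q, ∑ e ∈ sieveSupport t Q, ∑ k ∈ sieveSupport t Q,
      (k.totient : ℝ) * ((if k ∣ d then sieveWeight t Q d / d else 0) *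
          (if k ∣ e then sieveWeight t Q e / e else 0)) =
      ∑ k ∈ sieveSupport t Q, (k.totient : ℝ) *
        (∑ d ∈ sieveSupport t Q with k ∣ d, sieveWeight t Q d / d) ^ 2 := by
    rw [Finset.sum_congr rfl fun d _ => Finset.sum_comm, Finset.sum_comm]
    refine Finset.sum_congr rfl fun k _ => ?_
    rw [sq, Finset.sum_filter, Finset.sum_mul_sum, Finset.mul_sum]
    exact Finset.sum_congr rfl fun d _ => (Finset.mul_sum _ _ _).symm
  rw [h3]
  have h4 : ∀ k ∈ sieveSupport t Q, (k.totient : ℝ) *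
        (∑ d ∈ sieveSupport t Q with k ∣ d, sieveWeight t Q d / d) ^ 2 =
      1 / sieveMass t Q ^ 2 * (1 / k.totient) := by
    intro k hk
    have hφ := (totient_pos_of_mem_sieveSupport hk).ne'
    have hμ : (ArithmeticFunction.moebius k : ℝ) ^ 2 = 1 := by
      exact_mod_cast ArithmeticFunction.moebius_sq_eq_one_of_squarefree (mem_sieveSupport.1 hk).2.1
    rw [sum_sieveWeight_div_filter_dvd hk, div_pow, hμ]
    field_simp
  rw [Finset.sum_congr rfl h4, ← Finset.mul_sum, ← sieveMass]
  field_simp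

theorem totient_mul_log_le_sieveMass {t : ℕ} (ht : 0 < t) (Q : ℕ) :
    (t.totient : ℝ) / t * Real.log (Q + 1) ≤ sieveMass t Q := by
  have htφ : (0 : ℝ) < t.totient := by exact_mod_cast Nat.totient_pos.2 ht
  have ht0 : (0 : ℝ) < t := by exact_mod_cast ht
  have hlog : Real.log (Q + 1) ≤ ∑ n ∈ Finset.Icc 1 Q, (1 : ℝ) / n := by
    have h := log_add_one_le_harmonic Q
    rw [harmonic_eq_sum_Icc] at h
    push_cast at h
    simpa [one_div] using h
  let r : ℕ → ℕ := fun n => ∏ p ∈ n.primeFactors \ t.primeFactors, p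
  have hr0 : ∀ n, 0 < r n := fun n => Finset.prod_pos fun p hp =>
    (Nat.prime_of_mem_primeFactors (Finset.mem_sdiff.1 hp).1).pos
  have hrn : ∀ n, r n ∣ n := fun n =>
    (Finset.prod_dvd_prod_of_subset _ _ _ Finset.sdiff_subset).trans (Nat.prod_primeFactors_dvd n)
  have hrp : ∀ n, (r n).primeFactors = n.primeFactors \ t.primeFactors := fun n =>
    Nat.primeFactors_prod fun p hp => Nat.prime_of_mem_primeFactors (Finset.mem_sdiff.1 hp).1
  have hmaps : ∀ n ∈ Finset.Icc 1 Q, r n ∈ sieveSupport t Q := by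
    intro n hn
    rw [Finset.mem_Icc] at hn
    refine mem_sieveSupport.2 ⟨⟨hr0 n, (Nat.le_of_dvd hn.1 (hrn n)).trans hn.2⟩, ?_, ?_⟩
    · have hp : ∀ p ∈ n.primeFactors \ t.primeFactors, p.Prime := fun p hp =>
        Nat.prime_of_mem_primeFactors (Finset.mem_sdiff.1 hp).1
      refine Finset.squarefree_prod_of_pairwise_isCoprime (fun a ha b hb hab => ?_)
        fun p h => (hp p h).squarefree
      exact Nat.coprime_iff_isRelPrime.1 ((Nat.coprime_primes (hp a ha) (hp b hb)).2 hab)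
    · rw [← Nat.disjoint_primeFactors (hr0 n).ne' ht.ne', hrp]
      exact Finset.sdiff_disjoint
  have hfib : ∀ m ∈ sieveSupport t Q, ∑ n ∈ Finset.Icc 1 Q with r n = m, (1 : ℝ) / n ≤
      t / t.totient * (1 / m.totient) := by
    intro m hm
    obtain ⟨⟨hm1, -⟩, -, hmt⟩ := mem_sieveSupport.1 hm
    have hm0 : (0 : ℝ) < m := by exact_mod_cast hm1
    have hmφ := totient_pos_of_mem_sieveSupport hm
    have hdvd : ∀ n ∈ {n ∈ Finset.Icc 1 Q | r n = m}, m * (n / m) = n := fun n hn =>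
      Nat.mul_div_cancel' ((Finset.mem_filter.1 hn).2 ▸ hrn n)
    have e : ∑ n ∈ Finset.Icc 1 Q with r n = m, (1 : ℝ) / n =
        1 / m * ∑ h ∈ {n ∈ Finset.Icc 1 Q | r n = m}.image (· / m), (1 : ℝ) / h := by
      rw [Finset.sum_image, Finset.mul_sum]
      · refine Finset.sum_congr rfl fun n hn => ?_
        rw [one_div_mul_one_div, ← Nat.cast_mul, hdvd n hn]
      · intro a ha b hb hab
        rw [← hdvd a ha, ← hdvd b hb]
        exact congrArg (m * ·) hab
    have hB := sum_inv_factoredNumbers_le (r := m * t) (by positivity)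
      ({n ∈ Finset.Icc 1 Q | r n = m}.image (· / m)) (by
        intro h hh
        obtain ⟨n, hn, rfl⟩ := Finset.mem_image.1 hh
        have hn' := Finset.mem_filter.1 hn
        have hn1 : n ≠ 0 := by have := (Finset.mem_Icc.1 hn'.1).1; omega
        have hq : n / m ≠ 0 := fun h0 => hn1 (by rw [← hdvd n hn, h0, mul_zero])
        refine Nat.mem_factoredNumbers_of_primeFactors_subset hq ?_
        refine (Nat.primeFactors_mono (Nat.div_dvd_of_dvd (hn'.2 ▸ hrn n)) hn1).trans ?_
        rw [Nat.primeFactors_mul (by omega) (by omega), ← hn'.2, hrp, Finset.sdiff_union_self_eq_union]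
        exact Finset.subset_union_left)
    rw [e]
    refine (mul_le_mul_of_nonneg_left hB (by positivity)).trans_eq ?_
    rw [Nat.totient_mul hmt]
    push_cast
    field_simp
  have h2 : ∑ n ∈ Finset.Icc 1 Q, (1 : ℝ) / n ≤ t / t.totient * sieveMass t Q := by
    rw [← Finset.sum_fiberwise_of_maps_to hmaps, sieveMass, Finset.mul_sum]
    exact Finset.sum_le_sum hfib
  have h3 := mul_le_mul_of_nonneg_left (hlog.trans h2)
    (show (0 : ℝ) ≤ t.totient / t by positivity)
  refine h3.trans_eq ?_
  field_simp

theorem card_sieveSupport_le {t : ℕ} (ht : 2 ∣ t) (Q : ℕ) :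
    ((sieveSupport t Q).card : ℝ) ≤ (Q + 1) / 2 := by
  have hodd : ∀ m ∈ sieveSupport t Q, m % 2 = 1 := fun m hm =>
    Nat.odd_iff.1 (Nat.coprime_two_right.1 ((mem_sieveSupport.1 hm).2.2.coprime_dvd_right ht))
  have h : (sieveSupport t Q).card ≤ (Finset.range ((Q + 1) / 2)).card := by
    refine Finset.card_le_card_of_injOn (· / 2) ?_ ?_
    · intro m hm
      have h1 := hodd m hm
      have h2 := (mem_sieveSupport.1 hm).1
      simp only [Finset.coe_range, Set.mem_Iio]
      omega
    · intro a ha b hb hab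
      have h1 := hodd a ha
      have h2 := hodd b hb
      simp only at hab
      omega
  rw [Finset.card_range] at h
  have h2 : 2 * (sieveSupport t Q).card ≤ Q + 1 := by omega
  have h3 : (2 : ℝ) * (sieveSupport t Q).card ≤ Q + 1 := by exact_mod_cast h2
  linarith

theorem card_filter_prime_mul_add_one_le (t : ℕ) {Q : ℕ} (hQ : 1 ≤ Q) (N : ℕ) :
    (((Finset.Ioc 0 N).filter fun n => (t * n + 1).Prime ∧ Q < t * n + 1).card : ℝ) ≤
      N / sieveMass t Q + (sieveSupport t Q).card ^ 2 := by
  set P := sieveSupport t Q with hP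
  let w := sieveWeight t Q
  let c : ℕ → ℝ := fun m => (((Finset.Ioc 0 N).filter fun n => m ∣ t * n + 1).card : ℝ)
  have h1 : (((Finset.Ioc 0 N).filter fun n => (t * n + 1).Prime ∧ Q < t * n + 1).card : ℝ) ≤
      ∑ n ∈ Finset.Ioc 0 N, (∑ d ∈ P, if d ∣ t * n + 1 then w d else 0) ^ 2 := by
    rw [Finset.card_filter]
    push_cast
    refine Finset.sum_le_sum fun n _ => ?_
    split_ifs with h
    · have h2 : ∑ d ∈ P, (if d ∣ t * n + 1 then w d else 0) = 1 := by
        rw [Finset.sum_eq_single 1]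
        · simp [w, sieveWeight_one t hQ]
        · intro d hd hd1
          have hd' := (mem_sieveSupport.1 hd).1
          rw [if_neg]
          intro hdvd
          rcases (Nat.dvd_prime h.1).1 hdvd with h3 | h3
          · exact hd1 h3
          · omega
        · exact fun h => absurd (one_mem_sieveSupport t hQ) h
      rw [h2]; norm_num
    · positivity
  have h2 : ∑ n ∈ Finset.Ioc 0 N, (∑ d ∈ P, if d ∣ t * n + 1 then w d else 0) ^ 2 =
      ∑ d ∈ P, ∑ e ∈ P, w d * w e * c (d.lcm e) := by
    simp_rw [sq, Finset.sum_mul_sum]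
    rw [Finset.sum_comm]
    refine Finset.sum_congr rfl fun d _ => ?_
    rw [Finset.sum_comm]
    refine Finset.sum_congr rfl fun e _ => ?_
    simp only [c]
    rw [Finset.card_filter]
    push_cast
    rw [Finset.mul_sum]
    refine Finset.sum_congr rfl fun n _ => ?_
    by_cases ha : d ∣ t * n + 1 <;> by_cases hb : e ∣ t * n + 1 <;>
      simp [ha, hb, Nat.lcm_dvd_iff]
  have h3 : ∀ d ∈ P, ∀ e ∈ P,
      w d * w e * c (d.lcm e) ≤ N * (w d * w e / (d.lcm e : ℕ)) + 1 := by
    intro d hd e he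
    have hd' := mem_sieveSupport.1 hd
    have he' := mem_sieveSupport.1 he
    have hpos : 0 < d.lcm e := Nat.lcm_pos hd'.1.1 he'.1.1
    have hcop : (d.lcm e).Coprime t :=
      (hd'.2.2.mul_left he'.2.2).coprime_dvd_left (Nat.lcm_dvd_mul d e)
    have hc := abs_card_filter_dvd_mul_add_one_sub_le hpos hcop N
    have hw : |w d * w e| ≤ 1 := by
      rw [abs_mul]
      exact mul_le_one₀ (abs_sieveWeight_le_one hd) (abs_nonneg _) (abs_sieveWeight_le_one he)
    have h4 : w d * w e * (c (d.lcm e) - N / (d.lcm e : ℕ)) ≤ 1 := by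
      refine (le_abs_self _).trans ?_
      rw [abs_mul]
      exact mul_le_one₀ hw (abs_nonneg _) hc
    have h5 : w d * w e * c (d.lcm e) = N * (w d * w e / (d.lcm e : ℕ)) +
        w d * w e * (c (d.lcm e) - N / (d.lcm e : ℕ)) := by ring
    rw [h5]
    linarith
  have h6 : ∑ d ∈ P, ∑ e ∈ P, w d * w e * c (d.lcm e) ≤
      ∑ d ∈ P, ∑ e ∈ P, (N * (w d * w e / (d.lcm e : ℕ)) + 1) :=
    Finset.sum_le_sum fun d hd => Finset.sum_le_sum fun e he => h3 d hd e he
  rw [h2] at h1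
  refine (h1.trans h6).trans_eq ?_
  simp_rw [Finset.sum_add_distrib, ← Finset.mul_sum]
  rw [sum_sieveWeight_mul_div_lcm t hQ]
  simp only [Finset.sum_const, nsmul_eq_mul, mul_one]
  ring

theorem totient_div_le_half {t : ℕ} (ht0 : 0 < t) (ht : 2 ∣ t) : (t.totient : ℝ) / t ≤ 1 / 2 := by
  have ht0' : (0 : ℝ) < t := by exact_mod_cast ht0
  rw [totient_eq_mul_prod_one_sub_inv, mul_div_cancel_left₀ _ ht0'.ne']
  have h2 : 2 ∈ t.primeFactors := Nat.mem_primeFactors.2 ⟨Nat.prime_two, ht, ht0.ne'⟩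
  have h3 : ∀ p ∈ t.primeFactors, (0 : ℝ) ≤ 1 - (p : ℝ)⁻¹ ∧ 1 - (p : ℝ)⁻¹ ≤ 1 := by
    intro p hp
    have h4 : (1 : ℝ) ≤ p := by exact_mod_cast (Nat.prime_of_mem_primeFactors hp).one_le
    have h5 := inv_le_one_of_one_le₀ h4
    have h6 : (0 : ℝ) ≤ (p : ℝ)⁻¹ := by positivity
    constructor <;> linarith
  rw [← Finset.mul_prod_erase _ _ h2]
  have h4 : ∏ p ∈ t.primeFactors.erase 2, (1 - (p : ℝ)⁻¹) ≤ 1 :=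
    Finset.prod_le_one (fun p hp => (h3 p (Finset.mem_of_mem_erase hp)).1)
      fun p hp => (h3 p (Finset.mem_of_mem_erase hp)).2
  push_cast
  linarith

/-- A Brun–Titchmarsh type bound for the primes `t * n + 1` with `0 < n ≤ N`. -/
theorem totient_div_mul_card_prime_le {t : ℕ} (ht0 : 0 < t) (ht : 2 ∣ t) {Q : ℕ} (hQ : 1 ≤ Q)
    (N : ℕ) :
    (t.totient : ℝ) / t * ((Finset.Ioc 0 N).filter fun n => (t * n + 1).Prime).card ≤
      N / Real.log (Q + 1) + (Q + 2) ^ 2 / 8 := by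
  have hsmall : (((Finset.Ioc 0 N).filter fun n => t * n + 1 ≤ Q).card : ℝ) ≤ Q / 2 := by
    have h : ((Finset.Ioc 0 N).filter fun n => t * n + 1 ≤ Q) ⊆ Finset.Ioc 0 (Q / 2) := by
      intro n hn
      simp only [Finset.mem_filter, Finset.mem_Ioc] at hn ⊢
      have h2 : 2 * n ≤ t * n := Nat.mul_le_mul_right n (Nat.le_of_dvd ht0 ht)
      omega
    have h2 := Finset.card_le_card h
    rw [Nat.card_Ioc] at h2
    have h3 : 2 * ((Finset.Ioc 0 N).filter fun n => t * n + 1 ≤ Q).card ≤ Q := by omega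
    have h4 : (2 : ℝ) * ((Finset.Ioc 0 N).filter fun n => t * n + 1 ≤ Q).card ≤ Q := by
      exact_mod_cast h3
    linarith
  have hsplit : (((Finset.Ioc 0 N).filter fun n => (t * n + 1).Prime).card : ℝ) ≤
      ((Finset.Ioc 0 N).filter fun n => (t * n + 1).Prime ∧ Q < t * n + 1).card +
      ((Finset.Ioc 0 N).filter fun n => t * n + 1 ≤ Q).card := by
    have h : ((Finset.Ioc 0 N).filter fun n => (t * n + 1).Prime) ⊆
        ((Finset.Ioc 0 N).filter fun n => (t * n + 1).Prime ∧ Q < t * n + 1) ∪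
        ((Finset.Ioc 0 N).filter fun n => t * n + 1 ≤ Q) := by
      intro n hn
      simp only [Finset.mem_filter, Finset.mem_union] at hn ⊢
      by_cases h : t * n + 1 ≤ Q
      · exact Or.inr ⟨hn.1, h⟩
      · exact Or.inl ⟨hn.1, hn.2, by omega⟩
    exact_mod_cast (Finset.card_le_card h).trans (Finset.card_union_le _ _)
  have hmain := card_filter_prime_mul_add_one_le t hQ N
  have hP := card_sieveSupport_le ht Q
  have hP2 : ((sieveSupport t Q).card : ℝ) ^ 2 ≤ ((Q + 1) / 2) ^ 2 :=
    pow_le_pow_left₀ (Nat.cast_nonneg _) hP 2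
  have hhalf := totient_div_le_half ht0 ht
  have hφ : (0 : ℝ) < t.totient / t := by
    have : 0 < t.totient := Nat.totient_pos.2 ht0
    positivity
  have hlog : 0 < Real.log (Q + 1) := Real.log_pos (by
    have : (1 : ℝ) ≤ Q := by exact_mod_cast hQ
    linarith)
  have hL := totient_mul_log_le_sieveMass ht0 Q
  have hN : (t.totient : ℝ) / t * (N / sieveMass t Q) ≤ N / Real.log (Q + 1) := by
    rw [← mul_div_assoc, div_le_div_iff₀ (sieveMass_pos t hQ) hlog]
    calc (t.totient : ℝ) / t * N * Real.log (Q + 1)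
        = N * (t.totient / t * Real.log (Q + 1)) := by ring
      _ ≤ N * sieveMass t Q := by gcongr
  calc (t.totient : ℝ) / t * ((Finset.Ioc 0 N).filter fun n => (t * n + 1).Prime).card
      ≤ t.totient / t * (N / sieveMass t Q + (Q + 2) ^ 2 / 4) := by
        refine mul_le_mul_of_nonneg_left ?_ hφ.le
        nlinarith
    _ = t.totient / t * (N / sieveMass t Q) + t.totient / t * ((Q + 2) ^ 2 / 4) := by ring
    _ ≤ N / Real.log (Q + 1) + 1 / 2 * ((Q + 2) ^ 2 / 4) := by gcongr
    _ = N / Real.log (Q + 1) + (Q + 2) ^ 2 / 8 := by ring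

theorem inv_add_exp_le {s : ℝ} (hs : 3 ≤ s) :
    1 / (s ^ 2 / 2 - 3 / 10 * s) + 121 / 800 * Real.exp (-(3 / 5 * s)) ≤
      2 / (s * (s - 5 / 4)) := by
  have he : (271 / 100 : ℝ) ≤ Real.exp 1 := by have := Real.exp_one_gt_d9; linarith
  have h1 : 271 / 100 * (s / 5) ≤ Real.exp (s / 5) := by
    have h2 : Real.exp (s / 5) = Real.exp 1 * Real.exp (s / 5 - 1) := by
      rw [← Real.exp_add]; congr 1; ring
    have h3 := Real.add_one_le_exp (s / 5 - 1)
    rw [h2]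
    gcongr
    linarith
  have h2 : (271 / 100 * (s / 5)) ^ 3 ≤ Real.exp (3 / 5 * s) := by
    have h3 : Real.exp (3 / 5 * s) = Real.exp (s / 5) ^ 3 := by
      rw [← Real.exp_nat_mul]; congr 1; push_cast; ring
    rw [h3]
    gcongr
  have h4 : 121 / 800 * Real.exp (-(3 / 5 * s)) ≤ 13 / 10 / s ^ 3 := by
    rw [Real.exp_neg, ← div_eq_mul_inv, div_le_div_iff₀ (Real.exp_pos _) (by positivity)]
    have : 0 ≤ s ^ 3 := by positivity
    nlinarith
  have h5 : 13 / 10 / s ^ 3 ≤ 13 / 10 / (s * (s - 5 / 4) * (s - 3 / 5)) := by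
    have h6 : 0 < (s - 5 / 4) * (s - 3 / 5) := mul_pos (by linarith) (by linarith)
    refine div_le_div_of_nonneg_left (by norm_num) (by nlinarith) ?_
    nlinarith
  have h7 : 2 / (s * (s - 5 / 4)) - 1 / (s ^ 2 / 2 - 3 / 10 * s) =
      13 / 10 / (s * (s - 5 / 4) * (s - 3 / 5)) := by
    have a1 : s ≠ 0 := by linarith
    have a2 : s - 5 / 4 ≠ 0 := by linarith
    have a3 : s - 3 / 5 ≠ 0 := by linarith
    have a4 : s ^ 2 / 2 - 3 / 10 * s = s * (s - 3 / 5) / 2 := by ring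
    rw [a4, one_div_div, div_sub_div _ _ (by positivity) (by positivity),
      div_eq_div_iff (by positivity) (by positivity)]
    ring
  linarith

theorem totient_div_mul_card_prime_le_of_log {t : ℕ} (ht0 : 0 < t) (ht : 2 ∣ t) {N : ℕ}
    (hN : 9 ≤ Real.log N) :
    (t.totient : ℝ) / t * ((Finset.Ioc 0 N).filter fun n => (t * n + 1).Prime).card ≤
      N * (2 / (√(Real.log N) * (√(Real.log N) - 5 / 4))) := by
  set s := √(Real.log N) with hs
  have hs2 : s ^ 2 = Real.log N := Real.sq_sqrt (by linarith)
  have hs3 : 3 ≤ s := Real.le_sqrt_of_sq_le (by linarith)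
  have hN0 : (0 : ℝ) < N := by
    rcases Nat.eq_zero_or_pos N with h | h
    · rw [h] at hN; norm_num at hN
    · exact_mod_cast h
  set z := Real.exp (s ^ 2 / 2 - 3 / 10 * s) with hz
  have hz20 : 20 ≤ z := by
    have h1 : Real.exp 3 * Real.exp (6 / 10) ≤ z := by
      rw [← Real.exp_add]
      exact Real.exp_le_exp.2 (by nlinarith)
    have h2 : Real.exp 3 = Real.exp 1 ^ 3 := by rw [← Real.exp_nat_mul]; norm_num
    have h3 : (27 / 10 : ℝ) ^ 3 ≤ Real.exp 1 ^ 3 := by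
      have := Real.exp_one_gt_d9
      gcongr
      linarith
    have h4 := Real.add_one_le_exp (6 / 10 : ℝ)
    nlinarith
  have hz2 : z ^ 2 = N * Real.exp (-(3 / 5 * s)) := by
    rw [hz, ← Real.exp_nat_mul]
    have hNe : (N : ℝ) = Real.exp (s ^ 2) := by rw [hs2, Real.exp_log hN0]
    rw [hNe, ← Real.exp_add]
    congr 1
    push_cast
    ring
  have hQ1 : 1 ≤ ⌊z⌋₊ := Nat.le_floor (by push_cast; linarith)
  have hQle : (⌊z⌋₊ : ℝ) ≤ z := Nat.floor_le (by linarith)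
  have hQlt : z < ⌊z⌋₊ + 1 := Nat.lt_floor_add_one z
  have h := totient_div_mul_card_prime_le ht0 ht hQ1 N
  have hpos : 0 < s ^ 2 / 2 - 3 / 10 * s := by nlinarith
  have hlog : s ^ 2 / 2 - 3 / 10 * s ≤ Real.log (⌊z⌋₊ + 1) :=
    (Real.le_log_iff_exp_le (by linarith)).2 hQlt.le
  have h1 : N / Real.log (⌊z⌋₊ + 1) ≤ N * (1 / (s ^ 2 / 2 - 3 / 10 * s)) := by
    rw [mul_one_div]
    gcongr
  have h2 : ((⌊z⌋₊ : ℝ) + 2) ^ 2 / 8 ≤ N * (121 / 800 * Real.exp (-(3 / 5 * s))) := by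
    have h3 : ((⌊z⌋₊ : ℝ) + 2) ^ 2 ≤ (11 / 10 * z) ^ 2 := by
      gcongr
      linarith
    rw [mul_pow, hz2] at h3
    linarith
  have h3 := mul_le_mul_of_nonneg_left (inv_add_exp_le hs3) hN0.le
  rw [mul_add] at h3
  linarith

/-- An upper bound for `φ(t) / p`, where `t` is even and `p` is the `j`-th prime which is
congruent to `1` modulo `t`. -/
noncomputable def rankBound (j : ℕ) : ℝ :=
  if Real.log j < 9 then 1 / 2 * (1 / j) else
    2 / (j * (√(Real.log j) * (√(Real.log j) - 5 / 4)))

theorem totient_div_le_rankBound {t n j : ℕ} (ht0 : 0 < t) (ht : 2 ∣ t) (hj : 0 < j)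
    (hjn : j ≤ ((Finset.Ioc 0 n).filter fun n => (t * n + 1).Prime).card) :
    (t.totient : ℝ) / t / n ≤ rankBound j := by
  have hle : j ≤ n := by
    have := hjn.trans (Finset.card_filter_le _ _)
    rwa [Nat.card_Ioc, Nat.sub_zero] at this
  have hj0 : (0 : ℝ) < j := by exact_mod_cast hj
  have hjn' : (j : ℝ) ≤ n := by exact_mod_cast hle
  have hn0 : (0 : ℝ) < n := hj0.trans_le hjn'
  rw [rankBound]
  split_ifs with h
  · rw [div_eq_mul_one_div _ (n : ℝ)]
    have := totient_div_le_half ht0 ht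
    gcongr
  · rw [not_lt] at h
    have hlog := Real.log_le_log hj0 hjn'
    have h1 := totient_div_mul_card_prime_le_of_log ht0 ht (h.trans hlog)
    have hs : √(Real.log j) ≤ √(Real.log n) := Real.sqrt_le_sqrt hlog
    have hs3 : 3 ≤ √(Real.log j) := Real.le_sqrt_of_sq_le (by linarith)
    have hpos : 0 < √(Real.log j) * (√(Real.log j) - 5 / 4) :=
      mul_pos (by linarith) (by linarith)
    have hpos' : 0 ≤ √(Real.log j) - 5 / 4 := by linarith
    have h2 : (n : ℝ) * (2 / (√(Real.log n) * (√(Real.log n) - 5 / 4))) ≤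
        n * (2 / (√(Real.log j) * (√(Real.log j) - 5 / 4))) := by
      gcongr
    have h3 : (t.totient : ℝ) / t * j ≤ n * (2 / (√(Real.log j) * (√(Real.log j) - 5 / 4))) := by
      refine le_trans ?_ (h1.trans h2)
      gcongr
    rw [div_le_iff₀ hn0, ← mul_le_mul_iff_left₀ hj0]
    refine h3.trans_eq ?_
    field_simp

theorem rankBound_le_log_sub_log {k : ℕ} (hk : 9 ≤ Real.log k) :
    rankBound (k + 1) ≤ 4 * Real.log (√(Real.log (k + 1 : ℕ)) - 5 / 4) -
      4 * Real.log (√(Real.log k) - 5 / 4) := by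
  have hk0 : (0 : ℝ) < k := by
    rcases Nat.eq_zero_or_pos k with h | h
    · rw [h] at hk; norm_num at hk
    · exact_mod_cast h
  have hk1 : ((k + 1 : ℕ) : ℝ) = k + 1 := by push_cast; rfl
  have hmono : Real.log k ≤ Real.log (k + 1 : ℕ) := Real.log_le_log hk0 (by rw [hk1]; linarith)
  rw [rankBound, if_neg (by linarith)]
  set x := Real.log k with hx
  set y := Real.log (k + 1 : ℕ) with hy
  have hyx : 1 / ((k + 1 : ℕ) : ℝ) ≤ y - x := by
    have h1 := Real.log_le_sub_one_of_pos (x := (k : ℝ) / (k + 1 : ℕ)) (by positivity)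
    rw [Real.log_div hk0.ne' (by positivity), ← hx, ← hy] at h1
    have h2 : (k : ℝ) / (k + 1 : ℕ) - 1 = -(1 / (k + 1 : ℕ)) := by
      rw [hk1]; field_simp; ring
    linarith
  have ha3 : 3 ≤ √x := Real.le_sqrt_of_sq_le (by linarith)
  have hab : √x ≤ √y := Real.sqrt_le_sqrt hmono
  have ha2 : √x ^ 2 = x := Real.sq_sqrt (by linarith)
  have hb2 : √y ^ 2 = y := Real.sq_sqrt (by linarith)
  generalize √x = a at *
  generalize √y = b at *
  have hA : 0 < a - 5 / 4 := by linarith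
  have hB : 0 < b - 5 / 4 := by linarith
  have hlog := Real.log_le_sub_one_of_pos (x := (a - 5 / 4) / (b - 5 / 4)) (by positivity)
  rw [Real.log_div hA.ne' hB.ne'] at hlog
  have h3 : (a - 5 / 4) / (b - 5 / 4) - 1 = -((b - a) / (b - 5 / 4)) := by
    rw [div_sub_one hB.ne', ← neg_div]
    congr 1
    ring
  have h4 : 1 / ((k + 1 : ℕ) : ℝ) ≤ (b - a) * (2 * b) := by
    nlinarith
  have h5 : 2 / (((k + 1 : ℕ) : ℝ) * (b * (b - 5 / 4))) ≤ 4 * ((b - a) / (b - 5 / 4)) := by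
    have e1 : 2 / (((k + 1 : ℕ) : ℝ) * (b * (b - 5 / 4))) =
        1 / ((k + 1 : ℕ) : ℝ) * (2 / (b * (b - 5 / 4))) := by field_simp
    have e2 : 4 * ((b - a) / (b - 5 / 4)) = (b - a) * (2 * b) * (2 / (b * (b - 5 / 4))) := by
      have : b ≠ 0 := by linarith
      field_simp
      ring
    rw [e1, e2]
    exact mul_le_mul_of_nonneg_right h4
      (div_nonneg zero_le_two (mul_pos (by linarith) hB).le)
  linarith

theorem sum_rankBound_le_of_log_lt {k : ℕ} (hk : Real.log k < 9) :
    ∑ j ∈ Finset.Icc 1 k, rankBound j ≤ (1 + Real.log k) / 2 := by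
  have h1 : ∀ j ∈ Finset.Icc 1 k, rankBound j = 1 / 2 * (1 / j) := by
    intro j hj
    rw [Finset.mem_Icc] at hj
    rw [rankBound, if_pos]
    refine (Real.log_le_log ?_ ?_).trans_lt hk
    · exact_mod_cast hj.1
    · exact_mod_cast hj.2
  have h2 := harmonic_le_one_add_log k
  rw [harmonic_eq_sum_Icc] at h2
  push_cast at h2
  rw [Finset.sum_congr rfl h1, ← Finset.mul_sum]
  simp only [one_div] at h2 ⊢
  linarith

theorem sum_rankBound_le_of_le_log {k : ℕ} (hk : 9 ≤ Real.log k) :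
    ∑ j ∈ Finset.Icc 1 k, rankBound j ≤
      51 / 10 + 4 * Real.log (√(Real.log k) - 5 / 4) - 4 * Real.log (7 / 4) := by
  induction k with
  | zero => norm_num at hk
  | succ k ih =>
    rw [Finset.sum_Icc_succ_top (by omega)]
    rcases lt_or_ge (Real.log k) 9 with h | h
    · have h1 := sum_rankBound_le_of_log_lt h
      have hs3 : 3 ≤ √(Real.log (k + 1 : ℕ)) := Real.le_sqrt_of_sq_le (by linarith)
      have h2 : Real.log (7 / 4) ≤ Real.log (√(Real.log (k + 1 : ℕ)) - 5 / 4) :=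
        Real.log_le_log (by norm_num) (by linarith)
      have hk10 : (10 : ℝ) ≤ (k + 1 : ℕ) := by
        have h3 := (Real.le_log_iff_exp_le (by positivity)).1 hk
        have h4 := Real.add_one_le_exp (9 : ℝ)
        linarith
      have h5 : rankBound (k + 1) ≤ 1 / 10 := by
        rw [rankBound, if_neg (not_lt.2 hk)]
        rw [div_le_iff₀ (mul_pos (by linarith) (mul_pos (by linarith) (by linarith)))]
        have : 2 ≤ √(Real.log (k + 1 : ℕ)) * (√(Real.log (k + 1 : ℕ)) - 5 / 4) := by nlinarith
        nlinarith
      linarith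
    · have h1 := ih h
      have h2 := rankBound_le_log_sub_log h
      linarith

theorem sum_rankBound_le {k : ℕ} {K : ℝ} (hK : 3 ≤ K) (hk : k ≤ K) :
    ∑ j ∈ Finset.Icc 1 k, rankBound j ≤ 3 + 2 * Real.log (Real.log K) := by
  have hlogK : 1 ≤ Real.log K := by
    rw [Real.le_log_iff_exp_le (by linarith)]
    have := Real.exp_one_lt_d9
    linarith
  have hmono : Real.log k ≤ Real.log K := by
    rcases Nat.eq_zero_or_pos k with h | h
    · rw [h, Nat.cast_zero, Real.log_zero]; linarith
    · exact Real.log_le_log (by exact_mod_cast h) hk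
  have hl2 := Real.log_two_gt_d9
  rcases lt_or_ge (Real.log k) 9 with h | h
  · refine (sum_rankBound_le_of_log_lt h).trans ?_
    have h0 : 0 ≤ Real.log (Real.log K) := Real.log_nonneg hlogK
    rcases le_or_gt (Real.log k) 5 with h5 | h5
    · linarith
    · have h4 : Real.log 4 ≤ Real.log (Real.log K) := Real.log_le_log (by norm_num) (by linarith)
      have h6 : Real.log 4 = 2 * Real.log 2 := by
        rw [show (4 : ℝ) = 2 ^ 2 by norm_num, Real.log_pow]; norm_num
      linarith
  · refine (sum_rankBound_le_of_le_log h).trans ?_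
    have hs3 : 3 ≤ √(Real.log k) := Real.le_sqrt_of_sq_le (by linarith)
    have h1 : Real.log (√(Real.log k) - 5 / 4) ≤ Real.log (√(Real.log k)) :=
      Real.log_le_log (by linarith) (by linarith)
    have h2 : Real.log (√(Real.log k)) = Real.log (Real.log k) / 2 :=
      Real.log_sqrt (by linarith)
    have h3 : Real.log (Real.log k) ≤ Real.log (Real.log K) :=
      Real.log_le_log (by linarith) hmono
    have h4 : 4 * Real.log 2 ≤ 5 * Real.log (7 / 4) := by
      have h5 : Real.log ((2 : ℝ) ^ 4) ≤ Real.log ((7 / 4 : ℝ) ^ 5) :=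
        Real.log_le_log (by norm_num) (by norm_num)
      rw [Real.log_pow, Real.log_pow] at h5
      exact_mod_cast h5
    linarith

theorem sum_le_sum_Icc_of_rank_le {T : Finset ℕ} {a f : ℕ → ℝ}
    (h : ∀ p ∈ T, a p ≤ f {q ∈ T | q ≤ p}.card) :
    ∑ p ∈ T, a p ≤ ∑ j ∈ Finset.Icc 1 T.card, f j := by
  induction T using Finset.induction_on_max with
  | empty => simp
  | insert m T hm ih =>
    have hmT : m ∉ T := fun h => lt_irrefl _ (hm m h)
    rw [Finset.sum_insert hmT, Finset.card_insert_of_notMem hmT,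
      Finset.sum_Icc_succ_top (by omega), add_comm]
    refine add_le_add (ih fun p hp => ?_) ?_
    · have := h p (Finset.mem_insert_of_mem hp)
      rwa [Finset.filter_insert, if_neg (not_le.2 (hm p hp))] at this
    · have := h m (Finset.mem_insert_self _ _)
      rwa [Finset.filter_true_of_mem, Finset.card_insert_of_notMem hmT] at this
      intro q hq
      rcases Finset.mem_insert.1 hq with rfl | hq
      · exact le_rfl
      · exact (hm q hq).le

theorem totient_mul_sum_inv_le_sum_rankBound {t : ℕ} (ht0 : 0 < t) (ht : 2 ∣ t) {T : Finset ℕ}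
    (hT : ∀ p ∈ T, p.Prime ∧ p % t = 1) :
    (t.totient : ℝ) * ∑ p ∈ T, (1 : ℝ) / p ≤ ∑ j ∈ Finset.Icc 1 T.card, rankBound j := by
  rw [Finset.mul_sum]
  refine sum_le_sum_Icc_of_rank_le fun p hp => ?_
  have hdecomp : ∀ q ∈ T, t * (q / t) + 1 = q := fun q hq => by
    have := Nat.div_add_mod q t
    rwa [(hT q hq).2] at this
  have hpos : ∀ q ∈ T, 0 < q / t := fun q hq => by
    rcases Nat.eq_zero_or_pos (q / t) with h | h
    · have h1 := hdecomp q hq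
      rw [h, mul_zero, zero_add] at h1
      exact absurd (hT q hq).1 (h1 ▸ Nat.not_prime_one)
    · exact h
  have hj : 0 < {q ∈ T | q ≤ p}.card :=
    Finset.card_pos.2 ⟨p, Finset.mem_filter.2 ⟨hp, le_rfl⟩⟩
  have hcard : {q ∈ T | q ≤ p}.card ≤
      ((Finset.Ioc 0 (p / t)).filter fun n => (t * n + 1).Prime).card := by
    refine Finset.card_le_card_of_injOn (· / t) ?_ ?_
    · intro q hq
      have hq' := Finset.mem_filter.1 hq
      simp only [Finset.coe_filter, Finset.mem_Ioc, Set.mem_ofPred_eq]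
      refine ⟨⟨hpos q hq'.1, Nat.div_le_div_right hq'.2⟩, ?_⟩
      rw [hdecomp q hq'.1]
      exact (hT q hq'.1).1
    · intro q hq r hr hqr
      rw [← hdecomp q (Finset.mem_filter.1 hq).1, ← hdecomp r (Finset.mem_filter.1 hr).1]
      exact congrArg (t * · + 1) hqr
  refine le_trans ?_ (totient_div_le_rankBound ht0 ht hj hcard)
  rw [mul_one_div, div_div]
  have h1 : (0 : ℝ) < t * (p / t : ℕ) := by
    have := hpos p hp
    positivity
  have h2 : (t : ℝ) * (p / t : ℕ) ≤ p := by exact_mod_cast Nat.mul_div_le p t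
  gcongr

theorem card_le_log_div_log_two {u : ℕ} (hu : u ≠ 0) {T : Finset ℕ} (hT : T ⊆ u.primeFactors) :
    (T.card : ℝ) ≤ Real.log u / Real.log 2 := by
  have h1 : 2 ^ T.card ≤ u := by
    calc 2 ^ T.card ≤ ∏ p ∈ T, p := Finset.pow_card_le_prod _ _ _ fun p hp =>
          (Nat.prime_of_mem_primeFactors (hT hp)).two_le
      _ ≤ u := Nat.le_of_dvd (Nat.pos_of_ne_zero hu)
          ((Finset.prod_dvd_prod_of_subset _ _ _ hT).trans (Nat.prod_primeFactors_dvd u))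
  have h2 : (2 : ℝ) ^ T.card ≤ u := by exact_mod_cast h1
  rw [le_div_iff₀ (Real.log_pos one_lt_two), ← Real.log_pow]
  exact Real.log_le_log (by positivity) h2

theorem totient_mul_sum_inv_le_of_even {t u : ℕ} (ht0 : 0 < t) (ht : 2 ∣ t) (hu : 8 ≤ u)
    {T : Finset ℕ} (hT : T ⊆ u.primeFactors) (hT1 : ∀ p ∈ T, p % t = 1) :
    (t.totient : ℝ) * ∑ p ∈ T, (1 : ℝ) / p ≤
      3 + 2 * Real.log (Real.log (Real.log u / Real.log 2)) := by
  refine (totient_mul_sum_inv_le_sum_rankBound ht0 ht fun p hp =>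
    ⟨Nat.prime_of_mem_primeFactors (hT hp), hT1 p hp⟩).trans
    (sum_rankBound_le ?_ (card_le_log_div_log_two (by omega) hT))
  rw [le_div_iff₀ (Real.log_pos one_lt_two)]
  have h8 : (8 : ℝ) ≤ u := by exact_mod_cast hu
  calc 3 * Real.log 2 = Real.log (2 ^ 3) := by rw [Real.log_pow]; norm_num
    _ ≤ Real.log u := Real.log_le_log (by norm_num) (by linarith)

/-- For all integers `t ≥ 2` and `u ≥ 8`,
`φ(t) · Σ_{p prime, p ≡ 1 (mod t), p ∣ u} 1/p ≤ 3 + 2·log(log(log u / log 2))`. -/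
theorem totient_mul_sum_inv_primes_dvd_le (t u : ℕ) (ht : 2 ≤ t) (hu : 8 ≤ u) :
    (t.totient : ℝ) *
        ∑ p ∈ u.primeFactors.filter (fun p => p % t = 1), (1 : ℝ) / p ≤
      3 + 2 * Real.log (Real.log (Real.log u / Real.log 2)) := by
  rcases Nat.even_or_odd t with h | h
  · exact totient_mul_sum_inv_le_of_even (by omega) h.two_dvd hu (Finset.filter_subset _ _)
      fun p hp => (Finset.mem_filter.1 hp).2
  · rw [← Nat.totient_two_mul_of_odd h]
    refine totient_mul_sum_inv_le_of_even (by omega) (dvd_mul_right 2 t) hu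
      (Finset.filter_subset _ _) fun p hp => ?_
    rw [Finset.mem_filter] at hp
    have hp2 : p % 2 = 1 := by
      rcases (Nat.prime_of_mem_primeFactors hp.1).eq_two_or_odd with h2 | h2
      · have h3 : 2 < t := lt_of_le_of_ne ht (by rintro rfl; exact absurd h (by decide))
        rw [h2, Nat.mod_eq_of_lt h3] at hp
        omega
      · exact h2
    have hmod : p ≡ 1 [MOD 2 * t] :=
      (Nat.modEq_and_modEq_iff_modEq_mul (Nat.coprime_two_left.2 h)).1
        ⟨hp2, hp.2.trans (Nat.mod_eq_of_lt (by omega)).symm⟩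
    exact Eq.trans hmod (Nat.mod_eq_of_lt (by omega))
end

section
/- There exists a real constant C > 2 such that for all integers t ≥ 2 and all integers N ≥ 3, one has |φ(t) · Σ_{p prime, p ≤ N, p ≡ 1 (mod t)} 1/p − log log N| ≤ C · log t. -/
open scoped BigOperators

open ArithmeticFunction in
/-- The Ramanujan sum `c_d(n)`, given by Kluyver's formula. -/
noncomputable def ramanujanSum (d n : ℕ) : ℝ :=
  ∑ g ∈ d.divisors, if g ∣ n then (g : ℝ) * (moebius (d / g) : ℝ) else 0

open ArithmeticFunction in
theorem ramanujanSum_of_coprime {d n : ℕ} (hd : d ≠ 0) (h : n.Coprime d) :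
    ramanujanSum d n = moebius d := by
  unfold ramanujanSum
  rw [Finset.sum_eq_single 1]
  · simp
  · intro g hg hg1
    rw [if_neg]
    intro hgn
    exact hg1 (Nat.eq_one_of_dvd_coprimes h hgn (Nat.dvd_of_mem_divisors hg))
  · simp [hd]

open ArithmeticFunction in
theorem sum_divisors_dvd_moebius_div {d k : ℕ} (hd : d ≠ 0) (hk : k ≠ 0) :
    (∑ g ∈ d.divisors, if k ∣ g then (moebius (d / g) : ℝ) else 0) = if k = d then 1 else 0 := by
  by_cases hkd : k ∣ d
  · obtain ⟨m, rfl⟩ := hkd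
    have hm : m ≠ 0 := by rintro rfl; simp at hd
    rw [← Finset.sum_filter]
    have h1 : (∑ g ∈ (k * m).divisors with k ∣ g, (moebius (k * m / g) : ℝ)) =
        ∑ g ∈ m.divisors, (moebius (m / g) : ℝ) := by
      symm
      refine Finset.sum_bij (fun g _ => k * g) ?_ ?_ ?_ ?_
      · intro g hg
        simp only [Finset.mem_filter, Nat.mem_divisors]
        exact ⟨⟨Nat.mul_dvd_mul_left k (Nat.dvd_of_mem_divisors hg), hd⟩, dvd_mul_right _ _⟩
      · intro a _ b _ hab
        exact Nat.eq_of_mul_eq_mul_left (Nat.pos_of_ne_zero hk) hab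
      · intro b hb
        simp only [Finset.mem_filter, Nat.mem_divisors] at hb
        obtain ⟨c, rfl⟩ := hb.2
        exact ⟨c, Nat.mem_divisors.2
          ⟨Nat.dvd_of_mul_dvd_mul_left (Nat.pos_of_ne_zero hk) hb.1.1, hm⟩, rfl⟩
      · intro g _
        rw [Nat.mul_div_mul_left _ _ (Nat.pos_of_ne_zero hk)]
    rw [h1, Nat.sum_div_divisors m (fun g => (moebius g : ℝ))]
    have h2 : (∑ g ∈ m.divisors, moebius g) = if m = 1 then 1 else 0 := by
      rw [← coe_mul_zeta_apply, moebius_mul_coe_zeta, one_apply]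
    have h3 : (k = k * m) ↔ m = 1 := by
      constructor
      · intro h
        exact Nat.eq_of_mul_eq_mul_left (Nat.pos_of_ne_zero hk) (by rw [← h, mul_one])
      · rintro rfl; simp
    simp only [h3]
    exact_mod_cast h2
  · rw [if_neg (by rintro rfl; exact hkd dvd_rfl)]
    refine Finset.sum_eq_zero fun g hg => if_neg fun h => hkd ?_
    exact h.trans (Nat.dvd_of_mem_divisors hg)

open ArithmeticFunction in
/-- Orthogonality of Ramanujan sums on average. -/
theorem sum_divisors_gcd_mul_moebius {d e : ℕ} (hd : d ≠ 0) (he : e ≠ 0) :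
    (∑ g ∈ d.divisors, ∑ h ∈ e.divisors,
      (Nat.gcd g h : ℝ) * moebius (d / g) * moebius (e / h)) =
      if d = e then (d.totient : ℝ) else 0 := by
  have key : ∀ g ∈ d.divisors, ∀ h ∈ e.divisors,
      (Nat.gcd g h : ℝ) * moebius (d / g) * moebius (e / h) =
      ∑ k ∈ d.divisors, (k.totient : ℝ) * (if k ∣ g then (moebius (d / g) : ℝ) else 0) *
        (if k ∣ h then (moebius (e / h) : ℝ) else 0) := by
    intro g hg h hh
    have hg0 : g ≠ 0 := (Nat.pos_of_mem_divisors hg).ne'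
    have h1 : (Nat.gcd g h : ℝ) = ∑ k ∈ (Nat.gcd g h).divisors, (k.totient : ℝ) := by
      exact_mod_cast (Nat.sum_totient (Nat.gcd g h)).symm
    have h2 : (Nat.gcd g h).divisors = d.divisors.filter (fun k => k ∣ g ∧ k ∣ h) := by
      ext k
      simp only [Nat.mem_divisors, Finset.mem_filter, Nat.dvd_gcd_iff]
      refine ⟨fun H => ⟨⟨H.1.1.trans (Nat.dvd_of_mem_divisors hg), hd⟩, H.1⟩,
        fun H => ⟨H.2, Nat.gcd_ne_zero_left hg0⟩⟩
    rw [h1, h2, Finset.sum_filter, Finset.sum_mul, Finset.sum_mul]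
    refine Finset.sum_congr rfl fun k _ => ?_
    by_cases hkg : k ∣ g <;> by_cases hkh : k ∣ h <;> simp [hkg, hkh]
  rw [Finset.sum_congr rfl fun g hg => Finset.sum_congr rfl fun h hh => key g hg h hh]
  have : (∑ g ∈ d.divisors, ∑ h ∈ e.divisors, ∑ k ∈ d.divisors,
      (k.totient : ℝ) * (if k ∣ g then (moebius (d / g) : ℝ) else 0) *
        (if k ∣ h then (moebius (e / h) : ℝ) else 0)) =
      ∑ k ∈ d.divisors, (k.totient : ℝ) * (if k = d then 1 else 0) * (if k = e then 1 else 0) := by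
    rw [Finset.sum_congr rfl fun g _ => Finset.sum_comm, Finset.sum_comm]
    refine Finset.sum_congr rfl fun k hk => ?_
    have hk0 : k ≠ 0 := (Nat.pos_of_mem_divisors hk).ne'
    rw [← sum_divisors_dvd_moebius_div hd hk0, ← sum_divisors_dvd_moebius_div he hk0,
      mul_assoc, Finset.sum_mul_sum, Finset.mul_sum]
    refine Finset.sum_congr rfl fun g _ => ?_
    rw [Finset.mul_sum]
    exact Finset.sum_congr rfl fun h _ => mul_assoc _ _ _
  rw [this, Finset.sum_eq_single d]
  · by_cases h : d = e <;> simp [h]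
  · intro b _ hb; simp [hb]
  · simp [hd]

theorem abs_card_filter_dvd_sub_le {t m : ℕ} (hm : 0 < m) (h : m.Coprime t) (a K : ℕ) :
    |(((Finset.Ico a (a + K)).filter (fun k => m ∣ 1 + t * k)).card : ℝ) - K / m| ≤ 1 := by
  have : NeZero m := ⟨hm.ne'⟩
  have hu : IsUnit (t : ZMod m) := (ZMod.isUnit_iff_coprime t m).2 h.symm
  obtain ⟨u, hu⟩ := hu
  set v : ℕ := (-(↑u⁻¹ : ZMod m)).val with hv
  have h1 : (Finset.Ico a (a + K)).filter (fun k => m ∣ 1 + t * k) =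
      (Finset.Ico a (a + K)).filter (fun k => k ≡ v [MOD m]) := by
    refine Finset.filter_congr fun k _ => ?_
    rw [← ZMod.natCast_eq_zero_iff, ← ZMod.natCast_eq_natCast_iff, hv, ZMod.natCast_zmod_val]
    push_cast
    rw [← hu]
    constructor
    · intro H
      have : (↑u⁻¹ : ZMod m) * (1 + u * k) = 0 := by rw [H, mul_zero]
      rw [mul_add, ← mul_assoc, Units.inv_mul] at this
      linear_combination this
    · intro H
      rw [H, mul_neg, Units.mul_inv]; ring
  rw [h1]
  have h2 := Nat.Ico_filter_modEq_card a (a + K) hm v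
  have hmr : (0 : ℝ) < m := by exact_mod_cast hm
  have h3 : ((((Finset.Ico a (a + K)).filter (fun k => k ≡ v [MOD m])).card : ℤ) : ℝ) =
    ((max (⌈((a + K : ℕ) - v : ℚ) / m⌉ - ⌈((a : ℕ) - v : ℚ) / m⌉) 0 : ℤ) : ℝ) := by
    rw [h2]
  have h4 : ⌈((a : ℕ) - v : ℚ) / m⌉ ≤ ⌈((a + K : ℕ) - v : ℚ) / m⌉ := by
    apply Int.ceil_mono
    push_cast
    gcongr
    linarith [(Nat.cast_nonneg K : (0:ℚ) ≤ K)]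
  rw [max_eq_left (by omega)] at h3
  rw [Int.cast_natCast] at h3
  rw [h3]
  have e1 := Int.ceil_lt_add_one (((a + K : ℕ) - v : ℚ) / m)
  have e2 := Int.le_ceil (((a + K : ℕ) - v : ℚ) / m)
  have e3 := Int.ceil_lt_add_one (((a : ℕ) - v : ℚ) / m)
  have e4 := Int.le_ceil (((a : ℕ) - v : ℚ) / m)
  have e5 : (((a + K : ℕ) - v : ℚ) / m) = ((a : ℕ) - v : ℚ) / m + K / m := by
    push_cast; ring
  generalize ⌈((a + K : ℕ) - v : ℚ) / m⌉ = A at *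
  generalize ⌈((a : ℕ) - v : ℚ) / m⌉ = B at *
  have q : |((A - B : ℤ) : ℚ) - K / m| ≤ 1 := by
    rw [abs_le]; push_cast; constructor <;> linarith
  have q' := (Rat.cast_le (K := ℝ)).2 q
  push_cast at q' ⊢
  exact q'

theorem sum_divisors_le_sq (d : ℕ) : (∑ g ∈ d.divisors, (g : ℝ)) ≤ (d : ℝ) ^ 2 := by
  have h1 : ∀ g ∈ d.divisors, (g : ℝ) ≤ d := fun g hg => by
    exact_mod_cast Nat.divisor_le hg
  refine (Finset.sum_le_card_nsmul _ _ _ h1).trans ?_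
  have : (d.divisors.card : ℝ) ≤ d := by exact_mod_cast Nat.card_divisors_le_self d
  rw [nsmul_eq_mul, sq]
  gcongr

open ArithmeticFunction in
theorem abs_sum_ramanujanSum_mul_sub_le {t d e : ℕ} (hd0 : d ≠ 0) (he0 : e ≠ 0)
    (hd : d.Coprime t) (he : e.Coprime t) (a K : ℕ) :
    |(∑ k ∈ Finset.Ico a (a + K), ramanujanSum d (1 + t * k) * ramanujanSum e (1 + t * k)) -
      K * (if d = e then (d.totient : ℝ) else 0)| ≤ (d : ℝ) ^ 2 * (e : ℝ) ^ 2 := by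
  have hmu : ∀ n : ℕ, |(moebius n : ℝ)| ≤ 1 := fun n => by
    exact_mod_cast abs_moebius_le_one (n := n)
  have h1 : (∑ k ∈ Finset.Ico a (a + K),
      ramanujanSum d (1 + t * k) * ramanujanSum e (1 + t * k)) =
      ∑ g ∈ d.divisors, ∑ h ∈ e.divisors, (g : ℝ) * h * moebius (d / g) * moebius (e / h) *
        (((Finset.Ico a (a + K)).filter (fun k => Nat.lcm g h ∣ 1 + t * k)).card : ℝ) := by
    simp only [ramanujanSum, Finset.sum_mul_sum]
    rw [Finset.sum_comm]
    refine Finset.sum_congr rfl fun g _ => ?_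
    rw [Finset.sum_comm]
    refine Finset.sum_congr rfl fun h _ => ?_
    rw [Finset.card_filter, Nat.cast_sum, Finset.mul_sum]
    refine Finset.sum_congr rfl fun k _ => ?_
    simp only [Nat.lcm_dvd_iff]
    by_cases hg : g ∣ 1 + t * k <;> by_cases hh : h ∣ 1 + t * k <;> simp [hg, hh]
    ring
  rw [h1, ← sum_divisors_gcd_mul_moebius hd0 he0, Finset.mul_sum, ← Finset.sum_sub_distrib]
  refine (Finset.abs_sum_le_sum_abs _ _).trans ?_
  calc _ ≤ ∑ g ∈ d.divisors, ∑ h ∈ e.divisors, (g : ℝ) * h := by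
        refine Finset.sum_le_sum fun g hg => ?_
        rw [Finset.mul_sum, ← Finset.sum_sub_distrib]
        refine (Finset.abs_sum_le_sum_abs _ _).trans (Finset.sum_le_sum fun h hh => ?_)
        have hg0 := Nat.pos_of_mem_divisors hg
        have hh0 := Nat.pos_of_mem_divisors hh
        have hl : 0 < Nat.lcm g h := Nat.lcm_pos hg0 hh0
        have hc : (Nat.lcm g h).Coprime t := by
          have hgt := Nat.Coprime.of_dvd_left (Nat.dvd_of_mem_divisors hg) hd
          have hht := Nat.Coprime.of_dvd_left (Nat.dvd_of_mem_divisors hh) he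
          exact Nat.Coprime.of_dvd_left (Nat.lcm_dvd_mul g h) (hgt.mul_left hht)
        have hb := abs_card_filter_dvd_sub_le hl hc a K
        set c : ℝ := (((Finset.Ico a (a + K)).filter
          (fun k => Nat.lcm g h ∣ 1 + t * k)).card : ℝ)
        have hgl : (Nat.gcd g h : ℝ) * Nat.lcm g h = g * h := by
          exact_mod_cast Nat.gcd_mul_lcm g h
        have hl' : (0 : ℝ) < Nat.lcm g h := by exact_mod_cast hl
        have e1 : (g : ℝ) * h * moebius (d / g) * moebius (e / h) * c -
            K * ((Nat.gcd g h : ℝ) * moebius (d / g) * moebius (e / h)) =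
            (g : ℝ) * h * (moebius (d / g) * (moebius (e / h) * (c - K / Nat.lcm g h))) := by
          rw [← hgl]; field_simp
        rw [e1, abs_mul, abs_of_nonneg (by positivity : (0 : ℝ) ≤ (g : ℝ) * h), abs_mul, abs_mul]
        refine mul_le_of_le_one_right (by positivity) ?_
        exact mul_le_one₀ (hmu _) (by positivity) (mul_le_one₀ (hmu _) (abs_nonneg _) hb)
    _ = (∑ g ∈ d.divisors, (g : ℝ)) * ∑ h ∈ e.divisors, (h : ℝ) := by
        rw [Finset.sum_mul_sum]
    _ ≤ _ := by
        gcongr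
        · exact sum_divisors_le_sq d
        · exact sum_divisors_le_sq e

/-- Squarefree sieving moduli up to `R` which are coprime to `t`. -/
def sieveModuli (t R : ℕ) : Finset ℕ :=
  (Finset.Icc 1 R).filter (fun d => Squarefree d ∧ d.Coprime t)

open ArithmeticFunction in
/-- A dual form of Selberg's upper bound sieve for arithmetic progressions. -/
theorem card_mul_sq_le_of_coprime {t a K R : ℕ} {T : Finset ℕ} (hT : T ⊆ Finset.Ico a (a + K))
    (hcop : ∀ k ∈ T, ∀ d ∈ Finset.Icc 1 R, (1 + t * k).Coprime d) :
    (T.card : ℝ) * (∑ d ∈ sieveModuli t R, (1 : ℝ) / d.totient) ^ 2 ≤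
      K * (∑ d ∈ sieveModuli t R, (1 : ℝ) / d.totient) + (R : ℝ) ^ 6 := by
  set D := sieveModuli t R with hD
  have hDm : ∀ d ∈ D, d ≠ 0 ∧ d ≤ R ∧ Squarefree d ∧ d.Coprime t := by
    intro d hd
    simp only [hD, sieveModuli, Finset.mem_filter, Finset.mem_Icc] at hd
    exact ⟨by omega, hd.1.2, hd.2⟩
  set G := ∑ d ∈ D, (1 : ℝ) / d.totient with hG
  set w : ℕ → ℝ := fun d => (moebius d : ℝ) / d.totient with hw
  set F : ℕ → ℝ := fun k => ∑ d ∈ D, w d * ramanujanSum d (1 + t * k) with hF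
  have hmu : ∀ d ∈ D, (moebius d : ℝ) * moebius d = 1 := by
    intro d hd
    have := moebius_sq_eq_one_of_squarefree (hDm d hd).2.2.1
    rw [← sq]
    exact_mod_cast this
  have hw1 : ∀ d ∈ D, |w d| ≤ 1 := by
    intro d hd
    have h1 : |(moebius d : ℝ)| ≤ 1 := by exact_mod_cast abs_moebius_le_one (n := d)
    have h2 : (1 : ℝ) ≤ d.totient := by
      exact_mod_cast Nat.totient_pos.2 (Nat.pos_of_ne_zero (hDm d hd).1)
    rw [hw, abs_div, Nat.abs_cast]
    exact div_le_one_of_le₀ (h1.trans h2) (by positivity)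
  have hFT : ∀ k ∈ T, F k = G := by
    intro k hk
    refine Finset.sum_congr rfl fun d hd => ?_
    have hdR := hDm d hd
    rw [ramanujanSum_of_coprime hdR.1
      (hcop k hk d (Finset.mem_Icc.2 ⟨Nat.pos_of_ne_zero hdR.1, hdR.2.1⟩))]
    rw [hw, div_mul_eq_mul_div, hmu d hd]
  have h1 : (T.card : ℝ) * G ^ 2 ≤ ∑ k ∈ Finset.Ico a (a + K), F k ^ 2 := by
    calc (T.card : ℝ) * G ^ 2 = ∑ k ∈ T, F k ^ 2 := by
          rw [Finset.sum_congr rfl fun k hk => by rw [hFT k hk]]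
          simp
      _ ≤ _ := Finset.sum_le_sum_of_subset_of_nonneg hT fun _ _ _ => sq_nonneg _
  have h2 : ∑ k ∈ Finset.Ico a (a + K), F k ^ 2 = ∑ d ∈ D, ∑ e ∈ D, w d * w e *
      ∑ k ∈ Finset.Ico a (a + K), ramanujanSum d (1 + t * k) * ramanujanSum e (1 + t * k) := by
    simp only [hF, sq, Finset.sum_mul_sum]
    rw [Finset.sum_comm]
    refine Finset.sum_congr rfl fun d _ => ?_
    rw [Finset.sum_comm]
    refine Finset.sum_congr rfl fun e _ => ?_
    rw [Finset.mul_sum]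
    exact Finset.sum_congr rfl fun k _ => by ring
  have h3 : ∀ d ∈ D, ∀ e ∈ D, w d * w e *
      (∑ k ∈ Finset.Ico a (a + K), ramanujanSum d (1 + t * k) * ramanujanSum e (1 + t * k)) ≤
      (if d = e then K * ((1 : ℝ) / d.totient) else 0) + (d : ℝ) ^ 2 * (e : ℝ) ^ 2 := by
    intro d hd e he
    have hb := abs_sum_ramanujanSum_mul_sub_le (hDm d hd).1 (hDm e he).1 (hDm d hd).2.2.2
      (hDm e he).2.2.2 a K
    set S := ∑ k ∈ Finset.Ico a (a + K), ramanujanSum d (1 + t * k) * ramanujanSum e (1 + t * k)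
    set M := (K : ℝ) * (if d = e then (d.totient : ℝ) else 0) with hM
    have e1 : w d * w e * M = if d = e then K * ((1 : ℝ) / d.totient) else 0 := by
      by_cases hde : d = e
      · subst hde
        have : (d.totient : ℝ) ≠ 0 := by
          exact_mod_cast (Nat.totient_pos.2 (Nat.pos_of_ne_zero (hDm d hd).1)).ne'
        simp only [hM, if_true, hw]
        have := hmu d hd
        field_simp
        linear_combination (K : ℝ) * this
      · simp [hM, hde]
    have e2 : w d * w e * (S - M) ≤ (d : ℝ) ^ 2 * (e : ℝ) ^ 2 := by
      refine (le_abs_self _).trans ?_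
      rw [abs_mul, abs_mul]
      calc |w d| * |w e| * |S - M| ≤ 1 * 1 * ((d : ℝ) ^ 2 * (e : ℝ) ^ 2) := by
            gcongr
            · exact hw1 d hd
            · exact hw1 e he
        _ = _ := by ring
    rw [← e1]
    linarith [mul_sub (w d * w e) S M]
  have h4 : ∑ d ∈ D, (d : ℝ) ^ 2 ≤ (R : ℝ) ^ 3 := by
    have hcard : (D.card : ℝ) ≤ R := by
      have : D.card ≤ (Finset.Icc 1 R).card := Finset.card_filter_le _ _
      rw [Nat.card_Icc] at this
      exact_mod_cast this
    refine (Finset.sum_le_card_nsmul D _ ((R : ℝ) ^ 2) fun d hd => ?_).trans ?_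
    · have : (d : ℝ) ≤ R := by exact_mod_cast (hDm d hd).2.1
      gcongr
    · rw [nsmul_eq_mul, pow_succ' (R : ℝ) 2]
      gcongr
  calc (T.card : ℝ) * G ^ 2 ≤ _ := h1
    _ = _ := h2
    _ ≤ ∑ d ∈ D, ∑ e ∈ D, ((if d = e then K * ((1 : ℝ) / d.totient) else 0) +
        (d : ℝ) ^ 2 * (e : ℝ) ^ 2) :=
      Finset.sum_le_sum fun d hd => Finset.sum_le_sum fun e he => h3 d hd e he
    _ = K * G + (∑ d ∈ D, (d : ℝ) ^ 2) * ∑ e ∈ D, (e : ℝ) ^ 2 := by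
      rw [Finset.sum_mul_sum, hG, Finset.mul_sum, ← Finset.sum_add_distrib]
      refine Finset.sum_congr rfl fun d hd => ?_
      rw [Finset.sum_add_distrib, Finset.sum_ite_eq, if_pos hd]
    _ ≤ K * G + (R : ℝ) ^ 3 * (R : ℝ) ^ 3 := by gcongr
    _ = _ := by ring

theorem prod_primeFactors_inv_one_sub_inv (n : ℕ) (hn : n ≠ 0) :
    ∏ p ∈ n.primeFactors, (1 - (p : ℝ)⁻¹)⁻¹ = n / n.totient := by
  have h := Nat.totient_eq_mul_prod_factors n
  have h' : (n.totient : ℝ) = n * ∏ p ∈ n.primeFactors, (1 - (p : ℝ)⁻¹) := by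
    have := congrArg (fun q : ℚ => (q : ℝ)) h
    push_cast at this
    exact this
  have hn' : (n : ℝ) ≠ 0 := by exact_mod_cast hn
  have h0 : (n.totient : ℝ) ≠ 0 := by
    exact_mod_cast (Nat.totient_pos.2 (Nat.pos_of_ne_zero hn)).ne'
  rw [Finset.prod_inv_distrib, eq_div_iff h0, h']
  have : ∏ p ∈ n.primeFactors, (1 - (p : ℝ)⁻¹) ≠ 0 := by
    intro H; rw [h', H, mul_zero] at h0; exact h0 rfl
  generalize ∏ p ∈ n.primeFactors, (1 - (p : ℝ)⁻¹) = P at this ⊢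
  field_simp

theorem sum_inv_le_of_primeFactors_subset {n : ℕ} (hn : n ≠ 0) (S : Finset ℕ)
    (hS : ∀ m ∈ S, m ≠ 0 ∧ m.primeFactors ⊆ n.primeFactors) :
    ∑ m ∈ S, (1 : ℝ) / m ≤ n / n.totient := by
  classical
  let f : ℕ →* ℝ :=
    { toFun := fun m => (m : ℝ)⁻¹
      map_one' := by simp
      map_mul' := fun a b => by push_cast; rw [mul_inv] }
  have hf : ∀ {p : ℕ}, p.Prime → ‖f p‖ < 1 := by
    intro p hp
    have : (1 : ℝ) < p := by exact_mod_cast hp.one_lt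
    change ‖(p : ℝ)⁻¹‖ < 1
    rw [Real.norm_of_nonneg (by positivity)]
    exact inv_lt_one_of_one_lt₀ this
  obtain ⟨-, h2⟩ :=
    EulerProduct.summable_and_hasSum_factoredNumbers_prod_filter_prime_geometric hf n.primeFactors
  have h3 : n.primeFactors.filter Nat.Prime = n.primeFactors :=
    Finset.filter_true_of_mem fun p hp => Nat.prime_of_mem_primeFactors hp
  rw [h3] at h2
  have h4 : ∏ p ∈ n.primeFactors, (1 - f p)⁻¹ = n / n.totient :=
    prod_primeFactors_inv_one_sub_inv n hn
  rw [h4] at h2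
  have hmem : ∀ m ∈ S, m ∈ Nat.factoredNumbers n.primeFactors := fun m hm =>
    Nat.mem_factoredNumbers_iff_primeFactors_subset.2 (hS m hm)
  have h5 : ∑ m ∈ S, (1 : ℝ) / m =
      ∑ m ∈ S.subtype (· ∈ Nat.factoredNumbers n.primeFactors), f m := by
    rw [← Finset.sum_subtype_of_mem (p := (· ∈ Nat.factoredNumbers n.primeFactors))
      (fun m : ℕ => (1 : ℝ) / m) hmem]
    exact Finset.sum_congr rfl fun m _ => one_div _
  rw [h5]
  exact sum_le_hasSum _ (fun m _ => inv_nonneg.2 (Nat.cast_nonneg _)) h2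

theorem log_add_one_le_mul_sum_sieveModuli {t : ℕ} (ht : t ≠ 0) (R : ℕ) :
    Real.log (R + 1) ≤ (t / t.totient) * ∑ d ∈ sieveModuli t R, (1 : ℝ) / d.totient := by
  let ρ : ℕ → ℕ := fun n => ∏ p ∈ n.primeFactors \ t.primeFactors, p
  have hρdvd : ∀ n : ℕ, ρ n ∣ n := fun n =>
    (Finset.prod_dvd_prod_of_subset _ _ _ Finset.sdiff_subset).trans (Nat.prod_primeFactors_dvd n)
  have hprime : ∀ n : ℕ, ∀ p ∈ n.primeFactors \ t.primeFactors, p.Prime := fun n p hp =>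
    Nat.prime_of_mem_primeFactors (Finset.mem_sdiff.1 hp).1
  have hρpf : ∀ n : ℕ, (ρ n).primeFactors = n.primeFactors \ t.primeFactors := fun n =>
    Nat.primeFactors_prod (hprime n)
  have hρ0 : ∀ n : ℕ, ρ n ≠ 0 := fun n =>
    Finset.prod_ne_zero_iff.2 fun p hp => (hprime n p hp).ne_zero
  have hmaps : ∀ n ∈ Finset.Icc 1 R, ρ n ∈ sieveModuli t R := by
    intro n hn
    rw [Finset.mem_Icc] at hn
    simp only [sieveModuli, Finset.mem_filter, Finset.mem_Icc]
    refine ⟨⟨Nat.pos_of_ne_zero (hρ0 n), (Nat.le_of_dvd hn.1 (hρdvd n)).trans hn.2⟩, ?_, ?_⟩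
    · refine Finset.squarefree_prod_of_pairwise_isCoprime ?_ fun p hp =>
        (hprime n p hp).prime.squarefree
      intro p hp q hq hpq
      exact Nat.coprime_iff_isRelPrime.1
        ((Nat.coprime_primes (hprime n p hp) (hprime n q hq)).2 hpq)
    · refine Nat.Coprime.prod_left fun p hp => ?_
      rw [Nat.Prime.coprime_iff_not_dvd (hprime n p hp)]
      intro hpt
      exact (Finset.mem_sdiff.1 hp).2 (Nat.mem_primeFactors.2 ⟨hprime n p hp, hpt, ht⟩)
  have h1 : Real.log (R + 1) ≤ ∑ n ∈ Finset.Icc 1 R, (1 : ℝ) / n := by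
    have h := log_add_one_le_harmonic R
    rw [harmonic_eq_sum_Icc] at h
    push_cast at h
    simpa only [one_div] using h
  refine h1.trans ?_
  rw [← Finset.sum_fiberwise_of_maps_to hmaps, Finset.mul_sum]
  refine Finset.sum_le_sum fun d hd => ?_
  simp only [sieveModuli, Finset.mem_filter, Finset.mem_Icc] at hd
  have hd0 : d ≠ 0 := by omega
  set fib := (Finset.Icc 1 R).filter (fun n => ρ n = d) with hfib
  have hfd : ∀ n ∈ fib, d ∣ n := fun n hn => by
    rw [← (Finset.mem_filter.1 hn).2]; exact hρdvd n
  have hdt0 : d * t ≠ 0 := mul_ne_zero hd0 ht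
  have h2 := sum_inv_le_of_primeFactors_subset hdt0 (fib.image (· / d)) (by
    intro m hm
    obtain ⟨n, hn, rfl⟩ := Finset.mem_image.1 hm
    have hnd := hfd n hn
    have hn' := Finset.mem_filter.1 hn
    have hn0 : n ≠ 0 := by have := (Finset.mem_Icc.1 hn'.1).1; omega
    have hq0 : n / d ≠ 0 :=
      (Nat.div_pos (Nat.le_of_dvd (Nat.pos_of_ne_zero hn0) hnd) (Nat.pos_of_ne_zero hd0)).ne'
    refine ⟨hq0, (Nat.primeFactors_mono (Nat.div_dvd_of_dvd hnd) hn0).trans ?_⟩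
    rw [Nat.primeFactors_mul hd0 ht, ← hn'.2, hρpf]
    exact Finset.subset_union_left.trans (Finset.sdiff_union_self_eq_union).symm.subset)
  rw [Finset.sum_image (by
    intro a ha b hb hab
    exact (Nat.div_left_inj (hfd a ha) (hfd b hb)).1 hab)] at h2
  have hdr : (d : ℝ) ≠ 0 := by exact_mod_cast hd0
  have htr : (t : ℝ) ≠ 0 := by exact_mod_cast ht
  have hφt : (t.totient : ℝ) ≠ 0 := by
    exact_mod_cast (Nat.totient_pos.2 (Nat.pos_of_ne_zero ht)).ne'
  have hφd : (d.totient : ℝ) ≠ 0 := by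
    exact_mod_cast (Nat.totient_pos.2 (Nat.pos_of_ne_zero hd0)).ne'
  have h3 : ∑ n ∈ fib, (1 : ℝ) / n = (1 / d) * ∑ n ∈ fib, (1 : ℝ) / ((n / d : ℕ) : ℝ) := by
    rw [Finset.mul_sum]
    refine Finset.sum_congr rfl fun n hn => ?_
    rw [Nat.cast_div (hfd n hn) hdr]
    field_simp
  rw [h3]
  calc (1 / d : ℝ) * ∑ n ∈ fib, (1 : ℝ) / ((n / d : ℕ) : ℝ)
      ≤ (1 / d : ℝ) * (((d * t : ℕ) : ℝ) / (d * t).totient) := by gcongr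
    _ = _ := by
      rw [Nat.totient_mul hd.2.2]
      push_cast
      field_simp

theorem pow_four_le_mul_two_pow (j : ℕ) : j ^ 4 ≤ 81 * 2 ^ j := by
  rcases lt_or_ge j 6 with h | h
  · interval_cases j <;> norm_num
  · induction j, h using Nat.le_induction with
    | base => norm_num
    | succ n hn ih =>
      rw [pow_succ 2 n]
      have : (n + 1) ^ 4 ≤ 2 * n ^ 4 := by
        obtain ⟨m, rfl⟩ := Nat.exists_eq_add_of_le hn
        ring_nf
        nlinarith [Nat.zero_le m, Nat.zero_le (m ^ 2), Nat.zero_le (m ^ 3), Nat.zero_le (m ^ 4)]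
      omega

theorem div_ninetysix_le_log (j : ℕ) :
    (j : ℝ) / 96 ≤ Real.log (((2 ^ (j / 24) : ℕ) : ℝ) + 1) := by
  have hl := Real.log_two_gt_d9
  have hj : j < 24 * (j / 24) + 24 := by omega
  have hjr : (j : ℝ) < 24 * ((j / 24 : ℕ) : ℝ) + 24 := by exact_mod_cast hj
  rcases Nat.eq_zero_or_pos (j / 24) with h | h
  · rw [h] at hjr ⊢
    rw [pow_zero, Nat.cast_one, one_add_one_eq_two]
    rw [Nat.cast_zero] at hjr
    linarith
  · have h1 : (1 : ℝ) ≤ ((j / 24 : ℕ) : ℝ) := by exact_mod_cast h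
    have h2 : ((j / 24 : ℕ) : ℝ) * Real.log 2 ≤ Real.log (((2 ^ (j / 24) : ℕ) : ℝ) + 1) := by
      rw [← Real.log_pow]
      apply Real.log_le_log (by positivity)
      push_cast
      linarith
    nlinarith

/-- A dyadic Brun–Titchmarsh inequality. -/
theorem sum_inv_primes_dyadic_le {t j : ℕ} (ht : 2 ≤ t) (hj : 1 ≤ j) (htj : t ^ 2 ≤ 2 ^ j) :
    ∑ p ∈ (Finset.Ioc (2 ^ j) (2 ^ (j + 1))).filter (fun p => p.Prime ∧ p % t = 1), (1 : ℝ) / p ≤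
      300 / (t.totient * j) := by
  set P := (Finset.Ioc (2 ^ j) (2 ^ (j + 1))).filter (fun p => p.Prime ∧ p % t = 1) with hP
  have hPm : ∀ p ∈ P, 2 ^ j < p ∧ p ≤ 2 ^ (j + 1) ∧ p.Prime ∧ 1 + t * (p / t) = p := by
    intro p hp
    simp only [hP, Finset.mem_filter, Finset.mem_Ioc] at hp
    refine ⟨hp.1.1, hp.1.2, hp.2.1, ?_⟩
    have := Nat.mod_add_div p t
    rw [hp.2.2] at this
    exact this
  set R := 2 ^ (j / 24) with hR
  set K := 2 ^ j / t + 2 with hK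
  set T := P.image (· / t) with hT
  have hcard : T.card = P.card := Finset.card_image_of_injOn (by
    intro a ha b hb hab
    have h1 := (hPm a ha).2.2.2
    have h2 := (hPm b hb).2.2.2
    simp only at hab
    rw [← h1, ← h2, hab])
  have hRle : R ≤ 2 ^ j := Nat.pow_le_pow_right (by norm_num) (Nat.div_le_self _ _)
  have hTs : T ⊆ Finset.Ico (2 ^ j / t) (2 ^ j / t + K) := by
    intro k hk
    obtain ⟨p, hp, rfl⟩ := Finset.mem_image.1 hk
    have h := hPm p hp
    rw [Finset.mem_Ico]
    refine ⟨Nat.div_le_div_right h.1.le, ?_⟩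
    rw [Nat.div_lt_iff_lt_mul (by omega)]
    have h1 := Nat.lt_div_mul_add (a := 2 ^ j) (b := t) (by omega)
    have h2 := h.2.1
    rw [pow_succ] at h2
    rw [hK]
    nlinarith
  have hcop : ∀ k ∈ T, ∀ d ∈ Finset.Icc 1 R, (1 + t * k).Coprime d := by
    intro k hk d hd
    obtain ⟨p, hp, rfl⟩ := Finset.mem_image.1 hk
    have h := hPm p hp
    rw [h.2.2.2]
    rw [Finset.mem_Icc] at hd
    exact Nat.coprime_of_lt_prime (by omega) (lt_of_le_of_lt (hd.2.trans hRle) h.1) h.2.2.1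
  have hs := card_mul_sq_le_of_coprime hTs hcop
  rw [hcard] at hs
  set G := ∑ d ∈ sieveModuli t R, (1 : ℝ) / d.totient with hG
  have hG1 : 1 ≤ G := by
    have : (1 : ℕ) ∈ sieveModuli t R := by
      simp [sieveModuli, hR, Nat.one_le_two_pow]
    have h2 := Finset.single_le_sum (f := fun d : ℕ => (1 : ℝ) / d.totient)
      (fun d _ => by positivity) this
    rw [hG]
    simpa using h2
  have hGl := (div_ninetysix_le_log j).trans
    (log_add_one_le_mul_sum_sieveModuli (by omega : t ≠ 0) R)
  rw [← hG] at hGl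
  have hφ : (0 : ℝ) < t.totient := by exact_mod_cast Nat.totient_pos.2 (by omega : 0 < t)
  have htr : (2 : ℝ) ≤ t := by exact_mod_cast ht
  have hjr : (1 : ℝ) ≤ j := by exact_mod_cast hj
  have hφt : (t.totient : ℝ) ≤ t := by exact_mod_cast Nat.totient_le t
  have htj' : (t : ℝ) ^ 2 ≤ 2 ^ j := by exact_mod_cast htj
  have hX : (0 : ℝ) < 2 ^ j := by positivity
  have hKr : (K : ℝ) * t ≤ 3 * 2 ^ j := by
    have h1 : 2 ^ j / t * t ≤ 2 ^ j := Nat.div_mul_le_self _ _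
    have h2 : ((2 ^ j / t : ℕ) : ℝ) * t ≤ 2 ^ j := by exact_mod_cast h1
    rw [hK]; push_cast; nlinarith
  have hRj : (t.totient : ℝ) * R ^ 6 * j ≤ 3 * 2 ^ j := by
    have h1 : ((R : ℝ) ^ 6) ^ 4 ≤ 2 ^ j := by
      have : (R ^ 6) ^ 4 ≤ 2 ^ j := by
        rw [hR, ← pow_mul, ← pow_mul]
        exact Nat.pow_le_pow_right (by norm_num) (by omega)
      exact_mod_cast this
    have h2 : (j : ℝ) ^ 4 ≤ 81 * 2 ^ j := by exact_mod_cast pow_four_le_mul_two_pow j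
    have h3 : (t.totient : ℝ) ^ 4 ≤ (2 ^ j) ^ 2 := by
      calc (t.totient : ℝ) ^ 4 ≤ (t : ℝ) ^ 4 := by gcongr
        _ = ((t : ℝ) ^ 2) ^ 2 := by ring
        _ ≤ _ := by gcongr
    refine le_of_pow_le_pow_left₀ (n := 4) (by norm_num) (by positivity) ?_
    calc ((t.totient : ℝ) * R ^ 6 * j) ^ 4 = t.totient ^ 4 * (R ^ 6) ^ 4 * j ^ 4 := by ring
      _ ≤ (2 ^ j) ^ 2 * 2 ^ j * (81 * 2 ^ j) := by gcongr
      _ = _ := by ring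
  have hGφ : (t.totient : ℝ) * j ≤ 96 * t * G := by
    rw [div_mul_eq_mul_div, le_div_iff₀ hφ] at hGl
    linarith
  have hcardb : (P.card : ℝ) * (t.totient * j) ≤ 300 * 2 ^ j := by
    have h1 : (P.card : ℝ) * G ≤ K + R ^ 6 / G := by
      have : (P.card : ℝ) * G * G ≤ (K + R ^ 6 / G) * G := by
        rw [add_mul, div_mul_cancel₀ _ (by linarith : G ≠ 0)]; linarith
      exact le_of_mul_le_mul_right this (by linarith)
    have h2 : (P.card : ℝ) ≤ K / G + R ^ 6 := by
      have h3 : (R : ℝ) ^ 6 / G ≤ R ^ 6 := div_le_self (by positivity) hG1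
      rw [← sub_le_iff_le_add, le_div_iff₀ (by linarith)]
      nlinarith [pow_nonneg (Nat.cast_nonneg R : (0 : ℝ) ≤ R) 6]
    calc (P.card : ℝ) * (t.totient * j) ≤ (K / G + R ^ 6) * (t.totient * j) := by gcongr
      _ = K / G * (t.totient * j) + t.totient * R ^ 6 * j := by ring
      _ ≤ K / G * (96 * t * G) + 3 * 2 ^ j := by gcongr
      _ = 96 * (K * t) + 3 * 2 ^ j := by
        have : G ≠ 0 := by linarith
        field_simp
      _ ≤ _ := by linarith
  have hsum : ∑ p ∈ P, (1 : ℝ) / p ≤ P.card * (1 / 2 ^ j) := by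
    rw [← nsmul_eq_mul]
    refine Finset.sum_le_card_nsmul _ _ _ fun p hp => ?_
    have : (2 : ℝ) ^ j ≤ p := by exact_mod_cast (hPm p hp).1.le
    gcongr
  refine hsum.trans ?_
  rw [le_div_iff₀ (by positivity), mul_one_div, div_mul_eq_mul_div, div_le_iff₀ hX]
  exact hcardb

theorem totient_mul_sum_inv_small_le {t M : ℕ} (ht : 2 ≤ t) (hM : M ≤ 2 * t ^ 2) :
    (t.totient : ℝ) * ∑ p ∈ (Finset.range (M + 1)).filter (fun p => p.Prime ∧ p % t = 1),
      (1 : ℝ) / p ≤ 1 + Real.log (2 * t) := by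
  set P := (Finset.range (M + 1)).filter (fun p => p.Prime ∧ p % t = 1) with hP
  have hPm : ∀ p ∈ P, p ≤ M ∧ p.Prime ∧ 1 + t * (p / t) = p := by
    intro p hp
    simp only [hP, Finset.mem_filter, Finset.mem_range] at hp
    refine ⟨by omega, hp.2.1, ?_⟩
    have := Nat.mod_add_div p t
    rw [hp.2.2] at this
    exact this
  have htr : (0 : ℝ) < t := by exact_mod_cast (by omega : 0 < t)
  have hpos : ∀ p ∈ P, 1 ≤ p / t := by
    intro p hp
    have h := hPm p hp
    rcases Nat.eq_zero_or_pos (p / t) with h0 | h0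
    · rw [h0] at h
      exact absurd h.2.1 (by rw [← h.2.2]; norm_num)
    · exact h0
  have h1 : ∑ p ∈ P, (1 : ℝ) / p ≤ (1 / t) * ∑ k ∈ Finset.Icc 1 (2 * t), (1 : ℝ) / k := by
    calc ∑ p ∈ P, (1 : ℝ) / p ≤ ∑ p ∈ P, (1 / t) * ((1 : ℝ) / (p / t : ℕ)) := by
          refine Finset.sum_le_sum fun p hp => ?_
          have h := hPm p hp
          have hk : (0 : ℝ) < ((p / t : ℕ) : ℝ) := by exact_mod_cast hpos p hp
          have : (t : ℝ) * ((p / t : ℕ) : ℝ) ≤ p := by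
            exact_mod_cast (by omega : t * (p / t) ≤ p)
          rw [one_div_mul_one_div]
          gcongr
      _ = ∑ k ∈ P.image (· / t), (1 / t) * ((1 : ℝ) / k) := by
          rw [Finset.sum_image]
          intro a ha b hb hab
          have e1 := (hPm a ha).2.2
          have e2 := (hPm b hb).2.2
          simp only at hab
          rw [← e1, ← e2, hab]
      _ ≤ ∑ k ∈ Finset.Icc 1 (2 * t), (1 / t) * ((1 : ℝ) / k) := by
          refine Finset.sum_le_sum_of_subset_of_nonneg ?_ fun _ _ _ => by positivity
          intro k hk
          obtain ⟨p, hp, rfl⟩ := Finset.mem_image.1 hk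
          refine Finset.mem_Icc.2 ⟨hpos p hp, ?_⟩
          refine Nat.div_le_of_le_mul ?_
          have := (hPm p hp).1
          nlinarith
      _ = _ := by rw [Finset.mul_sum]
  have h2 : ∑ k ∈ Finset.Icc 1 (2 * t), (1 : ℝ) / k ≤ 1 + Real.log (2 * t) := by
    have h := harmonic_le_one_add_log (2 * t)
    rw [harmonic_eq_sum_Icc] at h
    push_cast at h
    simpa only [one_div] using h
  have hφt : (t.totient : ℝ) ≤ t := by exact_mod_cast Nat.totient_le t
  have hnn : 0 ≤ ∑ p ∈ P, (1 : ℝ) / p := Finset.sum_nonneg fun _ _ => by positivity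
  calc (t.totient : ℝ) * ∑ p ∈ P, (1 : ℝ) / p ≤ t * ∑ p ∈ P, (1 : ℝ) / p := by gcongr
    _ ≤ t * ((1 / t) * ∑ k ∈ Finset.Icc 1 (2 * t), (1 : ℝ) / k) := by gcongr
    _ = ∑ k ∈ Finset.Icc 1 (2 * t), (1 : ℝ) / k := by field_simp
    _ ≤ _ := h2

/-- Upper bound of the right order for all `N` up to `exp (t ^ 6)`, roughly. -/
theorem totient_mul_sum_inv_primes_le {t N : ℕ} (ht : 2 ≤ t) (hN1 : 1 ≤ N)
    (hN : Real.log N ≤ (t : ℝ) ^ 6 + 1) :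
    (t.totient : ℝ) * ∑ p ∈ (Finset.range (N + 1)).filter (fun p => p.Prime ∧ p % t = 1),
      (1 : ℝ) / p ≤ 5000 * Real.log t := by
  set S : ℕ → ℝ := fun M => ∑ p ∈ (Finset.range (M + 1)).filter
    (fun p => p.Prime ∧ p % t = 1), (1 : ℝ) / p with hS
  have hSmono : Monotone S := by
    intro a b hab
    refine Finset.sum_le_sum_of_subset_of_nonneg ?_ fun _ _ _ => by positivity
    exact Finset.filter_subset_filter _ (Finset.range_mono (by omega))
  set J₀ := Nat.clog 2 (t ^ 2) with hJ₀
  have ht4 : 4 ≤ t ^ 2 := by nlinarith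
  have hJ₀l : t ^ 2 ≤ 2 ^ J₀ := Nat.le_pow_clog (by norm_num) _
  have hJ₀pos : 1 ≤ J₀ := Nat.clog_pos (by norm_num) (by omega)
  have hJ₀u : 2 ^ J₀ ≤ 2 * t ^ 2 := by
    have := Nat.pow_pred_clog_lt_self (b := 2) (by norm_num) (by omega : 1 < t ^ 2)
    rw [← hJ₀] at this
    obtain ⟨i, hi⟩ := Nat.exists_eq_add_of_le' hJ₀pos
    rw [hi] at this ⊢
    simp only [Nat.pred_succ] at this
    rw [pow_succ]
    omega
  have hφ : (0 : ℝ) < t.totient := by exact_mod_cast Nat.totient_pos.2 (by omega : 0 < t)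
  have hstep : ∀ i, t.totient * S (2 ^ (J₀ + i)) ≤ t.totient * S (2 ^ J₀) +
      300 * ∑ j ∈ Finset.Ico J₀ (J₀ + i), (1 : ℝ) / j := by
    intro i
    induction i with
    | zero => simp
    | succ i ih =>
      have hd := sum_inv_primes_dyadic_le (t := t) (j := J₀ + i) ht (by omega)
        (hJ₀l.trans (Nat.pow_le_pow_right (by norm_num) (by omega)))
      have hsplit : S (2 ^ (J₀ + (i + 1))) = S (2 ^ (J₀ + i)) +
          ∑ p ∈ (Finset.Ioc (2 ^ (J₀ + i)) (2 ^ (J₀ + i + 1))).filter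
            (fun p => p.Prime ∧ p % t = 1), (1 : ℝ) / p := by
        rw [hS]
        simp only
        rw [← Finset.sum_union]
        · rw [← Finset.filter_union]
          congr 2
          ext p
          have : 2 ^ (J₀ + i) ≤ 2 ^ (J₀ + i + 1) := Nat.pow_le_pow_right (by norm_num) (by omega)
          simp only [Finset.mem_union, Finset.mem_range, Finset.mem_Ioc, ← add_assoc]
          omega
        · refine Finset.disjoint_filter_filter ?_
          rw [Finset.disjoint_left]
          intro p hp hp'
          rw [Finset.mem_range] at hp
          rw [Finset.mem_Ioc] at hp'
          omega
      have hji : (0 : ℝ) < ((J₀ + i : ℕ) : ℝ) := by exact_mod_cast (by omega : 0 < J₀ + i)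
      have hd' : t.totient * (300 / (t.totient * ((J₀ + i : ℕ) : ℝ))) =
          300 * (1 / ((J₀ + i : ℕ) : ℝ)) := by field_simp
      rw [hsplit, ← add_assoc, Finset.sum_Ico_succ_top (by omega), mul_add, mul_add, ← hd']
      have := mul_le_mul_of_nonneg_left hd hφ.le
      linarith
  have h0 : t.totient * S (2 ^ J₀) ≤ 1 + Real.log (2 * t) := totient_mul_sum_inv_small_le ht hJ₀u
  set i := Nat.log 2 N + 1 with hi
  have hNi : N ≤ 2 ^ (J₀ + i) :=
    (Nat.lt_pow_succ_log_self (by norm_num) N).le.trans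
      (Nat.pow_le_pow_right (by norm_num) (by omega))
  have hharm : ∑ j ∈ Finset.Ico J₀ (J₀ + i), (1 : ℝ) / j ≤ 1 + Real.log ((J₀ + i : ℕ) : ℝ) := by
    have h := harmonic_le_one_add_log (J₀ + i)
    rw [harmonic_eq_sum_Icc] at h
    rw [Rat.cast_sum] at h
    refine le_trans ?_ h
    refine (Finset.sum_le_sum_of_subset_of_nonneg (t := Finset.Icc 1 (J₀ + i)) ?_
      fun _ _ _ => by positivity).trans (le_of_eq ?_)
    · intro j hj
      rw [Finset.mem_Ico] at hj
      rw [Finset.mem_Icc]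
      omega
    · refine Finset.sum_congr rfl fun j _ => ?_
      push_cast
      rw [one_div]
  have htr : (2 : ℝ) ≤ t := by exact_mod_cast ht
  have hl2 := Real.log_two_gt_d9
  have hl2' := Real.log_two_lt_d9
  have hlt : Real.log 2 ≤ Real.log t := Real.log_le_log (by norm_num) htr
  have hiu : (Nat.log 2 N : ℝ) ≤ 2 * ((t : ℝ) ^ 6 + 1) := by
    have h1 : ((2 ^ Nat.log 2 N : ℕ) : ℝ) ≤ N := by
      exact_mod_cast Nat.pow_log_le_self 2 (by omega)
    have h2 := Real.log_le_log (by positivity) h1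
    rw [Nat.cast_pow, Real.log_pow, Nat.cast_ofNat] at h2
    nlinarith [(Nat.cast_nonneg (Nat.log 2 N) : (0 : ℝ) ≤ _)]
  have hJu : ((J₀ + i : ℕ) : ℝ) ≤ (t : ℝ) ^ 9 := by
    have h1 : J₀ < 2 ^ J₀ := Nat.lt_two_pow_self
    have h2 : (J₀ : ℝ) ≤ 2 * (t : ℝ) ^ 2 := by exact_mod_cast h1.le.trans hJ₀u
    have h3 : (1 : ℝ) ≤ (t : ℝ) ^ 2 := one_le_pow₀ (by linarith)
    have h4 : (2 : ℝ) ^ 4 ≤ (t : ℝ) ^ 4 := by gcongr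
    have h5 : (2 : ℝ) ^ 3 ≤ (t : ℝ) ^ 3 := by gcongr
    have h6 : (2 : ℝ) ^ 6 ≤ (t : ℝ) ^ 6 := by gcongr
    have e1 : (t : ℝ) ^ 6 = t ^ 2 * t ^ 4 := by ring
    have e2 : (t : ℝ) ^ 9 = t ^ 6 * t ^ 3 := by ring
    have h7 : (t : ℝ) ^ 2 * 2 ^ 4 ≤ t ^ 6 := by rw [e1]; gcongr
    have h8 : (t : ℝ) ^ 6 * 2 ^ 3 ≤ t ^ 9 := by rw [e2]; gcongr
    rw [hi]; push_cast
    linarith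
  have hlog : Real.log ((J₀ + i : ℕ) : ℝ) ≤ 9 * Real.log t := by
    have := Real.log_le_log (by exact_mod_cast (by omega : 0 < J₀ + i)) hJu
    rwa [Real.log_pow] at this
  have hlog2 : Real.log (2 * t) ≤ 2 * Real.log t := by
    rw [Real.log_mul (by norm_num) (by linarith)]; linarith
  calc (t.totient : ℝ) * S N ≤ t.totient * S (2 ^ (J₀ + i)) := by
        gcongr; exact hSmono hNi
    _ ≤ _ := hstep i
    _ ≤ (1 + Real.log (2 * t)) + 300 * (1 + Real.log ((J₀ + i : ℕ) : ℝ)) := by gcongr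
    _ ≤ _ := by linarith

theorem norm_sum_range_dirichletCharacter_le {t : ℕ} [NeZero t] {χ : DirichletCharacter ℂ t}
    (hχ : χ ≠ 1) (n : ℕ) : ‖∑ i ∈ Finset.range n, χ (i : ZMod t)‖ ≤ t := by
  have hz : ∑ i ∈ Finset.range t, χ (i : ZMod t) = 0 := by
    rw [← MulChar.sum_eq_zero_of_ne_one hχ]
    refine Finset.sum_bij (fun i _ => (i : ZMod t)) (fun _ _ => Finset.mem_univ _) ?_ ?_
      fun _ _ => rfl
    · intro a ha b hb hab
      rw [Finset.mem_range] at ha hb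
      rwa [ZMod.natCast_eq_natCast_iff', Nat.mod_eq_of_lt ha, Nat.mod_eq_of_lt hb] at hab
    · intro b _
      exact ⟨b.val, Finset.mem_range.2 (ZMod.val_lt b), ZMod.natCast_zmod_val b⟩
  have hper : Function.Periodic (fun n => ∑ i ∈ Finset.range n, χ (i : ZMod t)) t := by
    intro n
    simp only
    rw [add_comm, Finset.sum_range_add, hz, zero_add]
    simp
  have hmod := hper.map_mod_nat n
  rw [← hmod]
  refine (norm_sum_le_of_le (f := fun i : ℕ => χ (i : ZMod t)) _
    (fun i _ => χ.norm_le_one (i : ZMod t))).trans ?_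
  simp only [Finset.sum_const, Finset.card_range, nsmul_eq_mul, mul_one, Nat.cast_le]
  exact (Nat.mod_lt n (Nat.pos_of_neZero t)).le

theorem norm_sum_range_shift_dirichletCharacter_le {t : ℕ} [NeZero t] {χ : DirichletCharacter ℂ t}
    (hχ : χ ≠ 1) (a n : ℕ) :
    ‖∑ i ∈ Finset.range n, χ ((a + i : ℕ) : ZMod t)‖ ≤ 2 * t := by
  have h := Finset.sum_range_add (fun i : ℕ => χ (i : ZMod t)) a n
  have h2 := norm_sub_le (∑ i ∈ Finset.range (a + n), χ (i : ZMod t))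
    (∑ i ∈ Finset.range a, χ (i : ZMod t))
  rw [h, add_sub_cancel_left, ← h] at h2
  linarith [norm_sum_range_dirichletCharacter_le hχ a,
    norm_sum_range_dirichletCharacter_le hχ (a + n)]

/-- Abel's inequality. -/
theorem norm_sum_range_smul_le {E : Type*} [NormedAddCommGroup E] [NormedSpace ℝ E]
    {z : ℕ → E} {g : ℕ → ℝ} {B : ℝ} (hz : ∀ n, ‖∑ i ∈ Finset.range n, z i‖ ≤ B)
    (hg : Antitone g) (hg0 : ∀ n, 0 ≤ g n) (n : ℕ) :
    ‖∑ i ∈ Finset.range n, g i • z i‖ ≤ B * g 0 := by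
  have hid : ∀ m, ∑ i ∈ Finset.range m, g i • z i = g m • ∑ i ∈ Finset.range m, z i +
      ∑ i ∈ Finset.range m, (g i - g (i + 1)) • ∑ j ∈ Finset.range (i + 1), z j := by
    intro m
    induction m with
    | zero => simp
    | succ m ih =>
      rw [Finset.sum_range_succ, ih, Finset.sum_range_succ (fun i => (g i - g (i + 1)) • _) m,
        Finset.sum_range_succ z m]
      module
  rw [hid n]
  refine (norm_add_le _ _).trans ?_
  have h1 : ‖g n • ∑ i ∈ Finset.range n, z i‖ ≤ g n * B := by
    rw [norm_smul, Real.norm_of_nonneg (hg0 n)]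
    exact mul_le_mul_of_nonneg_left (hz n) (hg0 n)
  have h2 : ‖∑ i ∈ Finset.range n, (g i - g (i + 1)) • ∑ j ∈ Finset.range (i + 1), z j‖ ≤
      ∑ i ∈ Finset.range n, (g i - g (i + 1)) * B := by
    refine norm_sum_le_of_le _ fun i _ => ?_
    have : 0 ≤ g i - g (i + 1) := sub_nonneg.2 (hg (Nat.le_succ i))
    rw [norm_smul, Real.norm_of_nonneg this]
    exact mul_le_mul_of_nonneg_left (hz _) this
  rw [← Finset.sum_mul, Finset.sum_range_sub'] at h2
  linarith

theorem exists_norm_sub_sum_dirichletCharacter_div_le {t : ℕ} [NeZero t]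
    {χ : DirichletCharacter ℂ t} (hχ : χ ≠ 1) :
    ∃ L : ℂ, ∀ a : ℕ, 1 ≤ a →
      ‖L - ∑ n ∈ Finset.range a, χ (n : ZMod t) / n‖ ≤ 2 * t / a := by
  have htail : ∀ a k : ℕ, 1 ≤ a → ‖(∑ n ∈ Finset.range (a + k), χ (n : ZMod t) / n) -
      ∑ n ∈ Finset.range a, χ (n : ZMod t) / n‖ ≤ 2 * t / a := by
    intro a k ha
    rw [Finset.sum_range_add, add_sub_cancel_left]
    have h := norm_sum_range_smul_le (g := fun i => 1 / ((a + i : ℕ) : ℝ))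
      (norm_sum_range_shift_dirichletCharacter_le hχ a) ?_ (fun n => by positivity) k
    · rw [add_zero, mul_one_div] at h
      refine le_of_eq_of_le ?_ h
      congr 1
      refine Finset.sum_congr rfl fun i _ => ?_
      rw [Complex.real_smul]
      push_cast
      ring
    · intro i j hij
      have : (0 : ℝ) < ((a + i : ℕ) : ℝ) := by exact_mod_cast (by omega : 0 < a + i)
      exact one_div_le_one_div_of_le this (by exact_mod_cast (by omega : a + i ≤ a + j))
  have hlim : Filter.Tendsto (fun a : ℕ => 2 * (t : ℝ) / a) Filter.atTop (nhds 0) :=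
    tendsto_const_div_atTop_nhds_zero_nat _
  have hc : CauchySeq (fun a : ℕ => ∑ n ∈ Finset.range (a + 1), χ (n : ZMod t) / n) := by
    refine cauchySeq_of_le_tendsto_0' (fun a : ℕ => 2 * (t : ℝ) / ((a + 1 : ℕ) : ℝ)) ?_
      (hlim.comp (Filter.tendsto_add_atTop_nat 1))
    intro n m hnm
    obtain ⟨k, rfl⟩ := Nat.exists_eq_add_of_le hnm
    rw [dist_comm, dist_eq_norm, show n + k + 1 = n + 1 + k by ring]
    exact htail (n + 1) k (by omega)
  obtain ⟨L, hL⟩ := cauchySeq_tendsto_of_complete hc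
  refine ⟨L, fun a ha => ?_⟩
  have hL' : Filter.Tendsto (fun a : ℕ => ∑ n ∈ Finset.range a, χ (n : ZMod t) / n)
      Filter.atTop (nhds L) :=
    (Filter.tendsto_add_atTop_iff_nat (f := fun a : ℕ => ∑ n ∈ Finset.range a,
      χ (n : ZMod t) / (n : ℂ)) 1).1 hL
  refine le_of_tendsto ((hL'.sub_const _).norm) ?_
  filter_upwards [Filter.eventually_ge_atTop a] with m hm
  obtain ⟨k, rfl⟩ := Nat.exists_eq_add_of_le hm
  exact htail a k ha

theorem rpow_neg_sub_rpow_neg_succ_le {δ : ℝ} (hδ : 0 < δ) {n : ℕ} (hn : 1 ≤ n) :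
    ((n : ℝ) ^ (-δ)) - ((n + 1 : ℕ) : ℝ) ^ (-δ) ≤ δ / n := by
  have hn0 : (0 : ℝ) < n := by exact_mod_cast hn
  have hn1 : (1 : ℝ) ≤ n := by exact_mod_cast hn
  have h1 : ((n + 1 : ℕ) : ℝ) = n * (1 + 1 / n) := by push_cast; field_simp
  have hp : (0 : ℝ) < 1 + 1 / n := by positivity
  have h2 : 1 - δ * (1 / n) ≤ (1 + 1 / (n : ℝ)) ^ (-δ) := by
    rw [Real.rpow_def_of_pos hp]
    have h3 := Real.add_one_le_exp (Real.log (1 + 1 / (n : ℝ)) * -δ)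
    have h4 := Real.log_le_sub_one_of_pos hp
    have h5 : δ * Real.log (1 + 1 / (n : ℝ)) ≤ δ * (1 / n) :=
      mul_le_mul_of_nonneg_left (by linarith) hδ.le
    linarith
  rw [h1, Real.mul_rpow hn0.le hp.le]
  have h6 : (n : ℝ) ^ (-δ) ≤ 1 := Real.rpow_le_one_of_one_le_of_nonpos hn1 (by linarith)
  have h7 : 0 ≤ (n : ℝ) ^ (-δ) := by positivity
  have h8 : 0 ≤ δ * (1 / (n : ℝ)) := by positivity
  have h9 : (n : ℝ) ^ (-δ) * (1 - δ * (1 / n)) ≤ (n : ℝ) ^ (-δ) * (1 + 1 / (n : ℝ)) ^ (-δ) :=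
    mul_le_mul_of_nonneg_left h2 h7
  rw [div_eq_mul_one_div δ]
  nlinarith

theorem norm_LSeries_one_add_sub_le {f : ℕ → ℂ} {L : ℂ} {B δ : ℝ} (hδ : 0 < δ) (hB : 0 ≤ B)
    (hf : LSeriesSummable f (1 + δ))
    (hL : ∀ a : ℕ, 1 ≤ a → ‖L - ∑ n ∈ Finset.range a, f n / n‖ ≤ B / a) :
    ‖LSeries f (1 + δ) - L‖ ≤ B * δ := by
  have hterm : ∀ n, LSeries.term f (1 + δ) n = f n / n * ((n : ℝ) ^ (-δ) : ℝ) := by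
    intro n
    rcases Nat.eq_zero_or_pos n with rfl | hn
    · simp
    · have hn0 : (n : ℂ) ≠ 0 := by exact_mod_cast hn.ne'
      rw [LSeries.term_of_ne_zero hn.ne', Complex.cpow_add _ _ hn0, Complex.cpow_one,
        Real.rpow_neg (by positivity), Complex.ofReal_inv, Complex.ofReal_cpow (by positivity)]
      simp only [Complex.ofReal_natCast]
      rw [div_mul_eq_div_div]
      rfl
  set S : ℕ → ℂ := fun a => ∑ n ∈ Finset.range a, f n / n with hS
  set P : ℕ → ℂ := fun a => ∑ n ∈ Finset.range a, LSeries.term f (1 + δ) n with hP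
  have hbound : ∀ a : ℕ, ‖P (a + 1) - L + (((a + 1 : ℕ) : ℝ) ^ (-δ) : ℝ) * (L - S (a + 1))‖ ≤
      B * δ * (1 - 1 / ((a + 1 : ℕ) : ℝ)) := by
    intro a
    induction a with
    | zero => simp [hP, hS]
    | succ a ih =>
      have hid : P (a + 1 + 1) - L + (((a + 1 + 1 : ℕ) : ℝ) ^ (-δ) : ℝ) * (L - S (a + 1 + 1)) =
          (P (a + 1) - L + (((a + 1 : ℕ) : ℝ) ^ (-δ) : ℝ) * (L - S (a + 1))) -
          ((((a + 1 : ℕ) : ℝ) ^ (-δ) - ((a + 1 + 1 : ℕ) : ℝ) ^ (-δ) : ℝ) : ℂ) *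
            (L - S (a + 1 + 1)) := by
        simp only [hP, hS]
        rw [Finset.sum_range_succ _ (a + 1), Finset.sum_range_succ _ (a + 1), hterm (a + 1)]
        push_cast
        ring
      rw [hid]
      refine (norm_sub_le _ _).trans ?_
      have h1 := rpow_neg_sub_rpow_neg_succ_le hδ (n := a + 1) (by omega)
      have h2 : 0 ≤ ((a + 1 : ℕ) : ℝ) ^ (-δ) - ((a + 1 + 1 : ℕ) : ℝ) ^ (-δ) := by
        rw [sub_nonneg]
        refine Real.rpow_le_rpow_of_nonpos (by positivity) ?_ (by linarith)
        exact_mod_cast Nat.le_succ _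
      have h3 := hL (a + 1 + 1) (by omega)
      have h4 : ‖((((a + 1 : ℕ) : ℝ) ^ (-δ) - ((a + 1 + 1 : ℕ) : ℝ) ^ (-δ) : ℝ) : ℂ) *
            (L - S (a + 1 + 1))‖ ≤ δ / ((a + 1 : ℕ) : ℝ) * (B / ((a + 1 + 1 : ℕ) : ℝ)) := by
        rw [norm_mul, Complex.norm_real, Real.norm_of_nonneg h2]
        exact mul_le_mul h1 h3 (norm_nonneg _) (by positivity)
      refine (add_le_add ih h4).trans (le_of_eq ?_)
      push_cast
      have h5 : (a : ℝ) + 1 ≠ 0 := by positivity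
      have h6 : (a : ℝ) + 1 + 1 ≠ 0 := by positivity
      field_simp
      ring
  have hP' : Filter.Tendsto P Filter.atTop (nhds (LSeries f (1 + δ))) :=
    hf.hasSum.tendsto_sum_nat
  have hz : Filter.Tendsto (fun a : ℕ => (((a + 1 : ℕ) : ℝ) ^ (-δ) : ℝ) * (L - S (a + 1)))
      Filter.atTop (nhds 0) := by
    have hlim : Filter.Tendsto (fun a : ℕ => B / ((a + 1 : ℕ) : ℝ)) Filter.atTop (nhds 0) :=
      (tendsto_const_div_atTop_nhds_zero_nat B).comp (Filter.tendsto_add_atTop_nat 1)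
    refine squeeze_zero_norm (fun a => ?_) hlim
    rw [norm_mul, Complex.norm_real, Real.norm_of_nonneg (by positivity)]
    have h6 : ((a + 1 : ℕ) : ℝ) ^ (-δ) ≤ 1 :=
      Real.rpow_le_one_of_one_le_of_nonpos (by exact_mod_cast (by omega : 1 ≤ a + 1))
        (by linarith)
    have := mul_le_mul h6 (hL (a + 1) (by omega)) (norm_nonneg _) zero_le_one
    rwa [one_mul] at this
  have hlim := (((hP'.comp (Filter.tendsto_add_atTop_nat 1)).sub_const L).add hz).norm
  rw [add_zero] at hlim
  refine le_of_tendsto hlim (Filter.Eventually.of_forall fun a => (hbound a).trans ?_)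
  have : (0 : ℝ) ≤ 1 / ((a + 1 : ℕ) : ℝ) := by positivity
  nlinarith [mul_nonneg hB hδ.le]

theorem sum_range_rpow_le {δ : ℝ} (hδ : 0 < δ) (N : ℕ) :
    ∑ n ∈ Finset.range N, ((n + 1 : ℕ) : ℝ) ^ (-(1 + δ)) ≤ 1 + 1 / δ := by
  have key : ∀ N : ℕ, ∑ n ∈ Finset.range (N + 1), ((n + 1 : ℕ) : ℝ) ^ (-(1 + δ)) ≤
      1 + 1 / δ * (1 - ((N + 1 : ℕ) : ℝ) ^ (-δ)) := by
    intro N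
    induction N with
    | zero => simp
    | succ N ih =>
      rw [Finset.sum_range_succ]
      set x : ℝ := ((N + 1 : ℕ) : ℝ) with hx
      have hx1 : ((N + 1 + 1 : ℕ) : ℝ) = x + 1 := by rw [hx]; push_cast; ring
      have hx0 : 0 < x := by rw [hx]; positivity
      rw [hx1]
      have h1 : x ^ (-δ) = (x + 1) ^ (-δ) * (x / (x + 1)) ^ (-δ) := by
        rw [← Real.mul_rpow (by positivity) (by positivity)]
        congr 1
        field_simp
      have h2 : 1 + δ * (1 / (x + 1)) ≤ (x / (x + 1)) ^ (-δ) := by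
        have hp : 0 < x / (x + 1) := by positivity
        rw [Real.rpow_def_of_pos hp]
        have h3 := Real.add_one_le_exp (Real.log (x / (x + 1)) * -δ)
        have h4 := Real.log_le_sub_one_of_pos hp
        have h5 : x / (x + 1) - 1 = -(1 / (x + 1)) := by field_simp; ring
        rw [h5] at h4
        nlinarith
      have h6 : (x + 1) ^ (-(1 + δ)) = (x + 1) ^ (-δ) * (1 / (x + 1)) := by
        rw [neg_add, Real.rpow_add (by positivity), Real.rpow_neg_one]
        ring
      have h7 : 0 ≤ (x + 1) ^ (-δ) := by positivity
      have h8 := mul_le_mul_of_nonneg_left h2 h7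
      rw [← h1] at h8
      have h9 : δ * (x + 1) ^ (-(1 + δ)) ≤ x ^ (-δ) - (x + 1) ^ (-δ) := by rw [h6]; linarith
      have h10 : (x + 1) ^ (-(1 + δ)) ≤ 1 / δ * (x ^ (-δ) - (x + 1) ^ (-δ)) := by
        rw [one_div, inv_mul_eq_div, le_div_iff₀ hδ]
        linarith
      linarith
  have h0 : 0 ≤ 1 / δ := by positivity
  rcases N with _ | N
  · simp; positivity
  · refine (key N).trans ?_
    have : 0 ≤ ((N + 1 : ℕ) : ℝ) ^ (-δ) := by positivity
    nlinarith [mul_nonneg h0 this]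

theorem norm_LSeries_one_add_le {f : ℕ → ℂ} {δ : ℝ} (hδ : 0 < δ)
    (hf : ∀ n, ‖f n‖ ≤ 1) (hs : LSeriesSummable f (1 + δ)) :
    ‖LSeries f (1 + δ)‖ ≤ 1 + 1 / δ := by
  have h := hs.hasSum.tendsto_sum_nat.comp (Filter.tendsto_add_atTop_nat 1)
  refine le_of_tendsto h.norm (Filter.Eventually.of_forall fun N => ?_)
  simp only [Function.comp_apply]
  rw [Finset.sum_range_succ', LSeries.term_zero, add_zero]
  refine (norm_sum_le_of_le _ fun n _ => ?_).trans (sum_range_rpow_le hδ N)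
  have hre : (1 + (δ : ℂ)).re = 1 + δ := by simp
  rw [LSeries.norm_term_eq, if_neg (by omega), hre, Real.rpow_neg (by positivity), div_eq_mul_inv]
  refine (mul_le_mul_of_nonneg_right (hf (n + 1)) (by positivity)).trans (le_of_eq (one_mul _))

theorem norm_lvalue_le {t : ℕ} {f : ℕ → ℂ} {L : ℂ}
    (hL : ∀ a : ℕ, 1 ≤ a → ‖L - ∑ n ∈ Finset.range a, f n / n‖ ≤ 2 * t / a) :
    ‖L‖ ≤ 2 * t := by
  simpa using hL 1 le_rfl

theorem le_norm_lvalue_of_sq_ne_one {t : ℕ} [NeZero t] {χ : DirichletCharacter ℂ t}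
    (hχ2 : χ ^ 2 ≠ 1) {L : ℂ}
    (hL : ∀ a : ℕ, 1 ≤ a → ‖L - ∑ n ∈ Finset.range a, χ (n : ZMod t) / n‖ ≤ 2 * t / a) :
    1 / (8192 * (t : ℝ) ^ 4) ≤ ‖L‖ := by
  have ht : (1 : ℝ) ≤ t := by exact_mod_cast Nat.pos_of_neZero t
  obtain ⟨L₂, hL₂⟩ := exists_norm_sub_sum_dirichletCharacter_div_le hχ2
  set δ : ℝ := 1 / (16384 * (t : ℝ) ^ 5) with hδdef
  have ht5 : (1 : ℝ) ≤ (t : ℝ) ^ 5 := one_le_pow₀ ht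
  have hδ : 0 < δ := by positivity
  have hδ1 : δ ≤ 1 := by
    rw [hδdef, div_le_one (by positivity)]; linarith
  have hre : 1 < (1 + (δ : ℂ)).re := by simp [hδ]
  have hs := fun ψ : DirichletCharacter ℂ t => ψ.LSeriesSummable_of_one_lt_re hre
  have h0 := norm_LSeries_one_add_le hδ (fun n => (1 : DirichletCharacter ℂ t).norm_le_one n) (hs 1)
  have h1 := norm_LSeries_one_add_sub_le hδ (by positivity) (hs χ) hL
  have h2 := norm_LSeries_one_add_sub_le hδ (by positivity) (hs (χ ^ 2)) hL₂
  have hLb := norm_lvalue_le hL₂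
  have h3 := DirichletCharacter.norm_LSeries_product_ge_one χ hδ 0
  simp only [Complex.ofReal_zero, mul_zero, add_zero] at h3
  rw [norm_mul, norm_mul, norm_pow, norm_pow] at h3
  have h0' : ‖LSeries (fun n : ℕ => (1 : DirichletCharacter ℂ t) n) (1 + δ)‖ ≤ 2 / δ := by
    refine h0.trans ?_
    have : 1 ≤ 1 / δ := (one_le_div hδ).2 hδ1
    rw [show 2 / δ = 1 / δ + 1 / δ by ring]
    linarith
  have h2' : ‖LSeries (fun n : ℕ => (χ ^ 2 : DirichletCharacter ℂ t) n) (1 + δ)‖ ≤ 4 * t := by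
    have := norm_le_norm_add_norm_sub' (LSeries (fun n : ℕ => (χ ^ 2 : DirichletCharacter ℂ t) n)
      (1 + δ)) L₂
    nlinarith
  by_contra! hcon
  have htδ : 2 * t * δ = 1 / (8192 * (t : ℝ) ^ 4) := by
    rw [hδdef]; field_simp; norm_num
  have h1' : ‖LSeries (fun n : ℕ => χ n) (1 + δ)‖ ≤ 4 * t * δ := by
    have := norm_le_norm_add_norm_sub' (LSeries (fun n : ℕ => χ n) (1 + δ)) L
    linarith
  have h4 : (1 : ℝ) ≤ (2 / δ) ^ 3 * (4 * t * δ) ^ 4 * (4 * t) := by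
    refine h3.le.trans ?_
    gcongr
  have h5 : (2 / δ) ^ 3 * (4 * t * δ) ^ 4 * (4 * t) = 8192 * (t : ℝ) ^ 5 * δ := by
    field_simp; norm_num
  have h6 : 8192 * (t : ℝ) ^ 5 * δ = 1 / 2 := by
    rw [hδdef]; field_simp; norm_num
  linarith

theorem sum_Ioc_sum_divisorsAntidiagonal {R : Type*} [AddCommMonoid R] (F : ℕ → ℕ → R) (N : ℕ) :
    ∑ n ∈ Finset.Ioc 0 N, ∑ x ∈ n.divisorsAntidiagonal, F x.1 x.2 =
      ∑ n ∈ Finset.Ioc 0 N, ∑ m ∈ Finset.Ioc 0 (N / n), F n m := by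
  rw [Finset.sum_sigma', Finset.sum_sigma']
  refine Finset.sum_bij' (fun x _ => ⟨x.2.1, x.2.2⟩) (fun x _ => ⟨x.1 * x.2, (x.1, x.2)⟩)
    ?_ ?_ ?_ ?_ ?_
  · rintro ⟨n, a, b⟩ h
    simp only [Finset.mem_sigma, Finset.mem_Ioc, Nat.mem_divisorsAntidiagonal] at h ⊢
    obtain ⟨⟨hn, hN⟩, rfl, -⟩ := h
    have ha : 0 < a := Nat.pos_of_mul_pos_right hn
    have hb : 0 < b := Nat.pos_of_mul_pos_left hn
    refine ⟨⟨ha, (Nat.le_mul_of_pos_right a hb).trans hN⟩, hb, ?_⟩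
    rwa [Nat.le_div_iff_mul_le ha, mul_comm]
  · rintro ⟨a, b⟩ h
    simp only [Finset.mem_sigma, Finset.mem_Ioc, Nat.mem_divisorsAntidiagonal] at h ⊢
    obtain ⟨⟨ha, haN⟩, hb, hbN⟩ := h
    rw [Nat.le_div_iff_mul_le ha, mul_comm] at hbN
    have := Nat.mul_pos ha hb
    exact ⟨⟨this, hbN⟩, trivial, this.ne'⟩
  · rintro ⟨n, a, b⟩ h
    simp only [Finset.mem_sigma, Finset.mem_Ioc, Nat.mem_divisorsAntidiagonal] at h
    obtain ⟨-, rfl, -⟩ := h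
    rfl
  · rintro ⟨a, b⟩ _
    rfl
  · rintro ⟨n, a, b⟩ _
    rfl

theorem sum_Ioc_eq_sum_range_succ {R : Type*} [AddCommMonoid R] (f : ℕ → R) (N : ℕ) :
    ∑ n ∈ Finset.Ioc 0 N, f n = ∑ i ∈ Finset.range N, f (i + 1) := by
  have : Finset.Ioc 0 N = Finset.Ico 1 (N + 1) := by
    ext; simp only [Finset.mem_Ioc, Finset.mem_Ico]; omega
  rw [this, Finset.sum_Ico_eq_sum_range, Nat.add_sub_cancel]
  simp only [add_comm]

theorem mul_pow_le_geom_sum_sq {w : ℝ} (i : ℕ) :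
    ((i + 1 : ℕ) : ℝ) * w ^ i ≤ ∑ j ∈ Finset.range (i + 1), (w ^ 2) ^ j := by
  have h := Finset.sum_range_reflect (fun j => (w ^ 2) ^ j) (i + 1)
  have h2 : ∑ j ∈ Finset.range (i + 1), 2 * w ^ i ≤
      ∑ j ∈ Finset.range (i + 1), ((w ^ 2) ^ j + (w ^ 2) ^ (i + 1 - 1 - j)) := by
    refine Finset.sum_le_sum fun j hj => ?_
    rw [Finset.mem_range] at hj
    obtain ⟨k, rfl⟩ := Nat.exists_eq_add_of_le (Nat.le_of_lt_succ hj)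
    rw [Nat.add_sub_cancel, Nat.add_sub_cancel_left, pow_add, ← pow_mul, ← pow_mul,
      mul_comm 2 j, mul_comm 2 k, pow_mul, pow_mul]
    nlinarith [sq_nonneg (w ^ j - w ^ k)]
  rw [Finset.sum_add_distrib, h, Finset.sum_const, Finset.card_range, nsmul_eq_mul] at h2
  linarith

theorem lambert_sub_eq {z : ℝ} (hz0 : 0 < z) (hz1 : z < 1) (i : ℕ) :
    1 / (((i + 1 : ℕ) : ℝ) * (1 - z)) - z ^ (i + 1) / (1 - z ^ (i + 1)) =
      (1 / ((i + 1 : ℕ) : ℝ) - z ^ (i + 1) / ∑ j ∈ Finset.range (i + 1), z ^ j) / (1 - z) := by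
  rw [← mul_neg_geom_sum]
  have : 1 - z ≠ 0 := by linarith
  have hs : (∑ j ∈ Finset.range (i + 1), z ^ j) ≠ 0 :=
    (Finset.sum_pos (fun j _ => by positivity) ⟨0, by simp⟩).ne'
  field_simp

theorem lambert_sub_nonneg {z : ℝ} (hz0 : 0 < z) (hz1 : z < 1) (i : ℕ) :
    0 ≤ 1 / (((i + 1 : ℕ) : ℝ) * (1 - z)) - z ^ (i + 1) / (1 - z ^ (i + 1)) := by
  rw [lambert_sub_eq hz0 hz1]
  refine div_nonneg ?_ (by linarith)
  have hs : 0 < (∑ j ∈ Finset.range (i + 1), z ^ j) :=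
    Finset.sum_pos (fun j _ => by positivity) ⟨0, by simp⟩
  rw [sub_nonneg, div_le_div_iff₀ hs (by positivity), one_mul]
  have h : ∑ j ∈ Finset.range (i + 1), z ^ (i + 1) ≤ ∑ j ∈ Finset.range (i + 1), z ^ j :=
    Finset.sum_le_sum fun j hj =>
      pow_le_pow_of_le_one hz0.le hz1.le (Finset.mem_range.1 hj).le
  rw [Finset.sum_const, Finset.card_range, nsmul_eq_mul] at h
  linarith

theorem lambert_sub_antitone {w : ℝ} (hw0 : 0 < w) (hw1 : w < 1) :
    Antitone fun i : ℕ => 1 / (((i + 1 : ℕ) : ℝ) * (1 - w ^ 2)) -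
      (w ^ 2) ^ (i + 1) / (1 - (w ^ 2) ^ (i + 1)) := by
  have hz0 : 0 < w ^ 2 := by positivity
  have hz1 : w ^ 2 < 1 := by nlinarith
  refine antitone_nat_of_succ_le fun i => ?_
  rw [lambert_sub_eq hz0 hz1, lambert_sub_eq hz0 hz1]
  refine div_le_div_of_nonneg_right ?_ (by linarith)
  have h1 := mul_pow_le_geom_sum_sq (w := w) i
  have h2 := mul_pow_le_geom_sum_sq (w := w) (i + 1)
  have hs : 0 < (∑ j ∈ Finset.range (i + 1), (w ^ 2) ^ j) :=
    Finset.sum_pos (fun j _ => by positivity) ⟨0, by simp⟩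
  have hsucc := geom_sum_succ (x := w ^ 2) (n := i + 1)
  set s := ∑ j ∈ Finset.range (i + 1), (w ^ 2) ^ j
  set s' := ∑ j ∈ Finset.range (i + 1 + 1), (w ^ 2) ^ j
  have hs' : 0 < s' := by rw [hsucc]; positivity
  set d : ℝ := ((i + 1 : ℕ) : ℝ) with hd
  have hd0 : 0 < d := by rw [hd]; positivity
  have hd1 : ((i + 1 + 1 : ℕ) : ℝ) = d + 1 := by rw [hd]; push_cast; ring
  rw [hd1] at h2 ⊢
  have h3 : d * w ^ i * ((d + 1) * w ^ (i + 1)) ≤ s * s' :=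
    mul_le_mul h1 h2 (by positivity) hs.le
  have h4 : (w ^ 2) ^ (i + 1) ≤ w ^ i * w ^ (i + 1) := by
    rw [← pow_mul, ← pow_add]
    exact pow_le_pow_of_le_one hw0.le hw1.le (by omega)
  have h5 : (w ^ 2) ^ (i + 1) / (s * s') ≤ 1 / (d * (d + 1)) := by
    rw [div_le_div_iff₀ (by positivity) (by positivity), one_mul]
    refine le_trans ?_ h3
    have := mul_le_mul_of_nonneg_left h4 (by positivity : 0 ≤ d * (d + 1))
    linarith
  have h6 : 1 / d - 1 / (d + 1) = 1 / (d * (d + 1)) := by field_simp; ring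
  have h7 : (w ^ 2) ^ (i + 1) / s - (w ^ 2) ^ (i + 1 + 1) / s' = (w ^ 2) ^ (i + 1) / (s * s') := by
    rw [pow_succ (w ^ 2) (i + 1), hsucc]
    rw [hsucc] at hs'
    field_simp
    ring
  linarith

open ArithmeticFunction in
open scoped ComplexOrder in
theorem one_le_zetaMul_sq {t : ℕ} {χ : DirichletCharacter ℂ t} (hχ : χ ^ 2 = 1) {m : ℕ}
    (hm : m ≠ 0) : 1 ≤ χ.zetaMul (m ^ 2) := by
  rw [χ.isMultiplicative_zetaMul.multiplicative_factorization _ (pow_ne_zero 2 hm)]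
  refine Finset.prod_induction _ (fun z : ℂ => 1 ≤ z) (fun a b => one_le_mul_of_one_le_of_one_le)
    le_rfl fun p hp => ?_
  have hp' : p.Prime := Nat.prime_of_mem_primeFactors hp
  rw [Nat.factorization_pow]
  simp only [Finsupp.smul_apply, smul_eq_mul]
  set k := m.factorization p
  have h : χ.zetaMul (p ^ (2 * k)) = ∑ i ∈ Finset.range (2 * k + 1), χ (p : ZMod t) ^ i := by
    rw [DirichletCharacter.zetaMul, coe_zeta_mul_apply, Nat.sum_divisors_prime_pow hp']
    refine Finset.sum_congr rfl fun i _ => ?_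
    simp [toArithmeticFunction, hp'.ne_zero]
  rw [h]
  rcases MulChar.isQuadratic_iff_sq_eq_one.mpr hχ (p : ZMod t) with h | h | h
  · rw [h, Finset.sum_range_succ']
    simp
  · rw [h]
    simp only [one_pow, Finset.sum_const, Finset.card_range, nsmul_eq_mul, mul_one]
    exact_mod_cast (by omega : 1 ≤ 2 * k + 1)
  · rw [h, neg_one_geom_sum, if_neg (by simp)]

open ArithmeticFunction in
theorem norm_sum_zetaMul_mul_pow_le {t : ℕ} [NeZero t] {χ : DirichletCharacter ℂ t}
    (hχ : χ ≠ 1) {L : ℂ}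
    (hL : ∀ a : ℕ, 1 ≤ a → ‖L - ∑ n ∈ Finset.range a, χ (n : ZMod t) / n‖ ≤ 2 * t / a)
    {w : ℝ} (hw0 : 0 < w) (hw1 : w < 1) (X : ℕ) :
    ‖∑ n ∈ Finset.Ioc 0 X, χ.zetaMul n * ((w : ℂ) ^ 2) ^ n‖ ≤
      ‖L‖ / (1 - w ^ 2) + 2 * t / ((X + 1 : ℕ) : ℝ) / (1 - w ^ 2) + 2 * t +
        X * (w ^ 2) ^ X / (1 - w ^ 2) := by
  have hz0 : 0 < w ^ 2 := by positivity
  have hz1 : w ^ 2 < 1 := by nlinarith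
  set z : ℝ := w ^ 2 with hz
  have hzc : (w : ℂ) ^ 2 = ((z : ℝ) : ℂ) := by rw [hz]; push_cast; rfl
  have hT : ∑ n ∈ Finset.Ioc 0 X, χ.zetaMul n * ((w : ℂ) ^ 2) ^ n =
      ∑ d ∈ Finset.Ioc 0 X, χ (d : ZMod t) * ((∑ m ∈ Finset.Ioc 0 (X / d), (z ^ d) ^ m : ℝ) : ℂ) := by
    have h := sum_Ioc_sum_divisorsAntidiagonal
      (fun d m : ℕ => χ (d : ZMod t) * (((z ^ d) ^ m : ℝ) : ℂ)) X
    have h' : ∀ d : ℕ, χ (d : ZMod t) * ((∑ m ∈ Finset.Ioc 0 (X / d), (z ^ d) ^ m : ℝ) : ℂ) =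
        ∑ m ∈ Finset.Ioc 0 (X / d), χ (d : ZMod t) * (((z ^ d) ^ m : ℝ) : ℂ) := by
      intro d
      rw [Complex.ofReal_sum, Finset.mul_sum]
    simp only [h']
    rw [← h]
    refine Finset.sum_congr rfl fun n hn => ?_
    rw [DirichletCharacter.zetaMul, mul_comm (natToArithmeticFunction zeta), mul_apply, Finset.sum_mul]
    refine Finset.sum_congr rfl fun x hx => ?_
    rw [Nat.mem_divisorsAntidiagonal] at hx
    have hx0 : x.1 ≠ 0 ∧ x.2 ≠ 0 := by rw [← mul_ne_zero_iff, hx.1]; exact hx.2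
    rw [← hx.1, hzc]
    simp [toArithmeticFunction, hx0.1, hx0.2, pow_mul]
  have hG : ∀ d ∈ Finset.Ioc 0 X, |(∑ m ∈ Finset.Ioc 0 (X / d), (z ^ d) ^ m) -
      z ^ d / (1 - z ^ d)| ≤ z ^ X / (1 - z) := by
    intro d hd
    rw [Finset.mem_Ioc] at hd
    have hq0 : 0 < z ^ d := by positivity
    have hq1 : z ^ d ≤ z := pow_le_of_le_one hz0.le hz1.le hd.1.ne'
    have h1 : (∑ m ∈ Finset.Ioc 0 (X / d), (z ^ d) ^ m) - z ^ d / (1 - z ^ d) =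
        -((z ^ d) ^ (X / d + 1) / (1 - z ^ d)) := by
      rw [sum_Ioc_eq_sum_range_succ]
      have h3 := mul_neg_geom_sum (z ^ d) (X / d)
      simp only [pow_succ _ (_ : ℕ), ← Finset.sum_mul]
      have h4 : 1 - z ^ d ≠ 0 := by linarith
      rw [eq_neg_iff_add_eq_zero, sub_add, ← sub_div, sub_eq_zero, eq_div_iff h4]
      linear_combination (z ^ d) * h3
    rw [h1, abs_neg, abs_of_nonneg (div_nonneg (by positivity) (by linarith)), ← pow_mul]
    refine div_le_div₀ (by positivity) ?_ (by linarith) (by linarith)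
    exact pow_le_pow_of_le_one hz0.le hz1.le (Nat.lt_mul_div_succ X hd.1).le
  have hE : ‖∑ d ∈ Finset.Ioc 0 X, χ (d : ZMod t) *
      (((∑ m ∈ Finset.Ioc 0 (X / d), (z ^ d) ^ m) - z ^ d / (1 - z ^ d) : ℝ) : ℂ)‖ ≤
      X * z ^ X / (1 - z) := by
    refine (norm_sum_le_of_le (f := fun d : ℕ => _) _ (fun d hd => ?_)).trans (b := ∑ d ∈
      Finset.Ioc 0 X, z ^ X / (1 - z)) ?_
    · rw [norm_mul, Complex.norm_real, Real.norm_eq_abs]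
      have := mul_le_mul (χ.norm_le_one (d : ZMod t)) (hG d hd) (abs_nonneg _) zero_le_one
      rwa [one_mul] at this
    · rw [Finset.sum_const, Nat.card_Ioc, Nat.sub_zero, nsmul_eq_mul, mul_div_assoc]
  have habel := norm_sum_range_smul_le (norm_sum_range_shift_dirichletCharacter_le hχ 1)
    (lambert_sub_antitone hw0 hw1) (lambert_sub_nonneg hz0 hz1) X
  rw [← hz] at habel
  have hz1' : 1 - z ≠ 0 := by linarith
  have hg0 : 1 / (((0 + 1 : ℕ) : ℝ) * (1 - z)) - z ^ (0 + 1) / (1 - z ^ (0 + 1)) = 1 := by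
    rw [zero_add, pow_one, Nat.cast_one, one_mul, ← sub_div, div_self hz1']
  rw [hg0, mul_one] at habel
  set S := ∑ n ∈ Finset.range (X + 1), χ (n : ZMod t) / (n : ℂ) with hS
  have hsplit : ∑ n ∈ Finset.Ioc 0 X, χ.zetaMul n * ((w : ℂ) ^ 2) ^ n =
      (∑ d ∈ Finset.Ioc 0 X, χ (d : ZMod t) *
        (((∑ m ∈ Finset.Ioc 0 (X / d), (z ^ d) ^ m) - z ^ d / (1 - z ^ d) : ℝ) : ℂ)) +
      (S * ((1 / (1 - z) : ℝ) : ℂ) - ∑ i ∈ Finset.range X, (1 / (((i + 1 : ℕ) : ℝ) * (1 - z)) -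
        z ^ (i + 1) / (1 - z ^ (i + 1))) • χ ((1 + i : ℕ) : ZMod t)) := by
    rw [hT, sum_Ioc_eq_sum_range_succ, sum_Ioc_eq_sum_range_succ, hS, Finset.sum_range_succ',
      Nat.cast_zero (R := ℂ), div_zero, add_zero, Finset.sum_mul, ← Finset.sum_sub_distrib,
      ← Finset.sum_add_distrib]
    refine Finset.sum_congr rfl fun i _ => ?_
    rw [Complex.real_smul, add_comm 1 i, ← one_div_mul_one_div, Complex.ofReal_sub,
      Complex.ofReal_sub, Complex.ofReal_mul (1 / _), Complex.ofReal_div 1 (((i + 1 : ℕ) : ℝ)),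
      Complex.ofReal_natCast, Complex.ofReal_one]
    ring
  rw [hsplit]
  have hSL : ‖S‖ ≤ ‖L‖ + 2 * t / ((X + 1 : ℕ) : ℝ) := by
    have h1 := hL (X + 1) (by omega)
    have h2 := norm_le_norm_add_norm_sub L S
    linarith
  have hS' : ‖S * ((1 / (1 - z) : ℝ) : ℂ)‖ ≤
      ‖L‖ / (1 - z) + 2 * t / ((X + 1 : ℕ) : ℝ) / (1 - z) := by
    rw [norm_mul, Complex.norm_real, Real.norm_of_nonneg (one_div_nonneg.2 (by linarith)),
      mul_one_div, ← add_div]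
    exact div_le_div_of_nonneg_right hSL (by linarith)
  have h1 := norm_add_le (∑ d ∈ Finset.Ioc 0 X, χ (d : ZMod t) *
        (((∑ m ∈ Finset.Ioc 0 (X / d), (z ^ d) ^ m) - z ^ d / (1 - z ^ d) : ℝ) : ℂ))
      (S * ((1 / (1 - z) : ℝ) : ℂ) - ∑ i ∈ Finset.range X, (1 / (((i + 1 : ℕ) : ℝ) * (1 - z)) -
        z ^ (i + 1) / (1 - z ^ (i + 1))) • χ ((1 + i : ℕ) : ZMod t))
  have h2 := norm_sub_le (S * ((1 / (1 - z) : ℝ) : ℂ)) (∑ i ∈ Finset.range X,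
    (1 / (((i + 1 : ℕ) : ℝ) * (1 - z)) - z ^ (i + 1) / (1 - z ^ (i + 1))) •
      χ ((1 + i : ℕ) : ZMod t))
  linarith

open scoped ComplexOrder in
theorem sum_pow_sq_le_norm_sum_zetaMul {t : ℕ} {χ : DirichletCharacter ℂ t} (hχ : χ ^ 2 = 1)
    {z : ℝ} (hz : 0 < z) {M X : ℕ} (hX : M ^ 2 ≤ X) :
    ∑ m ∈ Finset.Ioc 0 M, z ^ m ^ 2 ≤ ‖∑ n ∈ Finset.Ioc 0 X, χ.zetaMul n * (z : ℂ) ^ n‖ := by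
  refine le_trans ?_ (Complex.re_le_norm _)
  rw [Complex.re_sum]
  have hre : ∀ n : ℕ, (χ.zetaMul n * (z : ℂ) ^ n).re = (χ.zetaMul n).re * z ^ n := by
    intro n
    rw [← Complex.ofReal_pow, Complex.re_mul_ofReal]
  have hnn : ∀ n : ℕ, 0 ≤ (χ.zetaMul n).re := fun n =>
    (Complex.le_def.1 (DirichletCharacter.zetaMul_nonneg hχ n)).1
  have hinj : Set.InjOn (fun m : ℕ => m ^ 2) (Finset.Ioc 0 M) := by
    intro a _ b _ hab
    exact Nat.pow_left_injective two_ne_zero hab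
  have h1 : ∑ m ∈ Finset.Ioc 0 M, z ^ m ^ 2 ≤
      ∑ m ∈ Finset.Ioc 0 M, (χ.zetaMul (m ^ 2)).re * z ^ m ^ 2 := by
    refine Finset.sum_le_sum fun m hm => ?_
    rw [Finset.mem_Ioc] at hm
    have := (Complex.le_def.1 (one_le_zetaMul_sq hχ hm.1.ne')).1
    rw [Complex.one_re] at this
    exact le_mul_of_one_le_left (by positivity) this
  refine h1.trans ?_
  simp only [hre]
  rw [← Finset.sum_image (f := fun n => (χ.zetaMul n).re * z ^ n) hinj]
  refine Finset.sum_le_sum_of_subset_of_nonneg ?_ fun n _ _ => mul_nonneg (hnn n) (by positivity)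
  intro n hn
  obtain ⟨m, hm, rfl⟩ := Finset.mem_image.1 hn
  rw [Finset.mem_Ioc] at hm ⊢
  exact ⟨pow_pos hm.1 2, (Nat.pow_le_pow_left hm.2 2).trans hX⟩

theorem le_norm_lvalue_of_sq_eq_one {t : ℕ} [NeZero t] {χ : DirichletCharacter ℂ t}
    (hχ : χ ≠ 1) (hχ2 : χ ^ 2 = 1) {L : ℂ}
    (hL : ∀ a : ℕ, 1 ≤ a → ‖L - ∑ n ∈ Finset.range a, χ (n : ZMod t) / n‖ ≤ 2 * t / a) :
    1 / (128 * (t : ℝ)) ≤ ‖L‖ := by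
  have ht : (1 : ℝ) ≤ t := by exact_mod_cast Nat.pos_of_neZero t
  set M : ℕ := 8 * t with hM
  have hMt : (M : ℝ) = 8 * t := by rw [hM]; push_cast; rfl
  set w : ℝ := 1 - 1 / (4 * (M : ℝ) ^ 2) with hw
  have hM1 : (1 : ℝ) ≤ (M : ℝ) ^ 2 := one_le_pow₀ (by linarith)
  have hM4 : 1 / (4 * (M : ℝ) ^ 2) ≤ 1 / 4 := by
    rw [div_le_div_iff₀ (by positivity) (by norm_num)]; linarith
  have hM0 : 0 < 1 / (4 * (M : ℝ) ^ 2) := by positivity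
  have hw0 : 0 < w := by linarith
  have hw1 : w < 1 := by linarith
  have hz0 : 0 < w ^ 2 := by positivity
  have hz1 : w ^ 2 < 1 := by nlinarith
  have hzl : 1 / (4 * (M : ℝ) ^ 2) ≤ 1 - w ^ 2 := by nlinarith
  have hzu : 1 - w ^ 2 ≤ 1 / (2 * (M : ℝ) ^ 2) := by
    have : 1 / (2 * (M : ℝ) ^ 2) = 2 * (1 / (4 * (M : ℝ) ^ 2)) := by field_simp; norm_num
    rw [this]; nlinarith
  have hlow : (M : ℝ) / 2 ≤ ∑ m ∈ Finset.Ioc 0 M, (w ^ 2) ^ m ^ 2 := by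
    have h : ∑ m ∈ Finset.Ioc 0 M, (1 / 2 : ℝ) ≤ ∑ m ∈ Finset.Ioc 0 M, (w ^ 2) ^ m ^ 2 := by
      refine Finset.sum_le_sum fun m hm => ?_
      rw [Finset.mem_Ioc] at hm
      have h1 := one_add_mul_le_pow (a := w ^ 2 - 1) (by linarith) (m ^ 2)
      rw [add_sub_cancel] at h1
      refine le_trans ?_ h1
      have h2 : (m : ℝ) ^ 2 ≤ (M : ℝ) ^ 2 := by gcongr; exact hm.2
      have h3 : (m : ℝ) ^ 2 * (1 - w ^ 2) ≤ (M : ℝ) ^ 2 * (1 / (2 * (M : ℝ) ^ 2)) :=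
        mul_le_mul h2 hzu (by linarith) (by positivity)
      have h4 : (M : ℝ) ^ 2 * (1 / (2 * (M : ℝ) ^ 2)) = 1 / 2 := by
        have : (M : ℝ) ^ 2 ≠ 0 := by positivity
        rw [mul_one_div, mul_comm 2, ← div_div, div_self this]
      push_cast
      linarith
    rw [Finset.sum_const, Nat.card_Ioc, nsmul_eq_mul] at h
    simp only [Nat.sub_zero] at h
    linarith
  have hlim1 : Filter.Tendsto (fun X : ℕ => 2 * (t : ℝ) / ((X + 1 : ℕ) : ℝ)) Filter.atTop
      (nhds 0) :=
    (tendsto_const_div_atTop_nhds_zero_nat (2 * (t : ℝ))).comp (Filter.tendsto_add_atTop_nat 1)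
  have hlim2 : Filter.Tendsto (fun X : ℕ => (X : ℝ) * (w ^ 2) ^ X) Filter.atTop (nhds 0) :=
    tendsto_self_mul_const_pow_of_lt_one hz0.le hz1
  have hlim := ((hlim1.div_const (1 - w ^ 2)).const_add (‖L‖ / (1 - w ^ 2))).add_const (2 * (t : ℝ))
    |>.add (hlim2.div_const (1 - w ^ 2))
  rw [zero_div, add_zero, add_zero] at hlim
  have hle : (M : ℝ) / 2 ≤ ‖L‖ / (1 - w ^ 2) + 2 * t := by
    refine ge_of_tendsto hlim ?_
    filter_upwards [Filter.eventually_ge_atTop (M ^ 2)] with X hX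
    have h1 := sum_pow_sq_le_norm_sum_zetaMul hχ2 hz0 hX
    rw [Complex.ofReal_pow] at h1
    exact (hlow.trans h1).trans (norm_sum_zetaMul_mul_pow_le hχ hL hw0 hw1 X)
  have hL1 : ‖L‖ / (1 - w ^ 2) ≤ ‖L‖ * (4 * (M : ℝ) ^ 2) := by
    rw [div_eq_mul_inv]
    refine mul_le_mul_of_nonneg_left ?_ (norm_nonneg _)
    rw [inv_le_comm₀ (by linarith) (by positivity), ← one_div]
    exact hzl
  rw [hMt] at hL1 hle
  rw [div_le_iff₀ (by positivity)]
  nlinarith [norm_nonneg L]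

theorem le_norm_lvalue {t : ℕ} [NeZero t] {χ : DirichletCharacter ℂ t} (hχ : χ ≠ 1) {L : ℂ}
    (hL : ∀ a : ℕ, 1 ≤ a → ‖L - ∑ n ∈ Finset.range a, χ (n : ZMod t) / n‖ ≤ 2 * t / a) :
    1 / (8192 * (t : ℝ) ^ 4) ≤ ‖L‖ := by
  by_cases hχ2 : χ ^ 2 = 1
  · refine le_trans ?_ (le_norm_lvalue_of_sq_eq_one hχ hχ2 hL)
    have ht : (1 : ℝ) ≤ t := by exact_mod_cast Nat.pos_of_neZero t
    have h3 : (1 : ℝ) ≤ (t : ℝ) ^ 3 := one_le_pow₀ ht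
    refine one_div_le_one_div_of_le (by positivity) ?_
    nlinarith
  · exact le_norm_lvalue_of_sq_ne_one hχ2 hL

open ArithmeticFunction in
theorem sum_divisorsAntidiagonal_vonMangoldt_fst (n : ℕ) :
    ∑ x ∈ n.divisorsAntidiagonal, vonMangoldt x.1 = Real.log n :=
  (Nat.sum_divisorsAntidiagonal (fun d _ => vonMangoldt d)).trans vonMangoldt_sum

open ArithmeticFunction in
theorem sum_vonMangoldt_le (N : ℕ) : ∑ n ∈ Finset.Ioc 0 N, vonMangoldt n ≤ 6 * N := by
  have h := Chebyshev.psi_le_const_mul_self (Nat.cast_nonneg (α := ℝ) N)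
  rw [Chebyshev.psi, Nat.floor_natCast] at h
  refine h.trans (mul_le_mul_of_nonneg_right ?_ (Nat.cast_nonneg N))
  have : Real.log 4 = 2 * Real.log 2 := by
    rw [show (4 : ℝ) = 2 ^ 2 by norm_num, Real.log_pow, Nat.cast_ofNat]
  linarith [Real.log_two_lt_d9]

open ArithmeticFunction in
theorem abs_sum_vonMangoldt_div_sub_log_le {N : ℕ} (hN : 1 ≤ N) :
    |∑ n ∈ Finset.Ioc 0 N, vonMangoldt n / n - Real.log N| ≤ 6 := by
  have hN0 : (0 : ℝ) < N := by exact_mod_cast hN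
  have hfact : Real.log (N.factorial : ℝ) = ∑ n ∈ Finset.Ioc 0 N, vonMangoldt n * (N / n : ℕ) := by
    have h := sum_Ioc_sum_divisorsAntidiagonal (fun d _ : ℕ => vonMangoldt d) N
    simp only [Finset.sum_const, Nat.card_Ioc, Nat.sub_zero, nsmul_eq_mul] at h
    simp only [mul_comm (vonMangoldt _)]
    rw [← h, ← Finset.prod_range_add_one_eq_factorial, Nat.cast_prod, Real.log_prod
      (fun i _ => by positivity), sum_Ioc_eq_sum_range_succ]
    refine Finset.sum_congr rfl fun i _ => ?_
    rw [sum_divisorsAntidiagonal_vonMangoldt_fst]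
  have hup : Real.log (N.factorial : ℝ) ≤ N * Real.log N := by
    rw [← Real.log_pow]
    refine Real.log_le_log (by exact_mod_cast N.factorial_pos) ?_
    exact_mod_cast N.factorial_le_pow
  have hlo : N * Real.log N - N ≤ Real.log (N.factorial : ℝ) := by
    have h := Real.log_le_log (by positivity) (Real.pow_div_factorial_le_exp _ hN0.le N)
    rw [Real.log_exp, Real.log_div (by positivity) (by positivity), Real.log_pow] at h
    linarith
  have h1 : ∑ n ∈ Finset.Ioc 0 N, vonMangoldt n * (N / n : ℕ) ≤
      N * ∑ n ∈ Finset.Ioc 0 N, vonMangoldt n / n := by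
    rw [Finset.mul_sum]
    refine Finset.sum_le_sum fun n _ => ?_
    have := mul_le_mul_of_nonneg_left (Nat.cast_div_le (α := ℝ) (m := N) (n := n))
      (vonMangoldt_nonneg (n := n))
    refine this.trans (le_of_eq ?_)
    ring
  have h2 : N * ∑ n ∈ Finset.Ioc 0 N, vonMangoldt n / n ≤
      ∑ n ∈ Finset.Ioc 0 N, vonMangoldt n * (N / n : ℕ) + 6 * N := by
    refine le_trans ?_ (add_le_add_right (sum_vonMangoldt_le N) _)
    rw [Finset.mul_sum, ← Finset.sum_add_distrib]
    refine Finset.sum_le_sum fun n hn => ?_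
    rw [Finset.mem_Ioc] at hn
    have hn0 : (0 : ℝ) < n := by exact_mod_cast hn.1
    have h3 : (N : ℝ) / n ≤ (N / n : ℕ) + 1 := by
      rw [div_le_iff₀ hn0]
      exact_mod_cast (by rw [mul_comm]; exact (Nat.lt_mul_div_succ N hn.1).le)
    have := mul_le_mul_of_nonneg_left h3 (vonMangoldt_nonneg (n := n))
    calc (N : ℝ) * (vonMangoldt n / n) = vonMangoldt n * (N / n) := by ring
      _ ≤ _ := this
      _ = _ := by ring
  set A := ∑ n ∈ Finset.Ioc 0 N, vonMangoldt n / (n : ℝ)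
  rw [abs_le]
  constructor
  · have : N * (Real.log N - 1) ≤ N * A := by linarith
    linarith [le_of_mul_le_mul_left this hN0]
  · have : N * A ≤ N * (Real.log N + 6) := by linarith
    linarith [le_of_mul_le_mul_left this hN0]

theorem norm_sum_dirichletCharacter_mul_log_div_le {t : ℕ} [NeZero t] {χ : DirichletCharacter ℂ t}
    (hχ : χ ≠ 1) (N : ℕ) :
    ‖∑ n ∈ Finset.Ioc 0 N, χ (n : ZMod t) * (Real.log n / n : ℝ)‖ ≤ 3 * t := by
  have ht : (1 : ℝ) ≤ t := by exact_mod_cast Nat.pos_of_neZero t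
  have h1 : ∀ n : ℕ, Real.log n / n ≤ 1 := by
    intro n
    rcases Nat.eq_zero_or_pos n with rfl | hn
    · simp
    · have hn0 : (0 : ℝ) < n := by exact_mod_cast hn
      rw [div_le_one hn0]
      linarith [Real.log_le_sub_one_of_pos hn0]
  have h0 : ∀ n : ℕ, 0 ≤ Real.log n / n := fun n =>
    div_nonneg (Real.log_natCast_nonneg n) (Nat.cast_nonneg n)
  have hterm : ∀ n : ℕ, ‖χ (n : ZMod t) * (Real.log n / n : ℝ)‖ ≤ 1 := by
    intro n
    rw [norm_mul, Complex.norm_real, Real.norm_of_nonneg (h0 n)]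
    exact mul_le_one₀ (χ.norm_le_one _) (h0 n) (h1 n)
  rw [sum_Ioc_eq_sum_range_succ]
  rcases N with _ | _ | N
  · simp
  · simp
  rw [Finset.sum_range_succ', Finset.sum_range_succ']
  have hab := norm_sum_range_smul_le (g := fun i => Real.log ((3 + i : ℕ) : ℝ) / ((3 + i : ℕ) : ℝ))
    (norm_sum_range_shift_dirichletCharacter_le hχ 3) ?_ (fun n => h0 _) N
  · have h3 : ∑ k ∈ Finset.range N, χ ((k + 1 + 1 + 1 : ℕ) : ZMod t) *
        (Real.log ((k + 1 + 1 + 1 : ℕ) : ℝ) / ((k + 1 + 1 + 1 : ℕ) : ℝ) : ℝ) =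
        ∑ i ∈ Finset.range N, (Real.log ((3 + i : ℕ) : ℝ) / ((3 + i : ℕ) : ℝ)) •
          χ ((3 + i : ℕ) : ZMod t) := by
      refine Finset.sum_congr rfl fun i _ => ?_
      rw [Complex.real_smul, mul_comm, show i + 1 + 1 + 1 = 3 + i by ring]
    rw [h3]
    have h4 : χ ((0 + 1 : ℕ) : ZMod t) * (Real.log ((0 + 1 : ℕ) : ℝ) / ((0 + 1 : ℕ) : ℝ) : ℝ) = 0 := by
      simp
    rw [h4, add_zero]
    refine (norm_add_le _ _).trans ?_
    have h5 := hterm (0 + 1 + 1)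
    have h6 : 2 * (t : ℝ) * (Real.log ((3 + 0 : ℕ) : ℝ) / ((3 + 0 : ℕ) : ℝ)) ≤ 2 * t * 1 :=
      mul_le_mul_of_nonneg_left (h1 _) (by positivity)
    linarith
  · intro i j hij
    have he : ∀ k : ℕ, Real.exp 1 ≤ ((3 + k : ℕ) : ℝ) := by
      intro k
      push_cast
      linarith [Real.exp_one_lt_d9, (Nat.cast_nonneg k : (0 : ℝ) ≤ k)]
    exact Real.log_div_self_antitoneOn (he i) (he j) (by exact_mod_cast (by omega : 3 + i ≤ 3 + j))

open ArithmeticFunction in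
theorem norm_sum_dirichletCharacter_mul_vonMangoldt_div_le {t : ℕ} [NeZero t]
    {χ : DirichletCharacter ℂ t} (hχ : χ ≠ 1) {N : ℕ} (hN : 1 ≤ N) :
    ‖∑ n ∈ Finset.Ioc 0 N, χ (n : ZMod t) * (vonMangoldt n / n : ℝ)‖ ≤ 122880 * (t : ℝ) ^ 5 := by
  obtain ⟨L, hL⟩ := exists_norm_sub_sum_dirichletCharacter_div_le hχ
  have hN0 : (0 : ℝ) < N := by exact_mod_cast hN
  have hlb := le_norm_lvalue hχ hL
  have ht : (1 : ℝ) ≤ t := by exact_mod_cast Nat.pos_of_neZero t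
  set A := ∑ n ∈ Finset.Ioc 0 N, χ (n : ZMod t) * (vonMangoldt n / n : ℝ) with hA
  have hconv : ∑ n ∈ Finset.Ioc 0 N, χ (n : ZMod t) * (Real.log n / n : ℝ) =
      ∑ d ∈ Finset.Ioc 0 N, χ (d : ZMod t) * (vonMangoldt d / d : ℝ) *
        ∑ n ∈ Finset.range (N / d + 1), χ (n : ZMod t) / n := by
    have h := sum_Ioc_sum_divisorsAntidiagonal (fun d m : ℕ =>
      χ (d : ZMod t) * (vonMangoldt d / d : ℝ) * (χ (m : ZMod t) / m)) N
    have h' : ∀ d : ℕ, ∑ n ∈ Finset.range (N / d + 1), χ (n : ZMod t) / n =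
        ∑ n ∈ Finset.Ioc 0 (N / d), χ (n : ZMod t) / n := by
      intro d
      rw [Finset.sum_range_succ', sum_Ioc_eq_sum_range_succ]
      simp
    simp only [h', Finset.mul_sum]
    rw [← h]
    refine Finset.sum_congr rfl fun n hn => ?_
    rw [← sum_divisorsAntidiagonal_vonMangoldt_fst,
      Finset.sum_div, Complex.ofReal_sum, Finset.mul_sum]
    refine Finset.sum_congr rfl fun x hx => ?_
    rw [Nat.mem_divisorsAntidiagonal] at hx
    rw [← hx.1]
    push_cast
    rw [map_mul]
    ring
  have herr : ‖∑ d ∈ Finset.Ioc 0 N, χ (d : ZMod t) * (vonMangoldt d / d : ℝ) *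
        (L - ∑ n ∈ Finset.range (N / d + 1), χ (n : ZMod t) / n)‖ ≤ 12 * t := by
    refine (norm_sum_le_of_le (f := fun d : ℕ => _) _ (fun d hd => ?_)).trans (b := ∑ d ∈
      Finset.Ioc 0 N, vonMangoldt d * (2 * t / N)) ?_
    · rw [Finset.mem_Ioc] at hd
      have hd0 : (0 : ℝ) < d := by exact_mod_cast hd.1
      have hnn : 0 ≤ vonMangoldt d / (d : ℝ) := div_nonneg vonMangoldt_nonneg hd0.le
      rw [norm_mul, norm_mul, Complex.norm_real, Real.norm_of_nonneg hnn]
      have h1 := hL (N / d + 1) (Nat.le_add_left 1 _)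
      have h2 : (N : ℝ) / d ≤ ((N / d + 1 : ℕ) : ℝ) := by
        rw [div_le_iff₀ hd0]
        exact_mod_cast (by rw [mul_comm]; exact (Nat.lt_mul_div_succ N hd.1).le)
      have h3 : 2 * (t : ℝ) / ((N / d + 1 : ℕ) : ℝ) ≤ 2 * t / (N / d) :=
        div_le_div_of_nonneg_left (by positivity) (by positivity) h2
      have h4 : ‖χ (d : ZMod t)‖ * (vonMangoldt d / (d : ℝ)) ≤ vonMangoldt d / (d : ℝ) :=
        mul_le_of_le_one_left hnn (χ.norm_le_one _)
      refine (mul_le_mul h4 (h1.trans h3) (norm_nonneg _) hnn).trans (le_of_eq ?_)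
      field_simp
    · rw [← Finset.sum_mul]
      refine (mul_le_mul_of_nonneg_right (sum_vonMangoldt_le N) (by positivity)).trans
        (le_of_eq ?_)
      field_simp
      norm_num
  have hid : L * A = ∑ n ∈ Finset.Ioc 0 N, χ (n : ZMod t) * (Real.log n / n : ℝ) +
      ∑ d ∈ Finset.Ioc 0 N, χ (d : ZMod t) * (vonMangoldt d / d : ℝ) *
        (L - ∑ n ∈ Finset.range (N / d + 1), χ (n : ZMod t) / n) := by
    rw [hconv, ← Finset.sum_add_distrib, hA, Finset.mul_sum]
    refine Finset.sum_congr rfl fun d _ => ?_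
    ring
  have hLA : ‖L‖ * ‖A‖ ≤ 15 * t := by
    rw [← norm_mul, hid]
    have := norm_add_le (∑ n ∈ Finset.Ioc 0 N, χ (n : ZMod t) * (Real.log n / n : ℝ))
      (∑ d ∈ Finset.Ioc 0 N, χ (d : ZMod t) * (vonMangoldt d / d : ℝ) *
        (L - ∑ n ∈ Finset.range (N / d + 1), χ (n : ZMod t) / n))
    linarith [norm_sum_dirichletCharacter_mul_log_div_le hχ N]
  have h1 : 1 / (8192 * (t : ℝ) ^ 4) * ‖A‖ ≤ 15 * t :=
    (mul_le_mul_of_nonneg_right hlb (norm_nonneg _)).trans hLA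
  rw [one_div_mul_eq_div, div_le_iff₀ (by positivity)] at h1
  linarith

open ArithmeticFunction in
theorem exists_sum_vonMangoldt_div_not_prime_le : ∃ K : ℝ, 0 ≤ K ∧ ∀ s : Finset ℕ,
    ∑ n ∈ s, (if n.Prime then 0 else vonMangoldt n / n) ≤ K := by
  have h := vonMangoldt.summable_residueClass_non_primes_div (q := 1) 1
  have heq : ∀ n : ℕ, (if n.Prime then 0 else vonMangoldt.residueClass (1 : ZMod 1) n) / (n : ℝ) =
      if n.Prime then 0 else vonMangoldt n / n := by
    intro n
    have : (n : ZMod 1) = 1 := Subsingleton.elim _ _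
    split_ifs
    · simp
    · simp [vonMangoldt.residueClass, this]
  simp only [heq] at h
  have hnn : ∀ n : ℕ, 0 ≤ if n.Prime then 0 else vonMangoldt n / (n : ℝ) := by
    intro n
    split_ifs
    · exact le_rfl
    · exact div_nonneg vonMangoldt_nonneg (Nat.cast_nonneg n)
  exact ⟨_, tsum_nonneg hnn, fun s => h.sum_le_tsum s fun n _ => hnn n⟩

open ArithmeticFunction in
theorem exists_sum_vonMangoldt_div_not_coprime_le : ∃ K : ℝ, 0 ≤ K ∧ ∀ t N : ℕ, t ≠ 0 →
    ∑ n ∈ (Finset.Ioc 0 N).filter (fun n => ¬ n.Coprime t), vonMangoldt n / n ≤ t + K := by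
  obtain ⟨K, hK0, hK⟩ := exists_sum_vonMangoldt_div_not_prime_le
  refine ⟨K, hK0, fun t N ht => ?_⟩
  have h1 : ∀ n ∈ (Finset.Ioc 0 N).filter (fun n => ¬ n.Coprime t), vonMangoldt n / (n : ℝ) ≤
      (if n ∈ Finset.Ioc 0 t then 1 else 0) + (if n.Prime then 0 else vonMangoldt n / n) := by
    intro n hn
    rw [Finset.mem_filter, Finset.mem_Ioc] at hn
    have h3 : (0 : ℝ) ≤ if n ∈ Finset.Ioc 0 t then 1 else 0 := by split_ifs <;> norm_num
    by_cases hp : n.Prime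
    · rw [hp.coprime_iff_not_dvd, not_not] at hn
      have hn0 : (0 : ℝ) < n := by exact_mod_cast hn.1.1
      rw [if_pos (Finset.mem_Ioc.2 ⟨hn.1.1, Nat.le_of_dvd (Nat.pos_of_ne_zero ht) hn.2⟩), if_pos hp,
        vonMangoldt_apply_prime hp, add_zero, div_le_one hn0]
      linarith [Real.log_le_sub_one_of_pos hn0]
    · rw [if_neg hp]
      linarith
  refine (Finset.sum_le_sum h1).trans ?_
  rw [Finset.sum_add_distrib]
  refine add_le_add ?_ (hK _)
  refine (Finset.sum_le_sum_of_subset_of_nonneg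
    (Finset.subset_union_left (s₂ := Finset.Ioc 0 t)) ?_).trans (b := ∑ n ∈ _ ∪ Finset.Ioc 0 t,
      if n ∈ Finset.Ioc 0 t then (1 : ℝ) else 0) ?_
  · intro _ _ _
    split_ifs <;> norm_num
  · rw [Finset.sum_ite_mem, Finset.inter_eq_right.2 Finset.subset_union_right]
    simp

open ArithmeticFunction in
theorem exists_abs_totient_mul_sum_vonMangoldt_div_sub_log_le : ∃ K : ℝ, 0 ≤ K ∧
    ∀ t N : ℕ, 2 ≤ t → 1 ≤ N →
    |t.totient * (∑ n ∈ (Finset.Ioc 0 N).filter (fun n => n % t = 1), vonMangoldt n / n) -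
      Real.log N| ≤ K * (t : ℝ) ^ 6 := by
  classical
  obtain ⟨K, hK0, hK⟩ := exists_sum_vonMangoldt_div_not_coprime_le
  refine ⟨122880 + (6 + (1 + K)), by positivity, fun t N ht hN => ?_⟩
  have : NeZero t := ⟨by omega⟩
  have ht1 : (1 : ℝ) ≤ t := by exact_mod_cast (by omega : 1 ≤ t)
  have horth : ((t.totient * ∑ n ∈ (Finset.Ioc 0 N).filter (fun n => n % t = 1),
      vonMangoldt n / n : ℝ) : ℂ) =
      ∑ χ : DirichletCharacter ℂ t, ∑ n ∈ Finset.Ioc 0 N,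
        χ (n : ZMod t) * (vonMangoldt n / n : ℝ) := by
    rw [Finset.sum_comm, Finset.sum_filter, Complex.ofReal_mul, Complex.ofReal_sum, Finset.mul_sum]
    refine Finset.sum_congr rfl fun n _ => ?_
    rw [← Finset.sum_mul, DirichletCharacter.sum_characters_eq]
    have hiff : (n : ZMod t) = 1 ↔ n % t = 1 := by
      rw [← Nat.cast_one, ZMod.natCast_eq_natCast_iff', Nat.mod_eq_of_lt (by omega : 1 < t)]
    by_cases h : n % t = 1
    · rw [if_pos h, if_pos (hiff.2 h), Complex.ofReal_natCast]
    · rw [if_neg h, if_neg fun h' => h (hiff.1 h')]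
      simp
  rw [← Finset.add_sum_erase _ _ (Finset.mem_univ (1 : DirichletCharacter ℂ t))] at horth
  have hprinc : ∑ n ∈ Finset.Ioc 0 N, (1 : DirichletCharacter ℂ t) (n : ZMod t) *
      (vonMangoldt n / n : ℝ) = ((∑ n ∈ Finset.Ioc 0 N, vonMangoldt n / n -
        ∑ n ∈ (Finset.Ioc 0 N).filter (fun n => ¬ n.Coprime t), vonMangoldt n / n : ℝ) : ℂ) := by
    rw [← Finset.sum_filter_add_sum_filter_not (Finset.Ioc 0 N) (fun n => n.Coprime t)
      (fun n => vonMangoldt n / (n : ℝ)), add_sub_cancel_right, Complex.ofReal_sum,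
      Finset.sum_filter]
    refine Finset.sum_congr rfl fun n _ => ?_
    by_cases h : n.Coprime t
    · rw [if_pos h, MulChar.one_apply ((ZMod.isUnit_iff_coprime n t).2 h), one_mul]
    · rw [if_neg h, MulChar.map_nonunit _ (fun h' => h ((ZMod.isUnit_iff_coprime n t).1 h')),
        zero_mul]
  set T := t.totient * ∑ n ∈ (Finset.Ioc 0 N).filter (fun n => n % t = 1), vonMangoldt n / (n : ℝ)
  set A := ∑ n ∈ Finset.Ioc 0 N, vonMangoldt n / (n : ℝ)
  set D := ∑ n ∈ (Finset.Ioc 0 N).filter (fun n => ¬ n.Coprime t), vonMangoldt n / (n : ℝ)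
  have hA : |A - Real.log N| ≤ 6 := abs_sum_vonMangoldt_div_sub_log_le hN
  have hD : D ≤ t + K := hK t N (by omega)
  have hD0 : 0 ≤ D := Finset.sum_nonneg fun n _ => div_nonneg vonMangoldt_nonneg (Nat.cast_nonneg n)
  have hrest : |T - (A - D)| ≤ t * (122880 * (t : ℝ) ^ 5) := by
    rw [← Real.norm_eq_abs, ← Complex.norm_real, Complex.ofReal_sub, horth, hprinc,
      add_sub_cancel_left]
    refine (norm_sum_le_of_le _ fun χ hχ =>
      norm_sum_dirichletCharacter_mul_vonMangoldt_div_le (Finset.ne_of_mem_erase hχ) hN).trans ?_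
    rw [Finset.sum_const, nsmul_eq_mul]
    refine mul_le_mul_of_nonneg_right ?_ (by positivity)
    have h1 : Fintype.card (DirichletCharacter ℂ t) = t.totient := by
      rw [← Nat.card_eq_fintype_card, DirichletCharacter.card_eq_totient_of_hasEnoughRootsOfUnity]
    have h2 : (Finset.univ.erase (1 : DirichletCharacter ℂ t)).card ≤ t := by
      refine (Finset.card_erase_le).trans ?_
      rw [Finset.card_univ, h1]
      exact Nat.totient_le t
    exact_mod_cast h2
  have ht6 : (t : ℝ) ≤ (t : ℝ) ^ 6 := le_self_pow₀ ht1 (by norm_num)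
  have ht6' : (1 : ℝ) ≤ (t : ℝ) ^ 6 := one_le_pow₀ ht1
  rw [abs_le] at hA hrest ⊢
  constructor <;> nlinarith

open ArithmeticFunction in
theorem exists_abs_totient_mul_sum_log_div_sub_log_le : ∃ K : ℝ, 0 ≤ K ∧
    ∀ t N : ℕ, 2 ≤ t → 1 ≤ N →
    |t.totient * (∑ p ∈ (Finset.Ioc 0 N).filter (fun p => p.Prime ∧ p % t = 1), Real.log p / p) -
      Real.log N| ≤ K * (t : ℝ) ^ 6 := by
  obtain ⟨K₁, hK₁0, hK₁⟩ := exists_sum_vonMangoldt_div_not_prime_le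
  obtain ⟨K₂, hK₂0, hK₂⟩ := exists_abs_totient_mul_sum_vonMangoldt_div_sub_log_le
  refine ⟨K₁ + K₂, by positivity, fun t N ht hN => ?_⟩
  have ht1 : (1 : ℝ) ≤ t := by exact_mod_cast (by omega : 1 ≤ t)
  have hsplit : ∑ n ∈ (Finset.Ioc 0 N).filter (fun n => n % t = 1), vonMangoldt n / (n : ℝ) =
      (∑ p ∈ (Finset.Ioc 0 N).filter (fun p => p.Prime ∧ p % t = 1), Real.log p / p) +
      ∑ n ∈ (Finset.Ioc 0 N).filter (fun n => n % t = 1),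
        (if n.Prime then 0 else vonMangoldt n / (n : ℝ)) := by
    simp only [and_comm (a := Nat.Prime _)]
    rw [← Finset.filter_filter, Finset.sum_filter (fun p : ℕ => p.Prime), ← Finset.sum_add_distrib]
    refine Finset.sum_congr rfl fun n _ => ?_
    split_ifs with hp
    · rw [vonMangoldt_apply_prime hp, add_zero]
    · rw [zero_add]
  have h1 := hK₂ t N ht hN
  have h2 := hK₁ ((Finset.Ioc 0 N).filter (fun n => n % t = 1))
  have h3 : 0 ≤ ∑ n ∈ (Finset.Ioc 0 N).filter (fun n => n % t = 1),
        (if n.Prime then 0 else vonMangoldt n / (n : ℝ)) := by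
    refine Finset.sum_nonneg fun n _ => ?_
    split_ifs
    · exact le_rfl
    · exact div_nonneg vonMangoldt_nonneg (Nat.cast_nonneg n)
  rw [hsplit, mul_add] at h1
  have hφ : (t.totient : ℝ) ≤ t := by exact_mod_cast Nat.totient_le t
  have h4 := mul_le_mul hφ h2 h3 (by linarith)
  have h5 := mul_nonneg (Nat.cast_nonneg (α := ℝ) t.totient) h3
  have ht6 : (t : ℝ) * K₁ ≤ (t : ℝ) ^ 6 * K₁ :=
    mul_le_mul_of_nonneg_right (le_self_pow₀ ht1 (by norm_num)) hK₁0
  rw [abs_le] at h1 ⊢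
  constructor <;> nlinarith

theorem abs_sum_log_succ_sub_div_sub_loglog_le {M : ℕ} (hM : 2 ≤ M) (k : ℕ) :
    |∑ i ∈ Finset.range k, (Real.log ((M + i + 1 : ℕ) : ℝ) - Real.log ((M + i : ℕ) : ℝ)) /
        Real.log ((M + i + 1 : ℕ) : ℝ) -
      (Real.log (Real.log ((M + k : ℕ) : ℝ)) - Real.log (Real.log (M : ℝ)))| ≤
      1 / Real.log M := by
  have hpos : ∀ i : ℕ, 0 < Real.log ((M + i : ℕ) : ℝ) := fun i =>
    Real.log_pos (by exact_mod_cast (by omega : 1 < M + i))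
  have hstep : ∀ i : ℕ,
      (Real.log ((M + i + 1 : ℕ) : ℝ) - Real.log ((M + i : ℕ) : ℝ)) /
          Real.log ((M + i + 1 : ℕ) : ℝ) ≤
        Real.log (Real.log ((M + i + 1 : ℕ) : ℝ)) - Real.log (Real.log ((M + i : ℕ) : ℝ)) ∧
      Real.log (Real.log ((M + i + 1 : ℕ) : ℝ)) - Real.log (Real.log ((M + i : ℕ) : ℝ)) ≤
        (Real.log ((M + i + 1 : ℕ) : ℝ) - Real.log ((M + i : ℕ) : ℝ)) /
          Real.log ((M + i + 1 : ℕ) : ℝ) +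
        (1 / Real.log ((M + i : ℕ) : ℝ) - 1 / Real.log ((M + i + 1 : ℕ) : ℝ)) := by
    intro i
    have ha := hpos i
    have hb := hpos (i + 1)
    have hx : (2 : ℝ) ≤ ((M + i : ℕ) : ℝ) := by exact_mod_cast (by omega : 2 ≤ M + i)
    have hx1 : ((M + i + 1 : ℕ) : ℝ) = ((M + i : ℕ) : ℝ) + 1 := by push_cast; ring
    have hab : Real.log ((M + i : ℕ) : ℝ) ≤ Real.log ((M + i + 1 : ℕ) : ℝ) :=
      Real.log_le_log (by linarith) (by linarith)
    have hab1 : Real.log ((M + i + 1 : ℕ) : ℝ) - Real.log ((M + i : ℕ) : ℝ) ≤ 1 := by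
      rw [← Real.log_div (by linarith) (by linarith)]
      refine (Real.log_le_sub_one_of_pos (div_pos (by linarith) (by linarith))).trans ?_
      rw [hx1, add_div, div_self (by linarith), add_sub_cancel_left, div_le_one (by linarith)]
      linarith
    rw [← add_assoc] at hb
    set a := Real.log ((M + i : ℕ) : ℝ)
    set b := Real.log ((M + i + 1 : ℕ) : ℝ)
    rw [← Real.log_div hb.ne' ha.ne']
    constructor
    · have h := Real.one_sub_inv_le_log_of_pos (div_pos hb ha)
      refine le_trans (le_of_eq ?_) h
      rw [inv_div, sub_div, div_self hb.ne']
    · refine (Real.log_le_sub_one_of_pos (div_pos hb ha)).trans ?_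
      have h1 : b / a - 1 = (b - a) / b + (b - a) * (1 / a - 1 / b) := by field_simp; ring
      rw [h1]
      have h2 : 0 ≤ 1 / a - 1 / b := sub_nonneg.2 (one_div_le_one_div_of_le ha hab)
      have := mul_le_mul_of_nonneg_right hab1 h2
      linarith
  have hl := Finset.sum_le_sum fun i (_ : i ∈ Finset.range k) => (hstep i).1
  have hu := Finset.sum_le_sum fun i (_ : i ∈ Finset.range k) => (hstep i).2
  have ht1 := Finset.sum_range_sub (fun i => Real.log (Real.log ((M + i : ℕ) : ℝ))) k
  have ht2 := Finset.sum_range_sub' (fun i => 1 / Real.log ((M + i : ℕ) : ℝ)) k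
  simp only [← add_assoc, add_zero] at ht1 ht2
  rw [ht1] at hl
  rw [Finset.sum_add_distrib, ht1, ht2] at hu
  have h0 : 0 < 1 / Real.log ((M + k : ℕ) : ℝ) := one_div_pos.2 (hpos k)
  have h1 : 0 < 1 / Real.log (M : ℝ) := one_div_pos.2 (hpos 0)
  rw [abs_le]
  constructor <;> linarith

theorem abs_totient_mul_sum_inv_sub_loglog_le {t : ℕ} {E : ℝ}
    (hE : ∀ N : ℕ, 1 ≤ N → |t.totient * (∑ p ∈ (Finset.Ioc 0 N).filter
      (fun p => p.Prime ∧ p % t = 1), Real.log p / p) - Real.log N| ≤ E)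
    {M : ℕ} (hM : 2 ≤ M) (k : ℕ) :
    |(t.totient * (∑ p ∈ (Finset.range (M + k + 1)).filter (fun p => p.Prime ∧ p % t = 1),
          (1 : ℝ) / p) -
        t.totient * ∑ p ∈ (Finset.range (M + 1)).filter (fun p => p.Prime ∧ p % t = 1),
          (1 : ℝ) / p) -
      (Real.log (Real.log ((M + k : ℕ) : ℝ)) - Real.log (Real.log (M : ℝ)))| ≤
      (2 * E + 1) / Real.log M := by
  have hpos : ∀ i : ℕ, 0 < Real.log ((M + i : ℕ) : ℝ) := fun i =>
    Real.log_pos (by exact_mod_cast (by omega : 1 < M + i))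
  set A : ℕ → ℝ := fun N => t.totient * ∑ p ∈ (Finset.Ioc 0 N).filter
    (fun p => p.Prime ∧ p % t = 1), Real.log p / p with hA
  set S : ℕ → ℝ := fun N => t.totient * ∑ p ∈ (Finset.range (N + 1)).filter
    (fun p => p.Prime ∧ p % t = 1), (1 : ℝ) / p with hS
  set D : ℕ → ℝ := fun N => A N - Real.log N with hD
  have hSA : ∀ i : ℕ, S (M + i + 1) - S (M + i) =
      (A (M + i + 1) - A (M + i)) / Real.log ((M + i + 1 : ℕ) : ℝ) := by
    intro i
    have hne := (hpos (i + 1)).ne'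
    rw [← add_assoc] at hne
    have hS1 : S (M + i + 1) - S (M + i) = t.totient *
        (if (M + i + 1).Prime ∧ (M + i + 1) % t = 1 then 1 / ((M + i + 1 : ℕ) : ℝ) else 0) := by
      simp only [hS, Finset.sum_filter]
      rw [Finset.sum_range_succ _ (M + i + 1), mul_add, add_sub_cancel_left]
    have hA1 : A (M + i + 1) - A (M + i) = t.totient *
        (if (M + i + 1).Prime ∧ (M + i + 1) % t = 1 then
          Real.log ((M + i + 1 : ℕ) : ℝ) / ((M + i + 1 : ℕ) : ℝ) else 0) := by
      simp only [hA, Finset.sum_filter]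
      rw [sum_Ioc_eq_sum_range_succ, sum_Ioc_eq_sum_range_succ, Finset.sum_range_succ _ (M + i),
        mul_add, add_sub_cancel_left]
    rw [hS1, hA1]
    split_ifs
    · field_simp
    · simp
  have hsum : S (M + k) - S M = ∑ i ∈ Finset.range k, (1 / Real.log ((M + i + 1 : ℕ) : ℝ)) •
      (D (M + i + 1) - D (M + i)) +
      ∑ i ∈ Finset.range k, (Real.log ((M + i + 1 : ℕ) : ℝ) - Real.log ((M + i : ℕ) : ℝ)) /
        Real.log ((M + i + 1 : ℕ) : ℝ) := by
    have h := Finset.sum_range_sub (fun i => S (M + i)) k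
    simp only [← add_assoc, add_zero] at h
    rw [← h, ← Finset.sum_add_distrib]
    refine Finset.sum_congr rfl fun i _ => ?_
    rw [hSA, smul_eq_mul, hD]
    ring
  have habel := norm_sum_range_smul_le (z := fun i => D (M + i + 1) - D (M + i)) (B := 2 * E)
    (g := fun i => 1 / Real.log ((M + i + 1 : ℕ) : ℝ)) ?_ ?_
    (fun i => (one_div_pos.2 (hpos (i + 1))).le) k
  · have h1 := abs_sum_log_succ_sub_div_sub_loglog_le hM k
    have hE0 : 0 ≤ E := (abs_nonneg _).trans (hE 1 le_rfl)
    have h2 : 2 * E * (1 / Real.log ((M + 0 + 1 : ℕ) : ℝ)) ≤ 2 * E * (1 / Real.log M) := by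
      refine mul_le_mul_of_nonneg_left (one_div_le_one_div_of_le (hpos 0) ?_) (by positivity)
      refine Real.log_le_log (by exact_mod_cast (by omega : 0 < M)) ?_
      exact_mod_cast (by omega : M ≤ M + 0 + 1)
    rw [Real.norm_eq_abs] at habel
    change |S (M + k) - S M - _| ≤ _
    rw [hsum, add_sub_assoc, add_div, ← mul_one_div (2 * E)]
    refine (abs_add_le _ _).trans (add_le_add (habel.trans ?_) h1)
    exact h2
  · intro n
    have h := Finset.sum_range_sub (fun i => D (M + i)) n
    simp only [← add_assoc, add_zero] at h
    rw [h, Real.norm_eq_abs]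
    refine (abs_sub _ _).trans ?_
    have h1 := hE (M + n) (by omega)
    have h2 := hE M (by omega)
    rw [two_mul]
    exact add_le_add h1 h2
  · intro i j hij
    refine one_div_le_one_div_of_le (hpos (i + 1)) (Real.log_le_log ?_ ?_)
    · exact_mod_cast (by omega : 0 < M + i + 1)
    · exact_mod_cast (by omega : M + i + 1 ≤ M + j + 1)

/-- There is a constant `C > 2` such that for all integers `t ≥ 2` and `N ≥ 3`,
`|φ(t) · Σ_{p prime, p ≤ N, p ≡ 1 (mod t)} 1/p − log log N| ≤ C · log t`. -/
theorem exists_const_totient_sum_inv_primes :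
    ∃ C : ℝ, 2 < C ∧ ∀ t N : ℕ, 2 ≤ t → 3 ≤ N →
      |(t.totient : ℝ) *
          (∑ p ∈ (Finset.range (N + 1)).filter (fun p => p.Prime ∧ p % t = 1),
            (1 : ℝ) / p) -
        Real.log (Real.log N)| ≤ C * Real.log t := by
  obtain ⟨K, hK0, hK⟩ := exists_abs_totient_mul_sum_log_div_sub_log_le
  refine ⟨5007 + 2 * (2 * K + 1), by linarith, fun t N ht hN => ?_⟩
  have htr : (2 : ℝ) ≤ t := by exact_mod_cast ht
  have ht6 : (1 : ℝ) ≤ (t : ℝ) ^ 6 := one_le_pow₀ (by linarith)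
  have hlt : 1 / 2 ≤ Real.log t := by
    have := Real.log_le_log (by norm_num) htr
    linarith [Real.log_two_gt_d9]
  have hlog2 : Real.log 2 ≤ Real.log t := Real.log_le_log (by norm_num) htr
  have hKt : 0 ≤ K * Real.log t := mul_nonneg hK0 (by linarith)
  have hnn : ∀ n : ℕ, 0 ≤ (t.totient : ℝ) *
      ∑ p ∈ (Finset.range (n + 1)).filter (fun p => p.Prime ∧ p % t = 1), (1 : ℝ) / p :=
    fun n => mul_nonneg (Nat.cast_nonneg _) (Finset.sum_nonneg fun _ _ => by positivity)
  have hsmall : ∀ n : ℕ, 3 ≤ n → Real.log n ≤ (t : ℝ) ^ 6 + 1 →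
      0 ≤ Real.log (Real.log n) ∧ Real.log (Real.log n) ≤ 7 * Real.log t := by
    intro n hn hlogn
    have h1 : 1 ≤ Real.log n := by
      rw [Real.le_log_iff_exp_le (by exact_mod_cast (by omega : 0 < n))]
      have : (3 : ℝ) ≤ n := by exact_mod_cast hn
      linarith [Real.exp_one_lt_d9]
    refine ⟨Real.log_nonneg h1, ?_⟩
    have h2 : Real.log n ≤ 2 * (t : ℝ) ^ 6 := by linarith
    have h3 := Real.log_le_log (by linarith) h2
    rw [Real.log_mul (by norm_num) (by positivity), Real.log_pow, Nat.cast_ofNat] at h3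
    linarith
  set M : ℕ := ⌈Real.exp ((t : ℝ) ^ 6)⌉₊ with hM
  have hMl : Real.exp ((t : ℝ) ^ 6) ≤ M := Nat.le_ceil _
  have hM2 : (2 : ℝ) < M := by
    linarith [Real.add_one_le_exp ((t : ℝ) ^ 6),
      pow_le_pow_left₀ (by norm_num : (0 : ℝ) ≤ 2) htr 6]
  have hM3 : 3 ≤ M := by exact_mod_cast hM2
  have hMlog : (t : ℝ) ^ 6 ≤ Real.log M := (Real.le_log_iff_exp_le (by linarith)).2 hMl
  have hMlog' : Real.log M ≤ (t : ℝ) ^ 6 + 1 := by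
    rw [Real.log_le_iff_le_exp (by linarith), Real.exp_add]
    have h1 := Nat.ceil_lt_add_one (Real.exp_pos ((t : ℝ) ^ 6)).le
    have h2 := Real.add_one_le_exp ((t : ℝ) ^ 6)
    nlinarith [Real.exp_one_gt_d9]
  rcases le_total N M with hNM | hNM
  · have hN' : Real.log N ≤ (t : ℝ) ^ 6 + 1 :=
      (Real.log_le_log (by exact_mod_cast (by omega : 0 < N)) (by exact_mod_cast hNM)).trans hMlog'
    obtain ⟨h1, h2⟩ := hsmall N hN hN'
    have h3 := totient_mul_sum_inv_primes_le ht (by omega) hN'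
    have h4 := hnn N
    rw [abs_le]
    constructor <;> linarith
  · obtain ⟨k, rfl⟩ := Nat.exists_eq_add_of_le hNM
    obtain ⟨h1, h2⟩ := hsmall M hM3 hMlog'
    have h3 := totient_mul_sum_inv_primes_le ht (by omega) hMlog'
    have h4 := hnn M
    have h5 := abs_totient_mul_sum_inv_sub_loglog_le (fun n hn => hK t n ht hn)
      (by omega : 2 ≤ M) k
    have h6 : (2 * (K * (t : ℝ) ^ 6) + 1) / Real.log M ≤ 2 * K + 1 := by
      rw [div_le_iff₀ (by linarith)]
      have := mul_le_mul_of_nonneg_left hMlog (by linarith : 0 ≤ 2 * K + 1)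
      linarith
    have h7 := abs_le.1 (h5.trans h6)
    have h8 : 2 * K + 1 ≤ 2 * (2 * K + 1) * Real.log t := by
      have := mul_le_mul_of_nonneg_left hlt (by linarith : 0 ≤ 2 * K + 1)
      linarith
    rw [add_mul, abs_le]
    constructor <;> linarith [h7.1, h7.2]
end
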